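/- arXiv:1603.00936 — 5 statements merged into one kernel-verified Lean document; each statement's English description precedes it below -/
import Mathlib

section
/- Let n, k be positive integers with n ≥ 2k, and let 𝓐 and 𝓑 be cross-intersecting families of k-subsets of [n]. Then |𝓐|·|𝓑| ≤ binom(n-1, k-1)². -/
open Finset
open scoped FinsetFamily

theorem Nat.add_two_choose_mul_choose_le_sq {N j : ℕ} (h : j ≤ N) :
    (N + 2).choose (j + 2) * N.choose j ≤ (N + 1).choose (j + 1) ^ 2 := by
  have h1 := Nat.add_one_mul_choose_eq (N + 1) (j + 1)
  have h2 := Nat.add_one_mul_choose_eq N j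
  generalize (N + 1).choose (j + 1) = Y at *
  generalize (N + 1 + 1).choose (j + 1 + 1) = X at *
  generalize N.choose j = Z at *
  have h3 : X * Z * ((j + 2) * (N + 1)) = Y ^ 2 * ((N + 2) * (j + 1)) := by
    calc X * Z * ((j + 2) * (N + 1)) = (X * (j + 1 + 1)) * ((N + 1) * Z) := by ring
      _ = Y ^ 2 * ((N + 2) * (j + 1)) := by rw [← h1, h2]; ring
  have h4 : (N + 2) * (j + 1) ≤ (j + 2) * (N + 1) := by nlinarith
  refine Nat.le_of_mul_le_mul_right (c := (j + 2) * (N + 1)) ?_ (by positivity)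
  rw [h3]
  gcongr

namespace Finset.Colex

variable {α : Type*} [LinearOrder α]

theorem toColex_lt_toColex_of_forall_lt {s t : Finset α} {x : α} (hx : x ∈ s)
    (ht : ∀ y ∈ t, y < x) : toColex t < toColex s := by
  rw [toColex_lt_toColex]
  exact ⟨fun h => (ht x (h ▸ hx)).false,
    fun y hy _ => ⟨x, hx, fun h => (ht x h).false, (ht y hy).le⟩⟩

theorem exists_isInitSeg_card_eq [Fintype α] (r : ℕ) {m : ℕ}
    (hm : m ≤ (Fintype.card α).choose r) :
    ∃ 𝒞 : Finset (Finset α), IsInitSeg 𝒞 r ∧ #𝒞 = m := by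
  induction m with
  | zero => exact ⟨∅, by simp [IsInitSeg], rfl⟩
  | succ m ih =>
    obtain ⟨𝒞, h𝒞, rfl⟩ := ih (by omega)
    have hne : (powersetCard r univ \ 𝒞).Nonempty := by
      rw [sdiff_nonempty]
      intro h
      have := card_le_card h
      rw [card_powersetCard, card_univ] at this
      omega
    obtain ⟨s, hs, hmin⟩ := exists_min_image _ toColex hne
    simp only [mem_sdiff, mem_powersetCard_univ] at hs hmin
    refine ⟨insert s 𝒞, ⟨?_, ?_⟩, card_insert_of_notMem hs.2⟩
    · intro t ht
      rw [mem_coe, mem_insert] at ht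
      obtain rfl | ht := ht
      exacts [hs.1, h𝒞.1 ht]
    · rintro u t hu ⟨htu, ht⟩
      rw [mem_insert] at hu ⊢
      obtain rfl | hu := hu
      · by_contra! h
        exact (hmin t ⟨ht, h.2⟩).not_gt htu
      · exact .inr (h𝒞.2 hu ⟨htu, ht⟩)

theorem IsInitSeg.forall_lt_of_card_le [LocallyFiniteOrderBot α] {𝒞 : Finset (Finset α)} {r : ℕ}
    (h𝒞 : IsInitSeg 𝒞 r) {b : α} (hcard : #𝒞 ≤ (#(Iio b)).choose r) {s : Finset α} (hs : s ∈ 𝒞) :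
    ∀ x ∈ s, x < b := by
  by_contra! ⟨x, hx, hbx⟩
  have hsub : powersetCard r (Iio b) ⊆ 𝒞.erase s := by
    intro t ht
    rw [mem_powersetCard] at ht
    have hlt : ∀ y ∈ t, y < x := fun y hy => (mem_Iio.1 (ht.1 hy)).trans_le hbx
    refine mem_erase.2 ⟨fun h => (hlt x (h ▸ hx)).false, ?_⟩
    exact h𝒞.2 hs ⟨toColex_lt_toColex_of_forall_lt hx hlt, ht.2⟩
  have h1 := card_le_card hsub
  have h2 := card_erase_lt_of_mem hs
  rw [card_powersetCard] at h1
  omega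

theorem IsInitSeg.powersetCard_Iio_subset [LocallyFiniteOrderBot α] {𝒞 : Finset (Finset α)} {r : ℕ}
    (h𝒞 : IsInitSeg 𝒞 r) {a : α} (hcard : (#(Iio a)).choose r ≤ #𝒞) :
    powersetCard r (Iio a) ⊆ 𝒞 := by
  have key : ∀ s ∈ 𝒞, s ∉ powersetCard r (Iio a) → powersetCard r (Iio a) ⊆ 𝒞 := by
    intro s hs hsa t ht
    rw [mem_powersetCard] at ht hsa
    obtain ⟨x, hx, hax⟩ := not_subset.1 fun h => hsa ⟨h, h𝒞.1 hs⟩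
    rw [mem_Iio, not_lt] at hax
    exact h𝒞.2 hs ⟨toColex_lt_toColex_of_forall_lt hx
      fun y hy => (mem_Iio.1 (ht.1 hy)).trans_le hax, ht.2⟩
  by_cases h : 𝒞 ⊆ powersetCard r (Iio a)
  · rw [eq_of_subset_of_card_le h (by rwa [card_powersetCard])]
  · obtain ⟨s, hs, hsa⟩ := not_subset.1 h
    exact key s hs hsa

theorem IsInitSeg.card_add_choose_le_card_shadow_iterate {m d : ℕ}
    {𝒞 : Finset (Finset (Fin (2 * m + d + 2)))} (h𝒞 : IsInitSeg 𝒞 (m + d + 1))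
    (hlow : (2 * m + d).choose (m + d + 1) < #𝒞)
    (hupp : #𝒞 ≤ (2 * m + d + 1).choose (m + d + 1)) :
    #𝒞 + (2 * m + d).choose (m + 1) ≤ #(∂^[d] 𝒞) + (2 * m + d).choose (m + d + 1) := by
  obtain ⟨a, ha⟩ : ∃ a : Fin (2 * m + d + 2), (a : ℕ) = 2 * m + d := ⟨⟨2 * m + d, by omega⟩, rfl⟩
  obtain ⟨b, hb⟩ : ∃ b : Fin (2 * m + d + 2), (b : ℕ) = 2 * m + d + 1 :=
    ⟨⟨2 * m + d + 1, by omega⟩, rfl⟩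
  have hsb : ∀ s ∈ 𝒞, s ⊆ Iio b := fun s hs x hx =>
    mem_Iio.2 (h𝒞.forall_lt_of_card_le (by rwa [Fin.card_Iio, hb]) hs x hx)
  have hL := h𝒞.powersetCard_Iio_subset (a := a) (by rw [Fin.card_Iio, ha]; exact hlow.le)
  have hsL : ∀ s ∈ 𝒞, a ∉ s → s ∈ powersetCard (m + d + 1) (Iio a) := by
    intro s hs has
    refine mem_powersetCard.2 ⟨fun x hx => ?_, h𝒞.1 hs⟩
    have h1 := mem_Iio.1 (hsb s hs hx)
    have h2 : x ≠ a := fun h => has (h ▸ hx)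
    rw [mem_Iio]
    rw [Fin.lt_def] at h1 ⊢
    have := Fin.val_ne_of_ne h2
    omega
  have hD0 : powersetCard (m + 1) (Iio a) ⊆ {t ∈ ∂^[d] 𝒞 | a ∉ t} := by
    intro t ht
    rw [mem_powersetCard] at ht
    refine mem_filter.2 ⟨?_, fun h => (mem_Iio.1 (ht.1 h)).false⟩
    rw [mem_shadow_iterate_iff_exists_mem_card_add]
    rcases Nat.eq_zero_or_pos m with rfl | hm
    · obtain ⟨s, hs⟩ : 𝒞.Nonempty := card_pos.1 (by omega)
      have hsU : s = Iio b := eq_of_subset_of_card_le (hsb s hs) (by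
        rw [h𝒞.1 hs, Fin.card_Iio, hb])
      refine ⟨s, hs, ?_, by rw [h𝒞.1 hs, ht.2]; omega⟩
      rw [hsU]
      refine ht.1.trans (Iio_subset_Iio ?_)
      rw [Fin.le_def]; omega
    · obtain ⟨s, hts, hs, hc⟩ := exists_subsuperset_card_eq (n := m + d + 1) ht.1
        (by omega) (by rw [Fin.card_Iio, ha]; omega)
      exact ⟨s, hL (mem_powersetCard.2 ⟨hs, hc⟩), hts, by omega⟩
  have hC0 : #{s ∈ 𝒞 | a ∉ s} ≤ (2 * m + d).choose (m + d + 1) := by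
    have : {s ∈ 𝒞 | a ∉ s} ⊆ powersetCard (m + d + 1) (Iio a) := fun s hs =>
      hsL s (mem_filter.1 hs).1 (mem_filter.1 hs).2
    simpa [ha] using card_le_card this
  have hD0' := card_le_card hD0
  rw [card_powersetCard, Fin.card_Iio, ha] at hD0'
  have hcount : #{s ∈ 𝒞 | a ∈ s} ≤ #{t ∈ ∂^[d] 𝒞 | a ∈ t} := by
    refine Nat.le_of_mul_le_mul_right (c := (m + d).choose m) ?_ (Nat.choose_pos (by omega))
    refine card_mul_le_card_mul (fun s t => t ⊆ s) ?_ ?_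
    · intro s hs
      rw [mem_filter] at hs
      have hcs : #(s.erase a) = m + d := by rw [card_erase_of_mem hs.2, h𝒞.1 hs.1]; rfl
      rw [← hcs, ← card_powersetCard]
      refine card_le_card_of_injOn (insert a) ?_ ?_
      · intro t ht
        rw [mem_coe, mem_powersetCard] at ht
        have hat : a ∉ t := fun h => notMem_erase a s (ht.1 h)
        have hts : insert a t ⊆ s := insert_subset hs.2 (ht.1.trans (erase_subset _ _))
        rw [mem_coe, mem_bipartiteAbove, mem_filter, mem_shadow_iterate_iff_exists_mem_card_add]
        refine ⟨⟨⟨s, hs.1, hts, ?_⟩, mem_insert_self _ _⟩, hts⟩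
        rw [h𝒞.1 hs.1, card_insert_of_notMem hat]
        omega
      · intro t ht u hu htu
        rw [mem_coe, mem_powersetCard] at ht hu
        rw [← erase_insert (fun h => notMem_erase a s (ht.1 h)),
          ← erase_insert (fun h => notMem_erase a s (hu.1 h)), htu]
    · intro t ht
      rw [mem_filter, mem_shadow_iterate_iff_exists_mem_card_add] at ht
      obtain ⟨⟨s₀, hs₀, hts₀, hc₀⟩, -⟩ := ht
      rw [h𝒞.1 hs₀] at hc₀
      have hct : #(Iio b \ t) = m + d := by
        rw [card_sdiff_of_subset (hts₀.trans (hsb s₀ hs₀)), Fin.card_Iio, hb]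
        omega
      rw [Nat.choose_symm_add, ← hct, ← card_powersetCard]
      refine card_le_card_of_injOn (· \ t) ?_ ?_
      · intro s hs
        rw [mem_coe, mem_bipartiteBelow, mem_filter] at hs
        rw [mem_coe, mem_powersetCard]
        refine ⟨sdiff_subset_sdiff (hsb s hs.1.1) subset_rfl, ?_⟩
        rw [card_sdiff_of_subset hs.2, h𝒞.1 hs.1.1]
        omega
      · intro s hs u hu hsu
        rw [mem_coe, mem_bipartiteBelow] at hs hu
        rw [← sdiff_union_of_subset hs.2, ← sdiff_union_of_subset hu.2]
        exact congrArg (· ∪ t) hsu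
  have h1 := card_filter_add_card_filter_not (s := 𝒞) (fun s => a ∈ s)
  have h2 := card_filter_add_card_filter_not (s := ∂^[d] 𝒞) (fun s => a ∈ s)
  omega

end Finset.Colex

namespace Finset

theorem card_add_card_le_of_cross_intersecting {m d : ℕ}
    {𝒜 ℬ : Finset (Finset (Fin (2 * m + d + 2)))}
    (h𝒜 : (𝒜 : Set (Finset (Fin (2 * m + d + 2)))).Sized (m + 1))
    (hℬ : (ℬ : Set (Finset (Fin (2 * m + d + 2)))).Sized (m + 1))
    (hcross : ∀ A ∈ 𝒜, ∀ B ∈ ℬ, (A ∩ B).Nonempty)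
    (hlow : (2 * m + d).choose (m + d + 1) < #ℬ)
    (hupp : #ℬ ≤ (2 * m + d + 1).choose m) :
    #𝒜 + #ℬ ≤ 2 * (2 * m + d + 1).choose m := by
  have hsymm : (2 * m + d + 1).choose m = (2 * m + d + 1).choose (m + d + 1) :=
    Nat.choose_symm_of_eq_add (by omega)
  have hcompl : (ℬᶜˢ : Set (Finset (Fin (2 * m + d + 2)))).Sized (m + d + 1) := by
    intro s hs
    rw [mem_coe, mem_compls] at hs
    have h1 := hℬ hs
    rw [card_compl, Fintype.card_fin] at h1
    omega
  have hpascal₁ : (2 * m + d + 2).choose (m + 1) =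
      (2 * m + d + 1).choose m + (2 * m + d + 1).choose (m + 1) := Nat.choose_succ_succ _ _
  have hpascal₂ : (2 * m + d + 1).choose (m + 1) =
      (2 * m + d).choose m + (2 * m + d).choose (m + 1) := Nat.choose_succ_succ _ _
  have hpascal₃ : (2 * m + d + 1).choose (m + d + 1) =
      (2 * m + d).choose (m + d) + (2 * m + d).choose (m + d + 1) := Nat.choose_succ_succ _ _
  have hsymm' : (2 * m + d).choose m = (2 * m + d).choose (m + d) :=
    Nat.choose_symm_of_eq_add (by omega)
  have hsymm₂ : (2 * m + d + 2).choose (m + 1) = (2 * m + d + 2).choose (m + d + 1) :=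
    Nat.choose_symm_of_eq_add (by omega)
  obtain ⟨𝒞, h𝒞, hcard⟩ := Colex.exists_isInitSeg_card_eq (α := Fin (2 * m + d + 2)) (m + d + 1)
    (m := #ℬ) (by rw [Fintype.card_fin]; omega)
  have hKK := iterated_kk (k := d) hcompl (by rw [card_compls, hcard]) h𝒞
  have hshadow := h𝒞.card_add_choose_le_card_shadow_iterate (by omega) (by omega)
  have hdisj : Disjoint 𝒜 (∂^[d] ℬᶜˢ) := by
    rw [disjoint_left]
    intro t ht ht'
    obtain ⟨s, hs, hts, -⟩ := mem_shadow_iterate_iff_exists_mem_card_add.1 ht'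
    obtain ⟨x, hx⟩ := hcross t ht _ (mem_compls.1 hs)
    rw [mem_inter, mem_compl] at hx
    exact hx.2 (hts hx.1)
  have hsub : 𝒜 ∪ ∂^[d] ℬᶜˢ ⊆ powersetCard (m + 1) univ := by
    intro t ht
    rw [mem_powersetCard_univ]
    obtain ht | ht := mem_union.1 ht
    · exact h𝒜 ht
    · obtain ⟨s, hs, -, hc⟩ := mem_shadow_iterate_iff_exists_mem_card_add.1 ht
      rw [hcompl hs] at hc
      omega
  have htotal := card_le_card hsub
  rw [card_union_of_disjoint hdisj, card_powersetCard, card_fin] at htotal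
  omega

theorem card_mul_card_le_of_cross_intersecting {m d : ℕ}
    {𝒜 ℬ : Finset (Finset (Fin (2 * m + d + 2)))}
    (h𝒜 : (𝒜 : Set (Finset (Fin (2 * m + d + 2)))).Sized (m + 1))
    (hℬ : (ℬ : Set (Finset (Fin (2 * m + d + 2)))).Sized (m + 1))
    (hcross : ∀ A ∈ 𝒜, ∀ B ∈ ℬ, (A ∩ B).Nonempty) :
    #𝒜 * #ℬ ≤ (2 * m + d + 1).choose m ^ 2 := by
  wlog hle : #ℬ ≤ #𝒜 generalizing 𝒜 ℬ
  · rw [mul_comm]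
    exact this hℬ h𝒜 (fun B hB A hA => inter_comm A B ▸ hcross A hA B hB) (by omega)
  rcases le_or_gt #ℬ ((2 * m + d).choose (m + d + 1)) with hlow | hlow
  · have h𝒜card : #𝒜 ≤ (2 * m + d + 2).choose (m + 1) := by
      simpa using h𝒜.card_le
    refine (Nat.mul_le_mul h𝒜card hlow).trans ?_
    cases m with
    | zero => simp
    | succ j =>
      have hsymm : (2 * (j + 1) + d).choose (j + 1 + d + 1) = (2 * (j + 1) + d).choose j :=
        Nat.choose_symm_of_eq_add (by omega)
      rw [hsymm]
      exact Nat.add_two_choose_mul_choose_le_sq (by omega)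
  have hsq : ∀ {x y M : ℕ}, x + y ≤ 2 * M → x * y ≤ M ^ 2 := by
    intro x y M h
    nlinarith [four_mul_le_sq_add x y, Nat.pow_le_pow_left h 2]
  rcases le_total #ℬ ((2 * m + d + 1).choose m) with hupp | hupp
  · exact hsq (card_add_card_le_of_cross_intersecting h𝒜 hℬ hcross hlow hupp)
  · obtain ⟨ℬ', hsub, hcard⟩ := exists_subset_card_eq hupp
    have hpos : 0 < (2 * m + d).choose (m + d) := Nat.choose_pos (by omega)
    have hpascal : (2 * m + d + 1).choose (m + d + 1) =
      (2 * m + d).choose (m + d) + (2 * m + d).choose (m + d + 1) := Nat.choose_succ_succ _ _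
    have hsymm : (2 * m + d + 1).choose m = (2 * m + d + 1).choose (m + d + 1) :=
      Nat.choose_symm_of_eq_add (by omega)
    have := card_add_card_le_of_cross_intersecting h𝒜 (hℬ.mono (coe_subset.2 hsub))
      (fun A hA B hB => hcross A hA B (hsub hB)) (by omega) hcard.le
    exact hsq (by omega)

theorem card_filter_map_mem {α β : Type*} [Fintype α] [DecidableEq β] (e : α ↪ β)
    {𝒜 : Finset (Finset β)} (h : ∀ A ∈ 𝒜, A ⊆ univ.map e) :
    #{s : Finset α | s.map e ∈ 𝒜} = #𝒜 := by
  refine card_bij (fun s _ => s.map e) (fun s hs => (mem_filter.1 hs).2)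
    (fun s _ t _ hst => map_injective e hst) fun A hA => ?_
  obtain ⟨s, -, rfl⟩ := subset_map_iff.1 (h A hA)
  exact ⟨s, by simpa using hA, rfl⟩

end Finset

/-- Pyber's inequality: if `𝓐` and `𝓑` are cross-intersecting families of
`k`-subsets of `[n] = {1,…,n}` with `n ≥ 2k > 0`, then
`|𝓐|·|𝓑| ≤ binom(n-1, k-1)²`. -/
theorem pyber_inequality (n k : ℕ) (hk : 0 < k) (hn : 2 * k ≤ n)
    (𝓐 𝓑 : Finset (Finset ℕ))
    (h𝓐 : ∀ A ∈ 𝓐, A ⊆ Finset.Icc 1 n ∧ A.card = k)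
    (h𝓑 : ∀ B ∈ 𝓑, B ⊆ Finset.Icc 1 n ∧ B.card = k)
    (hcross : ∀ A ∈ 𝓐, ∀ B ∈ 𝓑, (A ∩ B).Nonempty) :
    𝓐.card * 𝓑.card ≤ ((n - 1).choose (k - 1)) ^ 2 := by
  obtain ⟨m, rfl⟩ : ∃ m, k = m + 1 := ⟨k - 1, by omega⟩
  obtain ⟨d, rfl⟩ : ∃ d, n = 2 * m + d + 2 := ⟨n - (2 * m + 2), by omega⟩
  let e : Fin (2 * m + d + 2) ↪ ℕ :=
    ⟨fun i => i + 1, fun i j h => Fin.ext (Nat.succ_injective h)⟩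
  have he : Finset.Icc 1 (2 * m + d + 2) ⊆ Finset.univ.map e := by
    intro x hx
    rw [Finset.mem_Icc] at hx
    exact Finset.mem_map.2 ⟨⟨x - 1, by omega⟩, Finset.mem_univ _, Nat.sub_add_cancel hx.1⟩
  rw [← Finset.card_filter_map_mem e fun A hA => (h𝓐 A hA).1.trans he,
    ← Finset.card_filter_map_mem e fun B hB => (h𝓑 B hB).1.trans he]
  refine Finset.card_mul_card_le_of_cross_intersecting ?_ ?_ ?_
  · intro s hs
    rw [← Finset.card_map e]
    exact (h𝓐 _ (Finset.mem_filter.1 hs).2).2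
  · intro s hs
    rw [← Finset.card_map e]
    exact (h𝓑 _ (Finset.mem_filter.1 hs).2).2
  · intro s hs t ht
    have := hcross _ (Finset.mem_filter.1 hs).2 _ (Finset.mem_filter.1 ht).2
    rwa [← Finset.map_inter, Finset.map_nonempty] at this
end

section
/- Let n, k be integers with n > 2k > 0, and let 𝓐 and 𝓑 be cross-intersecting families of k-subsets of [n] such that |𝓐| ≤ binom(n-1, k-1) ≤ |𝓑| and the intersection of all members of 𝓑 is empty. Then |𝓐|·|𝓑| ≤ (binom(n-1, k-1) + 1)·(binom(n-1, k-1) − binom(n-k-1, k-1)). -/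
namespace CrossIntersecting

open Finset

/-- Every member of the first family meets every member of the second one. -/
def Cross {α : Type*} (𝓐 𝓑 : Finset (Finset α)) : Prop :=
  ∀ A ∈ 𝓐, ∀ B ∈ 𝓑, ¬ Disjoint A B

section General

variable {α : Type*} [DecidableEq α] {G : Finset α} {𝓐 𝓑 : Finset (Finset α)} {s t : ℕ} {x : α}

theorem Cross.member_nonMember (h : Cross 𝓐 𝓑) (x : α) :
    Cross (𝓐.memberSubfamily x) (𝓑.nonMemberSubfamily x) := by
  intro A hA B hB
  rw [mem_memberSubfamily] at hA
  rw [mem_nonMemberSubfamily] at hB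
  have := h _ hA.1 _ hB.1
  rwa [disjoint_insert_left, not_and_or, not_not, or_iff_right hB.2] at this

theorem Cross.nonMember_member (h : Cross 𝓐 𝓑) (x : α) :
    Cross (𝓐.nonMemberSubfamily x) (𝓑.memberSubfamily x) := by
  intro A hA B hB
  rw [mem_memberSubfamily] at hB
  rw [mem_nonMemberSubfamily] at hA
  have := h _ hA.1 _ hB.1
  rwa [disjoint_insert_right, not_and_or, not_not, or_iff_right hA.2] at this

theorem memberSubfamily_subset_powersetCard (h : 𝓐 ⊆ G.powersetCard (s + 1)) (x : α) :
    𝓐.memberSubfamily x ⊆ (G.erase x).powersetCard s := by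
  intro A hA
  rw [mem_memberSubfamily] at hA
  have := mem_powersetCard.1 (h hA.1)
  rw [card_insert_of_notMem hA.2] at this
  refine mem_powersetCard.2 ⟨fun y hy => mem_erase.2 ⟨?_, this.1 (mem_insert_of_mem hy)⟩,
    by lia⟩
  rintro rfl
  exact hA.2 hy

theorem nonMemberSubfamily_subset_powersetCard (h : 𝓐 ⊆ G.powersetCard s) (x : α) :
    𝓐.nonMemberSubfamily x ⊆ (G.erase x).powersetCard s := by
  intro A hA
  rw [mem_nonMemberSubfamily] at hA
  have := mem_powersetCard.1 (h hA.1)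
  exact mem_powersetCard.2 ⟨subset_erase.2 ⟨this.1, hA.2⟩, this.2⟩

/-- Weighted double counting in the disjointness graph between `s`-sets and `t`-sets. -/
theorem Cross.card_mul_choose_add_le (h : Cross 𝓐 𝓑) (hA : 𝓐 ⊆ G.powersetCard s)
    (hB : 𝓑 ⊆ G.powersetCard t) (hst : s + t ≤ #G) :
    #𝓐 * (#G).choose t + #𝓑 * (#G).choose s ≤ (#G).choose s * (#G).choose t := by
  have key : #𝓐 * (#G - s).choose t ≤ #(G.powersetCard t \ 𝓑) * (#G - t).choose s := by
    refine card_mul_le_card_mul (fun A B => Disjoint A B) (fun A hAA => ?_) (fun B hBB => ?_)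
    · obtain ⟨h1, h2⟩ := mem_powersetCard.1 (hA hAA)
      rw [← h2, ← card_sdiff_of_subset h1, ← card_powersetCard]
      refine card_le_card fun B hB => ?_
      obtain ⟨h3, h4⟩ := mem_powersetCard.1 hB
      have h5 : Disjoint A B := disjoint_sdiff.mono_right h3
      rw [mem_bipartiteAbove, mem_sdiff, mem_powersetCard]
      exact ⟨⟨⟨h3.trans sdiff_subset, h4⟩, fun h6 => h A hAA B h6 h5⟩, h5⟩
    · obtain ⟨h1, h2⟩ := mem_powersetCard.1 (mem_sdiff.1 hBB).1
      rw [← h2, ← card_sdiff_of_subset h1, ← card_powersetCard]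
      refine card_le_card fun A hAA => ?_
      rw [mem_bipartiteBelow] at hAA
      obtain ⟨h3, h4⟩ := mem_powersetCard.1 (hA hAA.1)
      exact mem_powersetCard.2 ⟨subset_sdiff.2 ⟨h3, hAA.2⟩, h4⟩
  rw [card_sdiff_of_subset hB, card_powersetCard] at key
  have hBc : #𝓑 ≤ (#G).choose t := by simpa using card_le_card hB
  have hid : (#G).choose s * (#G - s).choose t = (#G).choose t * (#G - t).choose s := by
    have h1 := Nat.choose_mul (n := #G) (k := s + t) (s := s) (Nat.le_add_right s t)
    have h2 := Nat.choose_mul (n := #G) (k := s + t) (s := t) (Nat.le_add_left t s)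
    rw [Nat.add_sub_cancel_left] at h1
    rw [Nat.add_sub_cancel] at h2
    rw [← h1, ← h2, Nat.choose_symm_add]
  have p1 : 0 < (#G).choose s := Nat.choose_pos (by lia)
  have p2 : 0 < (#G - s).choose t := Nat.choose_pos (by lia)
  obtain ⟨d, hd⟩ := Nat.exists_eq_add_of_le hBc
  rw [hd, Nat.add_sub_cancel_left] at key
  have : #𝓐 * (#G).choose t ≤ d * (#G).choose s := by
    refine Nat.le_of_mul_le_mul_right (c := (#G).choose s * (#G - s).choose t) ?_ (by positivity)
    calc #𝓐 * (#G).choose t * ((#G).choose s * (#G - s).choose t)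
        = #𝓐 * (#G - s).choose t * ((#G).choose t * (#G).choose s) := by ring
      _ ≤ d * (#G - t).choose s * ((#G).choose t * (#G).choose s) := by gcongr
      _ = d * (#G).choose s * ((#G).choose t * (#G - t).choose s) := by ring
      _ = _ := by rw [hid]
  calc _ ≤ d * (#G).choose s + #𝓑 * (#G).choose s := by gcongr
    _ = _ := by rw [hd]; ring

theorem choose_le_choose_of_add_le {g s t : ℕ} (hst : s ≤ t) (h : s + t ≤ g) :
    g.choose s ≤ g.choose t := by
  rcases le_total t (g / 2) with h1 | h1
  · induction t, hst using Nat.le_induction with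
    | base => rfl
    | succ m _ ih =>
      exact (ih (by lia) (by lia)).trans (Nat.choose_le_succ_of_lt_half_left (by lia))
  · rw [← Nat.choose_symm (n := g) (k := t) (by lia)]
    have h2 : s ≤ g - t := by lia
    have h3 : g - t ≤ g / 2 ∨ g - t = g / 2 + 1 := by lia
    have mono : ∀ m, s ≤ m → m ≤ g / 2 → g.choose s ≤ g.choose m := by
      intro m hm
      induction m, hm using Nat.le_induction with
      | base => intro _; rfl
      | succ m _ ih =>
        intro h4
        exact (ih (by lia)).trans (Nat.choose_le_succ_of_lt_half_left (by lia))
    rcases h3 with h3 | h3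
    · exact mono _ h2 h3
    · have : t = g / 2 := by lia
      rw [Nat.choose_symm (n := g) (k := t) (by lia), this]
      exact mono _ (by lia) le_rfl

/-- A Hilton–Milner type bound for the sum of the sizes of cross-intersecting families. -/
theorem Cross.card_add_card_le (h : Cross 𝓐 𝓑) {k l : ℕ} (hA : 𝓐 ⊆ G.powersetCard k)
    (hB : 𝓑 ⊆ G.powersetCard l) (hlk : l < k) (hG : k + l ≤ #G) (hne : 𝓑.Nonempty) :
    #𝓐 + #𝓑 + (#G - l).choose k ≤ (#G).choose k + 1 := by
  induction l generalizing G 𝓐 𝓑 with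
  | zero =>
    obtain ⟨B, hBB⟩ := hne
    have hB0 : B = ∅ := card_eq_zero.1 (mem_powersetCard.1 (hB hBB)).2
    have hA0 : #𝓐 = 0 := by
      rw [card_eq_zero, eq_empty_iff_forall_notMem]
      intro A hAA
      exact h A hAA B hBB (by simp [hB0])
    have hB1 : #𝓑 ≤ 1 := by simpa using card_le_card hB
    simp only [Nat.sub_zero]
    lia
  | succ l ih =>
    obtain ⟨B, hBB⟩ := hne
    obtain ⟨h1, h2⟩ := mem_powersetCard.1 (hB hBB)
    obtain ⟨x, hx⟩ : B.Nonempty := card_pos.1 (by lia)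
    obtain ⟨k, rfl⟩ : ∃ k', k = k' + 1 := ⟨k - 1, by lia⟩
    have hg : #(G.erase x) + 1 = #G := card_erase_add_one (h1 hx)
    have e1 := (h.member_nonMember x).card_mul_choose_add_le
      (memberSubfamily_subset_powersetCard hA x) (nonMemberSubfamily_subset_powersetCard hB x)
      (by lia)
    have e2 := ih (h.nonMember_member x) (nonMemberSubfamily_subset_powersetCard hA x)
      (memberSubfamily_subset_powersetCard hB x) (by lia) (by lia)
      ⟨B.erase x, by simp [mem_memberSubfamily, insert_erase hx, hBB]⟩
    have e3 : (#(G.erase x)).choose (l + 1) ≤ (#(G.erase x)).choose k :=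
      choose_le_choose_of_add_le (by lia) (by lia)
    have e4 : 0 < (#(G.erase x)).choose (l + 1) := Nat.choose_pos (by lia)
    have e5 : #(𝓐.memberSubfamily x) + #(𝓑.nonMemberSubfamily x)
        ≤ (#(G.erase x)).choose k := by
      refine Nat.le_of_mul_le_mul_right (c := (#(G.erase x)).choose (l + 1)) ?_ e4
      calc _ = _ := add_mul _ _ _
        _ ≤ _ := Nat.add_le_add_left (Nat.mul_le_mul_left _ e3) _
        _ ≤ _ := e1
    have c1 := card_memberSubfamily_add_card_nonMemberSubfamily x 𝓐
    have c2 := card_memberSubfamily_add_card_nonMemberSubfamily x 𝓑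
    have c3 : (#G).choose (k + 1) = (#(G.erase x)).choose k + (#(G.erase x)).choose (k + 1) := by
      rw [← hg, Nat.choose_succ_succ]
    have c4 : #G - (l + 1) = #(G.erase x) - l := by lia
    rw [c4, c3]
    lia

end General

section Stability

open UV Finset.Colex
open scoped FinsetFamily

theorem mem_or_of_card_eq {n r : ℕ} {F : Finset (Finset (Fin n))} {U V : Finset (Fin n)} {e : Fin n}
    (hF' : 𝓒 U V F = (univ.erase e).powersetCard r) {S : Finset (Fin n)} (hS : #S = r)
    (heS : e ∉ S) : S ∈ F ∨ (U ⊆ S ∧ Disjoint V S ∧ (S ∪ V) \ U ∈ F) := by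
  by_cases hSF : S ∈ F
  · exact Or.inl hSF
  have : S ∈ 𝓒 U V F := by
    rw [hF', mem_powersetCard]
    exact ⟨subset_erase.2 ⟨subset_univ _, heS⟩, hS⟩
  right
  rcases mem_compression.1 this with h | ⟨-, D, hD, hDS⟩
  · exact absurd h.1 hSF
  unfold compress at hDS
  split_ifs at hDS with hc
  · obtain ⟨h1, h2⟩ := hc
    have h2' : V ⊆ D := h2
    have h3 : Disjoint U V := h1.mono_right h2
    have h4 : S = (D ∪ U) \ V := hDS.symm
    refine ⟨?_, ?_, ?_⟩
    · rw [h4]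
      exact subset_sdiff.2 ⟨subset_union_right, h3⟩
    · rw [h4]; exact disjoint_sdiff
    · have : (S ∪ V) \ U = D := by
        rw [h4]
        ext y
        have a1 : y ∈ U → y ∉ D := fun hy => disjoint_left.1 h1 hy
        have a2 := @h2' y
        simp only [mem_sdiff, mem_union]
        tauto
      rwa [this]
  · exact absurd (hDS ▸ hD) hSF

theorem of_mem_of_compression_eq {n r : ℕ} {F : Finset (Finset (Fin n))} {U V : Finset (Fin n)}
    {e : Fin n} (hF' : 𝓒 U V F = (univ.erase e).powersetCard r) {D : Finset (Fin n)}
    (hD : D ∈ F) (heD : e ∈ D) : Disjoint U D ∧ V ⊆ D ∧ (D ∪ U) \ V ∉ F := by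
  have hn : D ∉ 𝓒 U V F := by
    rw [hF', mem_powersetCard, subset_erase]
    exact fun h => h.1.2 heD
  have hc : compress U V D ∉ F := fun h => hn (mem_compression.2 (Or.inl ⟨hD, h⟩))
  unfold compress at hc
  split_ifs at hc with h
  · exact ⟨h.1, h.2, hc⟩
  · exact absurd hD hc

/-- The last compression uses sets with at least two elements. -/
theorem card_shadow_of_compression_eq_of_two_le {n r : ℕ} {F : Finset (Finset (Fin n))}
    {U V : Finset (Fin n)} {e : Fin n} (hr : 0 < r) (hrn : r < n)
    (hFr : (F : Set (Finset (Fin n))).Sized r)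
    (hF' : 𝓒 U V F = (univ.erase e).powersetCard r) (hV : 2 ≤ #V)
    (he : ∃ D ∈ F, e ∈ D) :
    (n - 1).choose (r - 1) + (r - 1) ≤ #(∂ F) := by
  obtain ⟨D, hD, heD⟩ := he
  have hVe : (V.erase e).Nonempty := by
    rw [← card_pos]
    have := pred_card_le_card_erase (s := V) (a := e)
    lia
  have h1 : (univ.erase e).powersetCard (r - 1) ⊆ ∂ F := by
    intro Y hY
    obtain ⟨hY1, hY2⟩ := mem_powersetCard.1 hY
    have heY := (subset_erase.1 hY1).2
    obtain ⟨x, hxY, hxe, hx⟩ : ∃ x, x ∉ Y ∧ x ≠ e ∧ ¬ Disjoint V (insert x Y) := by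
      by_cases hVY : V.erase e ⊆ Y
      · obtain ⟨x, hx⟩ : ∃ x, x ∉ insert e Y := by
          by_contra! hcon
          have h2 : #(insert e Y) = n := by
            rw [eq_univ_of_forall hcon, card_univ, Fintype.card_fin]
          have := card_insert_le e Y
          lia
        rw [mem_insert, not_or] at hx
        refine ⟨x, hx.2, hx.1, fun hdis => ?_⟩
        obtain ⟨v, hv⟩ := hVe
        exact disjoint_left.1 hdis (mem_of_mem_erase hv) (mem_insert_of_mem (hVY hv))
      · obtain ⟨x, hxV, hxY⟩ := not_subset.1 hVY
        exact ⟨x, hxY, ne_of_mem_erase hxV, fun hdis =>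
          disjoint_left.1 hdis (mem_of_mem_erase hxV) (mem_insert_self _ _)⟩
    rw [mem_shadow_iff_insert_mem]
    refine ⟨x, hxY, ?_⟩
    rcases mem_or_of_card_eq hF' (S := insert x Y)
      (by rw [card_insert_of_notMem hxY, hY2]; lia)
      (by simp [hxe.symm, heY]) with h | h
    · exact h
    · exact absurd h.2.1 hx
  have h2 : (D.erase e).image (fun y => D.erase y) ⊆ ∂ F := by
    intro Y hY
    obtain ⟨y, hy, rfl⟩ := mem_image.1 hY
    exact erase_mem_shadow hD (mem_of_mem_erase hy)
  have h3 : Disjoint ((univ.erase e).powersetCard (r - 1))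
      ((D.erase e).image (fun y => D.erase y)) := by
    rw [disjoint_right]
    intro Y hY hY'
    obtain ⟨y, hy, rfl⟩ := mem_image.1 hY
    exact (subset_erase.1 (mem_powersetCard.1 hY').1).2
      (mem_erase.2 ⟨(ne_of_mem_erase hy).symm, heD⟩)
  have h4 := card_le_card (union_subset h1 h2)
  rw [card_union_of_disjoint h3, card_powersetCard, card_erase_of_mem (mem_univ _), card_univ,
    Fintype.card_fin, card_image_of_injOn, card_erase_of_mem heD, hFr hD] at h4
  · exact h4
  · intro y hy z hz hyz
    have hy' : y ∈ D := mem_of_mem_erase hy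
    by_contra hne
    have : y ∈ D.erase z := mem_erase.2 ⟨hne, hy'⟩
    rw [← show D.erase y = D.erase z from hyz] at this
    exact absurd this (notMem_erase _ _)

/-- Two-coloured sets of size `s`: some differently coloured pair differs in a single exchange. -/
theorem exists_insert_pair {α : Type*} [DecidableEq α] {s : ℕ} (G : Finset α)
    (p : Finset α → Prop) {X Y : Finset α} (hX : X ∈ G.powersetCard s) (hY : Y ∈ G.powersetCard s)
    (hpX : p X) (hpY : ¬ p Y) :
    ∃ Z a b, a ∉ Z ∧ b ∉ Z ∧ a ≠ b ∧ insert a Z ∈ G.powersetCard s ∧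
      insert b Z ∈ G.powersetCard s ∧ p (insert a Z) ∧ ¬ p (insert b Z) := by
  induction h : #(X \ Y) using Nat.strong_induction_on generalizing X with
  | _ m ih =>
  have hX' := mem_powersetCard.1 hX
  have hY' := mem_powersetCard.1 hY
  have hne : X ≠ Y := by rintro rfl; exact hpY hpX
  have hcard : #X = #Y := by rw [hX'.2, hY'.2]
  obtain ⟨x, hx⟩ : (X \ Y).Nonempty :=
    sdiff_nonempty.2 fun h ↦ hne (eq_of_subset_of_card_le h hcard.ge)
  obtain ⟨y, hy⟩ : (Y \ X).Nonempty :=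
    sdiff_nonempty.2 fun h ↦ hne (eq_of_subset_of_card_le h hcard.le).symm
  rw [mem_sdiff] at hx hy
  have hxy : x ≠ y := by rintro rfl; exact hx.2 hy.1
  have hyX : y ∉ X.erase x := fun h => hy.2 (mem_of_mem_erase h)
  have hmem : insert y (X.erase x) ∈ G.powersetCard s := by
    refine mem_powersetCard.2 ⟨insert_subset (hY'.1 hy.1) ((erase_subset _ _).trans hX'.1), ?_⟩
    rw [card_insert_of_notMem hyX, card_erase_add_one hx.1, hX'.2]
  by_cases hp : p (insert y (X.erase x))
  · refine ih _ ?_ hmem hp rfl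
    rw [← h]
    refine card_lt_card ((ssubset_iff_of_subset ?_).2 ⟨x, mem_sdiff.2 hx, ?_⟩)
    · intro z hz
      simp only [mem_sdiff, mem_insert, mem_erase] at hz ⊢
      rcases hz with ⟨rfl | h1, h2⟩
      · exact absurd hy.1 h2
      · exact ⟨h1.2, h2⟩
    · simp [hxy]
  · exact ⟨X.erase x, x, y, notMem_erase _ _, hyX, hxy, by rwa [insert_erase hx.1], hmem,
      by rwa [insert_erase hx.1], hp⟩

/-- The last compression exchanges a single element. -/
theorem card_shadow_of_compression_singleton_eq {n r : ℕ} {F : Finset (Finset (Fin n))}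
    {u e : Fin n} (hue : u ≠ e) (hr : 0 < r) (hrn : r < n)
    (hFr : (F : Set (Finset (Fin n))).Sized r)
    (hF' : 𝓒 {u} {e} F = (univ.erase e).powersetCard r)
    (he : ∃ D ∈ F, e ∈ D) (hu : ∃ D ∈ F, u ∈ D) :
    (n - 1).choose (r - 1) + (r - 1) ≤ #(∂ F) := by
  obtain ⟨r, rfl⟩ : ∃ r', r = r' + 1 := ⟨r - 1, by lia⟩
  simp only [Nat.add_sub_cancel]
  have hF1 : ∀ T : Finset (Fin n), #T = r → u ∉ T → e ∉ T →
      (insert u T ∈ F ∨ insert e T ∈ F) := by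
    intro T hT huT heT
    rcases mem_or_of_card_eq hF' (S := insert u T)
      (by rw [card_insert_of_notMem huT, hT]) (by simp [hue.symm, heT]) with h | h
    · exact Or.inl h
    · right
      convert h.2.2 using 1
      ext y
      simp only [mem_insert, mem_sdiff, mem_union, mem_singleton]
      by_cases hy : y = u
      · subst hy; simp [hue, huT]
      · simp [hy]; tauto
  have hF2 : ∀ T : Finset (Fin n), u ∉ T → e ∉ T → insert u T ∈ F → insert e T ∉ F := by
    intro T huT heT h1 h2
    refine (of_mem_of_compression_eq hF' h2 (mem_insert_self _ _)).2.2 ?_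
    convert h1 using 1
    ext y
    simp only [mem_insert, mem_sdiff, mem_union, mem_singleton]
    by_cases hy : y = e
    · subst hy; simp [hue.symm, heT]
    · simp [hy]; tauto
  set G : Finset (Fin n) := (univ.erase e).erase u with hG
  have hGm : ∀ T : Finset (Fin n), T ⊆ G ↔ u ∉ T ∧ e ∉ T := by
    intro T
    rw [hG, subset_erase, subset_erase]
    simp [and_comm]
  have hGc : #G + 2 = n := by
    have h1 : #(univ.erase e) + 1 = n := by
      rw [card_erase_add_one (mem_univ e), card_univ, Fintype.card_fin]
    have h2 : #G + 1 = #(univ.erase e) :=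
      card_erase_add_one (mem_erase.2 ⟨hue, mem_univ u⟩)
    lia
  -- a set containing `u` and a set containing `e`
  obtain ⟨D, hD, heD⟩ := he
  have huD : u ∉ D := by
    simpa using (of_mem_of_compression_eq hF' hD heD).1
  obtain ⟨D', hD', huD'⟩ := hu
  have heD' : e ∉ D' := fun h => by
    have := (of_mem_of_compression_eq hF' hD' h).1
    simp [huD'] at this
  have hX0 : D'.erase u ∈ G.powersetCard r := by
    refine mem_powersetCard.2 ⟨(hGm _).2 ⟨notMem_erase _ _, fun h => heD' (mem_of_mem_erase h)⟩, ?_⟩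
    rw [card_erase_of_mem huD', hFr hD', Nat.add_sub_cancel]
  have hY0 : D.erase e ∈ G.powersetCard r := by
    refine mem_powersetCard.2 ⟨(hGm _).2 ⟨fun h => huD (mem_of_mem_erase h), notMem_erase _ _⟩, ?_⟩
    rw [card_erase_of_mem heD, hFr hD, Nat.add_sub_cancel]
  obtain ⟨Z, a, b, haZ, hbZ, hab, haG, hbG, hpa, hpb⟩ := exists_insert_pair G
    (fun T => insert u T ∈ F) hX0 hY0 (by simpa [insert_erase huD'] using hD') (fun h => by
      have h1 := mem_powersetCard.1 hY0
      have h2 := (hGm _).1 h1.1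
      refine hF2 _ h2.1 h2.2 h ?_
      rwa [insert_erase heD])
  have haG' := mem_powersetCard.1 haG
  have hbG' := mem_powersetCard.1 hbG
  have hpb' : insert e (insert b Z) ∈ F :=
    (hF1 _ hbG'.2 ((hGm _).1 hbG'.1).1 ((hGm _).1 hbG'.1).2).resolve_left hpb
  have hZG : Z ⊆ G := (subset_insert _ _).trans haG'.1
  -- the part of the shadow avoiding `e` and the one containing it
  set P := (∂ F).nonMemberSubfamily e with hP
  set Q := ((∂ F).memberSubfamily e).image (insert u) with hQ
  have hQinj : #Q = #((∂ F).memberSubfamily e) := by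
    refine card_image_of_injOn fun W hW W' hW' hWW => ?_
    have hu : ∀ W ∈ (∂ F).memberSubfamily e, u ∉ W := by
      intro W hW huW
      rw [mem_memberSubfamily] at hW
      obtain ⟨S, hS, hWS⟩ := exists_subset_of_mem_shadow hW.1
      have := (of_mem_of_compression_eq hF' hS (hWS (mem_insert_self _ _))).1
      rw [disjoint_singleton_left] at this
      exact this (hWS (mem_insert_of_mem huW))
    have := congrArg (fun S => S.erase u) hWW
    simpa [erase_insert, hu W hW, hu W' hW'] using this
  have hcard : #(∂ F) = #P + #Q := by
    rw [hQinj, add_comm, card_memberSubfamily_add_card_nonMemberSubfamily]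
  -- facts producing members of `P` and `Q`
  have memP : ∀ W : Finset (Fin n), ∀ x, u ∉ W → e ∉ W → x ∉ W → x ≠ u → x ≠ e →
      insert u (insert x W) ∈ F → insert u W ∈ P := by
    intro W x huW heW hxW hxu hxe h
    rw [hP, mem_nonMemberSubfamily, mem_shadow_iff_insert_mem]
    refine ⟨⟨x, by simp [hxu, hxW], by rwa [insert_comm]⟩, by simp [hue.symm, heW]⟩
  have memQ : ∀ W : Finset (Fin n), ∀ x, u ∉ W → e ∉ W → x ∉ W → x ≠ u → x ≠ e →
      insert e (insert x W) ∈ F → insert u W ∈ Q := by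
    intro W x huW heW hxW hxu hxe h
    refine mem_image_of_mem _ ?_
    rw [mem_memberSubfamily, mem_shadow_iff_insert_mem]
    exact ⟨⟨x, by simp [hxe, hxW], by rwa [insert_comm]⟩, heW⟩
  have hunion : (univ.erase e).powersetCard r ⊆ P ∪ Q := by
    intro Y hY
    obtain ⟨hY1, hY2⟩ := mem_powersetCard.1 hY
    have heY := (subset_erase.1 hY1).2
    by_cases huY : u ∈ Y
    · obtain ⟨x, hx⟩ : (G \ Y).Nonempty := by
        rw [← card_pos]
        have h1 : G \ Y = G \ (Y.erase u) := by
          ext z; simp only [mem_sdiff, mem_erase, hG]; tauto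
        have h2 := le_card_sdiff (Y.erase u) G
        rw [card_erase_of_mem huY] at h2
        have : 0 < #Y := card_pos.2 ⟨u, huY⟩
        rw [h1]
        lia
      rw [mem_sdiff, hG, mem_erase, mem_erase] at hx
      have hW := notMem_erase u Y
      have hxW : x ∉ Y.erase u := fun h => hx.2 (mem_of_mem_erase h)
      have heW : e ∉ Y.erase u := fun h => heY (mem_of_mem_erase h)
      have := hF1 (insert x (Y.erase u))
        (by rw [card_insert_of_notMem hxW, card_erase_add_one huY, hY2])
        (by simp [hx.1.1.symm]) (by simp [hx.1.2.1.symm, heY])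
      rw [mem_union, ← insert_erase huY]
      rcases this with h | h
      · exact Or.inl (memP _ x hW heW hxW hx.1.1 hx.1.2.1 h)
      · exact Or.inr (memQ _ x hW heW hxW hx.1.1 hx.1.2.1 h)
    · refine mem_union_left _ ?_
      rw [hP, mem_nonMemberSubfamily, mem_shadow_iff_insert_mem]
      refine ⟨?_, heY⟩
      rcases hF1 Y hY2 huY heY with h | h
      · exact ⟨u, huY, h⟩
      · exact ⟨e, heY, h⟩
  have hinter : r ≤ #(P ∩ Q) := by
    have hne : ∀ W ⊆ G, u ∉ W ∧ e ∉ W := fun W hW => (hGm W).1 hW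
    have hbne : b ≠ u ∧ b ≠ e := by
      have := mem_erase.1 (hbG'.1 (mem_insert_self b Z))
      exact ⟨this.1, (mem_erase.1 this.2).1⟩
    have hane : a ≠ u ∧ a ≠ e := by
      have := mem_erase.1 (haG'.1 (mem_insert_self a Z))
      exact ⟨this.1, (mem_erase.1 this.2).1⟩
    have hex : ∀ z ∈ insert a Z, ∃ W ∈ P ∩ Q, W ∩ Z = Z.erase z := by
      intro z hz
      rcases mem_insert.1 hz with rfl | hzZ
      · refine ⟨insert u Z, mem_inter.2 ⟨?_, ?_⟩, ?_⟩
        · exact memP Z z (hne Z hZG).1 (hne Z hZG).2 haZ hane.1 hane.2 hpa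
        · exact memQ Z b (hne Z hZG).1 (hne Z hZG).2 hbZ hbne.1 hbne.2 hpb'
        · rw [inter_eq_right.2 (subset_insert _ _), erase_eq_of_notMem haZ]
      have hzne : z ≠ u ∧ z ≠ e := by
        have := mem_erase.1 (hZG hzZ)
        exact ⟨this.1, (mem_erase.1 this.2).1⟩
      have hza : a ≠ z := fun h => haZ (h ▸ hzZ)
      have hzb : b ≠ z := fun h => hbZ (h ▸ hzZ)
      have hzz : ∀ c ∉ Z, insert u (insert c (Z.erase z)) ∩ Z = Z.erase z := by
        intro c hc
        have hu := (hne Z hZG).1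
        ext y
        simp only [mem_inter, mem_insert, mem_erase]
        constructor
        · rintro ⟨rfl | rfl | h, hy⟩
          · exact absurd hy hu
          · exact absurd hy hc
          · exact h
        · exact fun h => ⟨Or.inr (Or.inr h), h.2⟩
      have hcc : insert b (insert a (Z.erase z)) = insert a (insert b (Z.erase z)) :=
        insert_comm _ _ _
      have hT : insert b (insert a (Z.erase z)) ⊆ G :=
        insert_subset (hbG'.1 (mem_insert_self _ _)) (insert_subset (haG'.1 (mem_insert_self _ _))
          ((erase_subset _ _).trans hZG))
      have hTa : insert a (Z.erase z) ⊆ G := (subset_insert _ _).trans hT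
      have hTb : insert b (Z.erase z) ⊆ G := (subset_insert _ _).trans (hcc ▸ hT)
      have haW : a ∉ insert b (Z.erase z) := by simp [hab, haZ]
      have hbW : b ∉ insert a (Z.erase z) := by simp [hab.symm, hbZ]
      have hzWa : z ∉ insert a (Z.erase z) := by simp [hza.symm]
      have hzWb : z ∉ insert b (Z.erase z) := by simp [hzb.symm]
      have hTc : #(insert b (insert a (Z.erase z))) = r := by
        rw [card_insert_of_notMem hbW, card_insert_of_notMem (fun h => haZ (mem_of_mem_erase h)),
          card_erase_add_one hzZ, ← card_insert_of_notMem haZ, haG'.2]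
      have ea : insert z (insert a (Z.erase z)) = insert a Z := by
        rw [insert_comm, insert_erase hzZ]
      have eb : insert z (insert b (Z.erase z)) = insert b Z := by
        rw [insert_comm, insert_erase hzZ]
      rcases hF1 _ hTc (hne _ hT).1 (hne _ hT).2 with h | h
      · refine ⟨insert u (insert b (Z.erase z)), mem_inter.2 ⟨?_, ?_⟩, hzz b hbZ⟩
        · exact memP _ a (hne _ hTb).1 (hne _ hTb).2 haW hane.1 hane.2 (hcc ▸ h)
        · exact memQ _ z (hne _ hTb).1 (hne _ hTb).2 hzWb hzne.1 hzne.2 (eb.symm ▸ hpb')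
      · refine ⟨insert u (insert a (Z.erase z)), mem_inter.2 ⟨?_, ?_⟩, hzz a haZ⟩
        · exact memP _ z (hne _ hTa).1 (hne _ hTa).2 hzWa hzne.1 hzne.2 (ea.symm ▸ hpa)
        · exact memQ _ b (hne _ hTa).1 (hne _ hTa).2 hbW hbne.1 hbne.2 h
    choose! f hf1 hf2 using hex
    rw [← haG'.2]
    refine card_le_card_of_injOn f hf1 fun z hz w hw hzw => ?_
    have h1 : Z.erase z = Z.erase w := by rw [← hf2 z hz, ← hf2 w hw, hzw]
    by_contra hne'
    rcases mem_insert.1 (mem_coe.1 hz) with h | h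
    · rcases mem_insert.1 (mem_coe.1 hw) with h' | h'
      · exact hne' (h.trans h'.symm)
      · have : w ∈ Z.erase z := mem_erase.2 ⟨fun h => hne' h.symm, h'⟩
        rw [h1] at this
        exact notMem_erase _ _ this
    · have : z ∈ Z.erase w := mem_erase.2 ⟨hne', h⟩
      rw [← h1] at this
      exact notMem_erase _ _ this
  have h1 := card_le_card hunion
  have h2 := card_union_add_card_inter P Q
  rw [card_powersetCard, card_erase_of_mem (mem_univ _), card_univ, Fintype.card_fin] at h1
  lia

end Stability

section Compressions

open UV Finset.Colex
open scoped FinsetFamily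

/-- The compressions moving sets down in the colexicographic order. -/
def Lowering {α : Type*} [LinearOrder α] (U V : Finset α) : Prop :=
  Disjoint U V ∧ #U = #V ∧ ∃ (HU : U.Nonempty) (HV : V.Nonempty), max' U HU < max' V HV

theorem card_shadow_compression_le_of_lowering {α : Type*} [LinearOrder α] {U V : Finset α}
    (F : Finset (Finset α)) (h₁ : Lowering U V)
    (h₂ : ∀ U₁ V₁, Lowering U₁ V₁ → #U₁ < #U → IsCompressed U₁ V₁ F) :
    #(∂ (𝓒 U V F)) ≤ #(∂ F) := by
  obtain ⟨hd, hc, hU, hV, hlt⟩ := h₁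
  refine card_shadow_compression_le _ _ fun x hx ↦ ⟨min' V hV, min'_mem _ _, ?_⟩
  have c1 := card_erase_of_mem hx
  have c2 := card_erase_of_mem (min'_mem V hV)
  have hUpos := hU.card_pos
  obtain hU1 | hU1 : #U = 1 ∨ 1 < #U := by lia
  · have e1 : erase U x = ∅ := by rw [← Finset.card_eq_zero]; lia
    have e2 : erase V (min' V hV) = ∅ := by rw [← Finset.card_eq_zero]; lia
    rw [e1, e2]
    exact isCompressed_self _ _
  · refine h₂ _ _ ⟨hd.mono (erase_subset ..) (erase_subset ..), by lia, card_pos.1 (by lia),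
      card_pos.1 (by lia), ?_⟩ (card_erase_lt_of_mem hx)
    exact (Finset.max'_subset _ <| erase_subset _ _).trans_lt (hlt.trans_le <| le_max' _ _ <|
      mem_erase.2 ⟨(min'_lt_max'_of_card _ (by lia)).ne', max'_mem _ _⟩)

theorem isInitSeg_of_forall_lowering {α : Type*} [LinearOrder α] {F : Finset (Finset α)} {r : ℕ}
    (h₁ : (F : Set (Finset α)).Sized r) (h₂ : ∀ U V, Lowering U V → IsCompressed U V F) :
    IsInitSeg F r := by
  refine ⟨h₁, ?_⟩
  rintro A B hA ⟨hBA, sizeA⟩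
  by_contra hB
  have hAB : A ≠ B := ne_of_mem_of_not_mem hA hB
  have hAB' : #A = #B := (h₁ hA).trans sizeA.symm
  have hU : (A \ B).Nonempty := sdiff_nonempty.2 fun h ↦ hAB <| eq_of_subset_of_card_le h hAB'.ge
  have hV : (B \ A).Nonempty :=
    sdiff_nonempty.2 fun h ↦ hAB.symm <| eq_of_subset_of_card_le h hAB'.le
  have disj : Disjoint (B \ A) (A \ B) := disjoint_sdiff.mono_left sdiff_subset
  have smaller : max' _ hV < max' _ hU := by
    obtain hlt | heq | hgt := lt_trichotomy (max' _ hU) (max' _ hV)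
    · rw [← compress_sdiff_sdiff A B] at hAB hBA
      cases hBA.not_gt <| toColex_compress_lt_toColex hlt hAB
    · exact (disjoint_right.1 disj (max'_mem _ hU) <| heq.symm ▸ max'_mem _ _).elim
    · assumption
  refine hB ?_
  rw [← (h₂ _ _ ⟨disj, card_sdiff_comm hAB'.symm, hV, hU, smaller⟩).eq]
  exact mem_compression.2 (Or.inr ⟨hB, A, hA, compress_sdiff_sdiff _ _⟩)

/-- A measure which strictly decreases under lowering compressions. -/
def weight {n : ℕ} (F : Finset (Finset (Fin n))) : ℕ := ∑ A ∈ F, ∑ a ∈ A, 2 ^ (a : ℕ)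

theorem weight_compression_lt {n : ℕ} {U V : Finset (Fin n)} {hU : U.Nonempty}
    {hV : V.Nonempty} (h : max' U hU < max' V hV) {F : Finset (Finset (Fin n))}
    (a : 𝓒 U V F ≠ F) : weight (𝓒 U V F) < weight F := by
  rw [compression] at a ⊢
  have q : ∀ Q ∈ {A ∈ F | compress U V A ∉ F}, compress U V Q ≠ Q := by grind
  have uA : {A ∈ F | compress U V A ∈ F} ∪ {A ∈ F | compress U V A ∉ F} = F :=
    filter_union_filter_not_eq _ _
  have ne₂ : {A ∈ F | compress U V A ∉ F}.Nonempty := by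
    contrapose! a
    rw [filter_image, a, image_empty, union_empty]
    rwa [a, union_empty] at uA
  rw [weight, weight, sum_union compress_disjoint]
  conv_rhs => rw [← uA]
  rw [sum_union (disjoint_filter_filter_not _ _ _), add_lt_add_iff_left, filter_image,
    sum_image compress_injOn]
  refine sum_lt_sum_of_nonempty ne₂ fun A hA ↦ ?_
  simp_rw [← sum_image Fin.val_injective.injOn]
  rw [geomSum_lt_geomSum_iff_toColex_lt_toColex le_rfl,
    toColex_image_lt_toColex_image Fin.val_strictMono]
  exact toColex_compress_lt_toColex h <| q _ hA

/-- The sets avoiding the largest point form an initial segment of colex. -/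
theorem isInitSeg_powersetCard_erase_last (n r : ℕ) :
    IsInitSeg ((univ.erase (Fin.last n)).powersetCard r) r := by
  refine ⟨Set.sized_powersetCard _ _, ?_⟩
  rintro A B hA ⟨hBA, hB⟩
  rw [mem_powersetCard, subset_erase] at hA
  rw [mem_powersetCard, subset_erase]
  refine ⟨⟨subset_univ _, fun hl => ?_⟩, hB⟩
  obtain ⟨b, hb, hbA, h⟩ := Colex.toColex_lt_toColex_iff_exists_forall_lt.1 hBA
  have := h (Fin.last n) hl hA.1.2
  exact absurd this (Fin.le_last b).not_gt

/-- Stability for the shadow of a family of the size of the family of sets avoiding a point. -/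
theorem card_shadow_of_forall_exists_mem {n r : ℕ} (F : Finset (Finset (Fin n))) (hr : 0 < r)
    (hrn : r < n) (hFr : (F : Set (Finset (Fin n))).Sized r) (hF : #F = (n - 1).choose r)
    (hcov : ∀ e, ∃ D ∈ F, e ∈ D) : (n - 1).choose (r - 1) + (r - 1) ≤ #(∂ F) := by
  classical
  induction hw : weight F using Nat.strong_induction_on generalizing F with
  | _ w ih =>
  subst hw
  obtain ⟨m, rfl⟩ : ∃ m, n = m + 1 := ⟨n - 1, by lia⟩
  set usable : Finset (Finset (Fin (m + 1)) × Finset (Fin (m + 1))) :=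
    {t | Lowering t.1 t.2 ∧ ¬ IsCompressed t.1 t.2 F} with husable_def
  obtain husable | husable := usable.eq_empty_or_nonempty
  · exfalso
    have hI : IsInitSeg F r := isInitSeg_of_forall_lowering hFr fun U V hUV ↦ by
      by_contra h
      rw [eq_empty_iff_forall_notMem] at husable
      exact husable ⟨U, V⟩ <| mem_filter.2 ⟨mem_univ _, hUV, h⟩
    have hc : #((univ.erase (Fin.last m)).powersetCard r) = #F := by
      rw [hF, card_powersetCard, card_erase_of_mem (mem_univ _), card_univ, Fintype.card_fin]
    have hFe : F = (univ.erase (Fin.last m)).powersetCard r := by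
      rcases hI.total (isInitSeg_powersetCard_erase_last m r) with h | h
      · exact eq_of_subset_of_card_le h hc.le
      · exact (eq_of_subset_of_card_le h hc.ge).symm
    obtain ⟨D, hD, he⟩ := hcov (Fin.last m)
    rw [hFe, mem_powersetCard, subset_erase] at hD
    exact hD.1.2 he
  obtain ⟨⟨U, V⟩, hUV, hmin⟩ := exists_min_image usable (fun t ↦ #t.1) husable
  rw [husable_def, mem_filter] at hUV
  have h₂ : ∀ U₁ V₁, Lowering U₁ V₁ → #U₁ < #U → IsCompressed U₁ V₁ F := by
    rintro U₁ V₁ huseful hUcard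
    by_contra h
    exact hUcard.not_ge <| hmin ⟨U₁, V₁⟩ <| mem_filter.2 ⟨mem_univ _, huseful, h⟩
  have p1 : #(∂ (𝓒 U V F)) ≤ #(∂ F) := card_shadow_compression_le_of_lowering _ hUV.2.1 h₂
  obtain ⟨hd, hUV', hu, hv, hmax⟩ := hUV.2.1
  by_cases hcov' : ∀ e, ∃ D ∈ 𝓒 U V F, e ∈ D
  · exact (ih _ (weight_compression_lt hmax hUV.2.2) (𝓒 U V F) (hFr.uvCompression hUV')
      ((card_compression _ _ _).trans hF) hcov' rfl).trans p1
  push Not at hcov'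
  obtain ⟨e, he⟩ := hcov'
  have hF' : 𝓒 U V F = (univ.erase e).powersetCard r := by
    refine eq_of_subset_of_card_le (fun D hD => ?_) ?_
    · exact mem_powersetCard.2 ⟨subset_erase.2 ⟨subset_univ _, he D hD⟩,
        hFr.uvCompression hUV' hD⟩
    · rw [card_compression, hF, card_powersetCard, card_erase_of_mem (mem_univ _), card_univ,
        Fintype.card_fin]
  by_cases hV : 2 ≤ #V
  · exact card_shadow_of_compression_eq_of_two_le hr hrn hFr hF' hV (hcov e)
  have hV1 : #V = 1 := by have := hv.card_pos; lia
  obtain ⟨v, rfl⟩ := card_eq_one.1 hV1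
  obtain ⟨u, rfl⟩ := card_eq_one.1 (hUV'.trans hV1)
  have hve : v = e := by
    obtain ⟨D, hD, heD⟩ := hcov e
    have h1 := of_mem_of_compression_eq hF' hD heD
    have h2 : D ∉ 𝓒 {u} {v} F := fun h => he D h heD
    by_contra hne
    have h3 : compress {u} {v} D ∈ 𝓒 {u} {v} F := compress_mem_compression hD
    refine he _ h3 ?_
    rw [compress, if_pos ⟨h1.1, h1.2.1⟩]
    simp [heD, Ne.symm hne]
  subst hve
  refine card_shadow_of_compression_singleton_eq ?_ hr hrn hFr hF' (hcov _) (hcov _)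
  simpa using hd

end Compressions

section Lex

open Finset.Colex
open scoped FinsetFamily

/-- Members of the first of two cross-intersecting families avoid the iterated shadow of the
complements of the second one. -/
theorem Cross.disjoint_shadow_iterate {α : Type*} [DecidableEq α] [Fintype α]
    {𝓐 𝓑 : Finset (Finset α)} (h : Cross 𝓐 𝓑) (i : ℕ) : Disjoint 𝓐 (∂^[i] 𝓑ᶜˢ) := by
  rw [disjoint_right]
  intro A hA hAA
  obtain ⟨C, hC, hAC, -⟩ := mem_shadow_iterate_iff_exists_sdiff.1 hA
  exact h A hAA Cᶜ (mem_compls.1 hC) (disjoint_compl_right.mono_left hAC)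

theorem sized_compls {n k : ℕ} {𝓑 : Finset (Finset (Fin n))} (hB : 𝓑 ⊆ univ.powersetCard k) :
    (𝓑ᶜˢ : Set (Finset (Fin n))).Sized (n - k) := by
  intro S hS
  have := (mem_powersetCard.1 (hB (mem_compls.1 hS))).2
  rw [card_compl, Fintype.card_fin] at this
  have h2 : #S ≤ n := by simpa using card_le_univ S
  have h3 : k ≤ n := by lia
  lia

theorem shadow_iterate_compls_subset {n k : ℕ} {𝓑 : Finset (Finset (Fin n))} (hkn : 2 * k ≤ n)
    (hB : 𝓑 ⊆ univ.powersetCard k) : ∂^[n - 2 * k] 𝓑ᶜˢ ⊆ univ.powersetCard k := by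
  intro S hS
  refine mem_powersetCard.2 ⟨subset_univ _, ?_⟩
  have := (sized_compls hB).shadow_iterate (k := n - 2 * k) hS
  lia

theorem Cross.card_add_card_shadow_iterate_le {n k : ℕ} {𝓐 𝓑 : Finset (Finset (Fin n))}
    (h : Cross 𝓐 𝓑) (hkn : 2 * k ≤ n) (hA : 𝓐 ⊆ univ.powersetCard k)
    (hB : 𝓑 ⊆ univ.powersetCard k) : #𝓐 + #(∂^[n - 2 * k] 𝓑ᶜˢ) ≤ n.choose k := by
  rw [← card_union_of_disjoint (h.disjoint_shadow_iterate _)]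
  simpa using card_le_card (union_subset hA (shadow_iterate_compls_subset hkn hB))

/-- The bound in case the second family has the size of a star, but is not a star. -/
theorem Cross.card_add_choose_le_of_card_eq {n k : ℕ} {𝓐 𝓑 : Finset (Finset (Fin n))}
    (h : Cross 𝓐 𝓑) (hk : 0 < k) (hkn : 2 * k < n) (hA : 𝓐 ⊆ univ.powersetCard k)
    (hB : 𝓑 ⊆ univ.powersetCard k) (hcard : #𝓑 = (n - 1).choose (k - 1))
    (hempty : ∀ x, ∃ B ∈ 𝓑, x ∉ B) :
    #𝓐 + (n - k - 1).choose (k - 1) ≤ (n - 1).choose (k - 1) := by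
  have h1 := h.card_add_card_shadow_iterate_le hkn.le hA hB
  have h2 := card_shadow_of_forall_exists_mem 𝓑ᶜˢ (r := n - k) (by lia) (by lia) (sized_compls hB)
    (by rw [card_compls, hcard]; exact Nat.choose_symm_of_eq_add (by lia)) (fun e => by
      obtain ⟨B, hB, he⟩ := hempty e
      exact ⟨Bᶜ, by simpa using hB, mem_compl.2 he⟩)
  obtain ⟨m, rfl⟩ : ∃ m, n = m + 1 := ⟨n - 1, by lia⟩
  obtain ⟨c, rfl⟩ : ∃ c, k = c + 1 := ⟨k - 1, by lia⟩
  obtain ⟨d, rfl⟩ : ∃ d, m = 2 * c + 2 + d := ⟨m - (2 * c + 2), by lia⟩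
  simp only [Nat.add_sub_cancel] at *
  set e := Fin.last (2 * c + 2 + d) with he
  set I : Finset (Fin (2 * c + 2 + d + 1)) := {i | i.val < c + 1 + d} with hI
  have hIc : #I = c + 1 + d := by
    rw [hI, Fin.card_filter_val_lt]; lia
  have heI : e ∉ I := by simp [hI, he]; lia
  set 𝒞 : Finset (Finset (Fin (2 * c + 2 + d + 1))) := (univ.erase e).powersetCard (c + 1 + d) ∪
    (I.powersetCard (c + d)).image (insert e) with h𝒞
  have hinit : IsInitSeg 𝒞 (c + 1 + d) := by
    constructor
    · intro S hS
      rcases mem_union.1 hS with hS | hS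
      · exact (mem_powersetCard.1 hS).2
      · obtain ⟨W, hW, rfl⟩ := mem_image.1 hS
        obtain ⟨hW1, hW2⟩ := mem_powersetCard.1 hW
        rw [card_insert_of_notMem fun h => heI (hW1 h)]
        lia
    · rintro S T hS ⟨hTS, hT⟩
      obtain ⟨b, hbS, hbT, hb⟩ := Colex.toColex_lt_toColex_iff_exists_forall_lt.1 hTS
      rw [mem_union, mem_powersetCard, subset_erase]
      by_cases heT : e ∈ T
      · right
        have heS : e ∈ S := by
          by_contra heS
          exact absurd (hb _ heT heS) (Fin.le_last b).not_gt
        have hSI : S.erase e ⊆ I := by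
          rcases mem_union.1 hS with hS | hS
          · exact absurd heS (subset_erase.1 (mem_powersetCard.1 hS).1).2
          · obtain ⟨W, hW, rfl⟩ := mem_image.1 hS
            obtain ⟨hW1, hW2⟩ := mem_powersetCard.1 hW
            rwa [erase_insert fun h => heI (hW1 h)]
        refine mem_image.2 ⟨T.erase e, mem_powersetCard.2 ⟨fun y hy => ?_, ?_⟩, insert_erase heT⟩
        · by_cases hyS : y ∈ S
          · exact hSI (mem_erase.2 ⟨ne_of_mem_erase hy, hyS⟩)
          · have hyb := hb y (mem_of_mem_erase hy) hyS
            have hbI := hSI (mem_erase.2 ⟨fun h => hbT (by rwa [h]), hbS⟩)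
            rw [hI, mem_filter] at hbI ⊢
            exact ⟨mem_univ _, lt_trans hyb hbI.2⟩
        · rw [card_erase_of_mem heT, hT]; lia
      · exact Or.inl ⟨⟨subset_univ _, heT⟩, hT⟩
  have hcard𝒞 : #𝒞 ≤ #(∂ 𝓑ᶜˢ) := by
    refine (card_union_le _ _).trans (le_trans ?_ h2)
    gcongr
    · rw [card_powersetCard, card_erase_of_mem (mem_univ _), card_univ, Fintype.card_fin]
      refine le_of_eq (congrArg₂ _ (by lia) (by lia))
    · refine card_image_le.trans ?_
      rw [card_powersetCard, hIc, show c + 1 + d = c + d + 1 by ring, Nat.choose_succ_self_right]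
      lia
  have hkk := iterated_kk (k := d) (sized_compls hB).shadow hcard𝒞 (by convert hinit using 1; lia)
  have hlow : (2 * c + 2 + d).choose (c + 1) + (c + 1 + d).choose c ≤ #(∂^[d] 𝒞) := by
    have s1 : (univ.erase e).powersetCard (c + 1) ⊆ ∂^[d] 𝒞 := by
      intro S hS
      obtain ⟨hS1, hS2⟩ := mem_powersetCard.1 hS
      obtain ⟨T, hST, hT, hTc⟩ := exists_subsuperset_card_eq (n := c + 1 + d) hS1 (by lia)
        (by rw [card_erase_of_mem (mem_univ _), card_univ, Fintype.card_fin]; lia)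
      exact mem_shadow_iterate_iff_exists_sdiff.2 ⟨T, mem_union_left _
        (mem_powersetCard.2 ⟨hT, hTc⟩), hST, by rw [card_sdiff_of_subset hST]; lia⟩
    have s2 : (I.powersetCard c).image (insert e) ⊆ ∂^[d] 𝒞 := by
      intro S hS
      obtain ⟨W, hW, rfl⟩ := mem_image.1 hS
      obtain ⟨hS1, hS2⟩ := mem_powersetCard.1 hW
      obtain ⟨T, hST, hT, hTc⟩ := exists_subsuperset_card_eq (n := c + d) hS1 (by lia) (by lia)
      refine mem_shadow_iterate_iff_exists_sdiff.2 ⟨insert e T, mem_union_right _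
        (mem_image_of_mem _ (mem_powersetCard.2 ⟨hT, hTc⟩)), insert_subset_insert _ hST, ?_⟩
      rw [card_sdiff_of_subset (insert_subset_insert _ hST),
        card_insert_of_notMem fun h => heI (hT h), card_insert_of_notMem fun h => heI (hS1 h)]
      lia
    have s3 : Disjoint ((univ.erase e).powersetCard (c + 1))
        ((I.powersetCard c).image (insert e)) := by
      rw [disjoint_right]
      intro S hS hS'
      obtain ⟨W, hW, rfl⟩ := mem_image.1 hS
      exact (subset_erase.1 (mem_powersetCard.1 hS').1).2 (mem_insert_self _ _)
    have s4 := card_le_card (union_subset s1 s2)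
    rw [card_union_of_disjoint s3, card_powersetCard, card_erase_of_mem (mem_univ _), card_univ,
      Fintype.card_fin, card_image_of_injOn, card_powersetCard, hIc] at s4
    · exact s4
    · intro W hW W' hW' hWW
      have := congrArg (fun S => S.erase e) hWW
      have m1 : e ∉ W := fun h => heI ((mem_powersetCard.1 hW).1 h)
      have m2 : e ∉ W' := fun h => heI ((mem_powersetCard.1 hW').1 h)
      simpa [erase_insert, m1, m2] using this
  have e1 : 2 * c + 2 + d + 1 - 2 * (c + 1) = d + 1 := by lia
  have e2 : 2 * c + 2 + d + 1 - (c + 1) - 1 = c + 1 + d := by lia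
  rw [e1, Function.iterate_succ_apply, Nat.choose_succ_succ] at h1
  rw [e2]
  lia

theorem exists_isInitSeg_card {n r m : ℕ} (h : m ≤ n.choose r) :
    ∃ 𝒞 : Finset (Finset (Fin n)), IsInitSeg 𝒞 r ∧ #𝒞 = m := by
  induction m with
  | zero => exact ⟨∅, isInitSeg_empty, rfl⟩
  | succ m ih =>
    obtain ⟨𝒞, h1, h2⟩ := ih (by lia)
    have hsub : 𝒞 ⊆ univ.powersetCard r := fun S hS =>
      mem_powersetCard.2 ⟨subset_univ _, h1.1 hS⟩
    have hne : (univ.powersetCard r \ 𝒞).Nonempty := by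
      rw [← card_pos, card_sdiff_of_subset hsub, card_powersetCard, card_univ, Fintype.card_fin]
      lia
    obtain ⟨S, hS, hmin⟩ := exists_min_image _ toColex hne
    rw [mem_sdiff] at hS
    refine ⟨insert S 𝒞, ⟨?_, ?_⟩, by rw [card_insert_of_notMem hS.2, h2]⟩
    · intro T hT
      rcases mem_insert.1 hT with rfl | hT
      · exact (mem_powersetCard.1 hS.1).2
      · exact h1.1 hT
    · rintro T T' hT ⟨hlt, hc⟩
      rcases mem_insert.1 hT with rfl | hT
      · by_contra hn
        rw [mem_insert, not_or] at hn
        exact absurd hlt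
          (hmin T' (mem_sdiff.2 ⟨mem_powersetCard.2 ⟨subset_univ _, hc⟩, hn.2⟩)).not_gt
      · exact mem_insert_of_mem (h1.2 hT ⟨hlt, hc⟩)

/-- A pair of cross-intersecting families can be replaced by one where the second family is an
initial segment of the order in which `B` precedes `A` if the largest point of their symmetric
difference belongs to `B`. -/
theorem Cross.exists_lex {n k : ℕ} {𝓐 𝓑 : Finset (Finset (Fin n))}
    (h : Cross 𝓐 𝓑) (hkn : 2 * k ≤ n) (hA : 𝓐 ⊆ univ.powersetCard k)
    (hB : 𝓑 ⊆ univ.powersetCard k) :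
    ∃ 𝓐' ⊆ univ.powersetCard k, ∃ 𝓑' ⊆ univ.powersetCard k, Cross 𝓐' 𝓑' ∧ #𝓐 ≤ #𝓐' ∧ #𝓑' = #𝓑 ∧
      ∀ 𝓣 : Finset (Finset (Fin n)), 𝓣 ⊆ univ.powersetCard k → (∀ A ∈ 𝓣, ∀ B, #B = k →
        (∃ x ∈ B, x ∉ A ∧ ∀ y ∈ A, y ∉ B → y < x) → B ∈ 𝓣) → 𝓣 ⊆ 𝓑' ∨ 𝓑' ⊆ 𝓣 := by
  classical
  have hBc : #𝓑 ≤ n.choose (n - k) := by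
    rw [Nat.choose_symm (by lia)]
    simpa using card_le_card hB
  obtain ⟨𝒞, h1, h2⟩ := exists_isInitSeg_card hBc
  have hB' : 𝒞ᶜˢ ⊆ univ.powersetCard k := by
    intro S hS
    have := h1.1 (mem_compls.1 hS)
    rw [card_compl, Fintype.card_fin] at this
    have h2 : #S ≤ n := by simpa using card_le_univ S
    exact mem_powersetCard.2 ⟨subset_univ _, by lia⟩
  refine ⟨univ.powersetCard k \ ∂^[n - 2 * k] 𝒞, sdiff_subset, 𝒞ᶜˢ, hB', ?_, ?_,
    by rw [card_compls, h2], ?_⟩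
  · intro A hA B hB hd
    rw [mem_sdiff] at hA
    have hA1 := (mem_powersetCard.1 hA.1).2
    have hB1 := (mem_powersetCard.1 (hB' hB)).2
    have hAB : A ⊆ Bᶜ := subset_compl_iff_disjoint_right.2 hd
    refine hA.2 (mem_shadow_iterate_iff_exists_sdiff.2 ⟨Bᶜ, mem_compls.1 hB, hAB, ?_⟩)
    rw [card_sdiff_of_subset hAB, card_compl, Fintype.card_fin]
    lia
  · have h3 := h.card_add_card_shadow_iterate_le hkn hA hB
    have h4 : #(∂^[n - 2 * k] 𝒞) ≤ #(∂^[n - 2 * k] 𝓑ᶜˢ) :=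
      iterated_kk (sized_compls hB) (by rw [card_compls, h2]) h1
    have h5 := le_card_sdiff (∂^[n - 2 * k] 𝒞) (univ.powersetCard k : Finset (Finset (Fin n)))
    rw [card_powersetCard, card_univ, Fintype.card_fin] at h5
    lia
  · intro 𝓣 hT hdown
    have hTI : IsInitSeg 𝓣ᶜˢ (n - k) := by
      refine ⟨sized_compls hT, ?_⟩
      rintro S T hS ⟨hlt, hc⟩
      obtain ⟨b, hbS, hbT, hb⟩ := Colex.toColex_lt_toColex_iff_exists_forall_lt.1 hlt
      rw [mem_compls] at hS ⊢
      refine hdown _ hS _ (by rw [card_compl, Fintype.card_fin, hc]; lia)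
        ⟨b, mem_compl.2 hbT, by simpa using hbS, fun y hy hy' => ?_⟩
      simp only [mem_compl, not_not] at hy hy'
      exact hb y hy' hy
    rcases hTI.total h1 with h | h
    · left
      intro S hS
      exact mem_compls.2 (h (by simpa using hS))
    · right
      intro S hS
      simpa using h (mem_compls.1 hS)

end Lex

section Numerics

theorem choose_succ_lt_two_mul {m c : ℕ} (hm : 2 * c + 2 ≤ m) :
    (m + 1).choose c < 2 * m.choose c := by
  have h1 := Nat.choose_mul_succ_eq m c
  have h2 : 0 < m.choose c := Nat.choose_pos (by lia)
  by_contra! h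
  have h3 : m.choose c * (m + 1) < 2 * m.choose c * (m + 1 - c) := by
    rw [mul_comm 2, mul_assoc]
    exact Nat.mul_lt_mul_of_pos_left (by lia) h2
  have h4 := Nat.mul_le_mul_right (m + 1 - c) h
  lia

theorem choose_sub_add_choose_le {m c : ℕ} (hm : 2 * c + 2 ≤ m) :
    (m - c).choose (c + 1) + m.choose c ≤ m.choose (c + 1) + 1 := by
  have h : Cross (∅ : Finset (Finset (Fin m))) (univ.powersetCard c) := by simp [Cross]
  have := h.card_add_card_le (G := univ) (k := c + 1) (l := c) (by simp) le_rfl (by lia)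
    (by simp; lia) (card_pos.1 (by simpa using Nat.choose_pos (by lia)))
  simp at this
  lia

theorem mul_le_of_weighted_le {p q r a b α β : ℤ} (hr : 0 ≤ r) (hq : 0 < q)
    (hp : p + 1 ≤ 2 * q) (hqp : q ≤ p) (hα : -q ≤ α) (hα' : α ≤ q) (hb0 : 0 ≤ b)
    (h : α * r + β * q ≤ q * r) (ha : a ≤ p + α) (hb : b ≤ p + q + r + q + β) :
    a * b ≤ (p + q + r + 1) * (p + 2 * q - 1) := by
  refine le_of_mul_le_mul_left ?_ hq
  have h1 : q * (a * b) ≤ (p + α) * (q * (p + q + r + q) + (q * r - α * r)) := by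
    calc q * (a * b) = a * (q * b) := by ring
      _ ≤ (p + α) * (q * b) := mul_le_mul_of_nonneg_right ha (by positivity)
      _ ≤ _ := by
        refine mul_le_mul_of_nonneg_left ?_ (by linarith)
        have := mul_le_mul_of_nonneg_left hb hq.le
        linarith
  refine h1.trans ?_
  obtain ⟨w, rfl⟩ : ∃ w, α = q - w := ⟨q - α, by ring⟩
  have hw : 0 ≤ w := by linarith
  have h2 : 0 ≤ (w - q) * (w - q + 1) := by
    rcases lt_or_ge (w - q) 0 with h | h
    · exact mul_nonneg_of_nonpos_of_nonpos h.le (by lia)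
    · exact mul_nonneg h (by linarith)
  have h3 : 0 ≤ r * ((w - q) * (w - q + 1)) := mul_nonneg hr h2
  have h4 : 0 ≤ r * (w * (2 * q - 1 - p)) := mul_nonneg hr (mul_nonneg hw (by linarith))
  have h5 : 0 ≤ w * q * (p + 2 * q) := mul_nonneg (mul_nonneg hw hq.le) (by linarith)
  have h6 : 0 ≤ q * (q - 1) := mul_nonneg hq.le (by linarith)
  nlinarith

/-- The bound for families all of whose first members contain three given points. -/
theorem mul_choose_le_of_mul_le {m c z : ℕ} (hm : 2 * c + 2 ≤ m)
    (hz : z * (m + 1 - c) ≤ m.choose c * c) :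
    z * (m + 3).choose (c + 2) ≤ 2 * m.choose c * (m + 2).choose (c + 1) := by
  have h1 := Nat.add_one_mul_choose_eq (m + 2) (c + 1)
  refine Nat.le_of_mul_le_mul_right (c := (m + 1 - c) * (c + 2)) ?_ (by
    have : 0 < m + 1 - c := by lia
    positivity)
  have h2 : c * (m + 3) ≤ 2 * ((m + 1 - c) * (c + 2)) := by
    obtain ⟨d, rfl⟩ := Nat.exists_eq_add_of_le hm
    rw [show 2 * c + 2 + d + 1 - c = c + 3 + d by lia]
    nlinarith
  calc z * (m + 3).choose (c + 2) * ((m + 1 - c) * (c + 2))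
      = (z * (m + 1 - c)) * ((m + 2 + 1).choose (c + 1 + 1) * (c + 1 + 1)) := by ring
    _ ≤ (m.choose c * c) * ((m + 2 + 1).choose (c + 1 + 1) * (c + 1 + 1)) := by gcongr
    _ = m.choose c * (m + 2).choose (c + 1) * (c * (m + 3)) := by rw [← h1]; ring
    _ ≤ m.choose c * (m + 2).choose (c + 1) * (2 * ((m + 1 - c) * (c + 2))) := by gcongr
    _ = _ := by ring

end Numerics

section Cases

variable {α : Type*} [DecidableEq α] {G : Finset α} {𝓐 𝓑 𝓕 : Finset (Finset α)} {e₁ e₂ e₃ x : α}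
  {m c g s : ℕ}

theorem card_memberSubfamily_le_choose (h : 𝓕 ⊆ G.powersetCard (s + 1)) (hx : x ∈ G)
    (hG : #G = g + 1) : #(𝓕.memberSubfamily x) ≤ g.choose s := by
  have := card_le_card (memberSubfamily_subset_powersetCard h x)
  rwa [card_powersetCard, card_erase_of_mem hx, hG, Nat.add_sub_cancel] at this

theorem card_nonMemberSubfamily_le_choose (h : 𝓕 ⊆ G.powersetCard s) (hx : x ∈ G)
    (hG : #G = g + 1) : #(𝓕.nonMemberSubfamily x) ≤ g.choose s := by
  have := card_le_card (nonMemberSubfamily_subset_powersetCard h x)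
  rwa [card_powersetCard, card_erase_of_mem hx, hG, Nat.add_sub_cancel] at this

theorem card_memberSubfamily_of_forall_mem (h : ∀ A ∈ 𝓕, x ∈ A) :
    #(𝓕.memberSubfamily x) = #𝓕 := by
  have h1 := card_memberSubfamily_add_card_nonMemberSubfamily x 𝓕
  have h2 : 𝓕.nonMemberSubfamily x = ∅ := eq_empty_of_forall_notMem fun A hA => by
    rw [mem_nonMemberSubfamily] at hA
    exact hA.2 (h A hA.1)
  rwa [h2, card_empty, add_zero] at h1

/-- Three distinct points of a ground set of size `m + 3`, and two families of
`(c + 2)`-subsets which cross-intersect. -/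
structure Config (G : Finset α) (𝓐 𝓑 : Finset (Finset α)) (e₁ e₂ e₃ : α) (m c : ℕ) : Prop where
  cross : Cross 𝓐 𝓑
  subset_left : 𝓐 ⊆ G.powersetCard (c + 2)
  subset_right : 𝓑 ⊆ G.powersetCard (c + 2)
  mem₁ : e₁ ∈ G
  mem₂ : e₂ ∈ G.erase e₁
  mem₃ : e₃ ∈ (G.erase e₁).erase e₂
  card_eq : #G = m + 3
  le : 2 * c + 2 ≤ m

namespace Config

theorem card_erase₁ (h : Config G 𝓐 𝓑 e₁ e₂ e₃ m c) : #(G.erase e₁) = m + 2 := by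
  rw [card_erase_of_mem h.mem₁, h.card_eq]; rfl

theorem card_erase₂ (h : Config G 𝓐 𝓑 e₁ e₂ e₃ m c) : #((G.erase e₁).erase e₂) = m + 1 := by
  rw [card_erase_of_mem h.mem₂, h.card_erase₁]; rfl

theorem card_erase₃ (h : Config G 𝓐 𝓑 e₁ e₂ e₃ m c) :
    #(((G.erase e₁).erase e₂).erase e₃) = m := by
  rw [card_erase_of_mem h.mem₃, h.card_erase₂]; rfl

theorem ne₂₁ (h : Config G 𝓐 𝓑 e₁ e₂ e₃ m c) : e₂ ≠ e₁ := ne_of_mem_erase h.mem₂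

theorem ne₃₂ (h : Config G 𝓐 𝓑 e₁ e₂ e₃ m c) : e₃ ≠ e₂ := ne_of_mem_erase h.mem₃

theorem ne₃₁ (h : Config G 𝓐 𝓑 e₁ e₂ e₃ m c) : e₃ ≠ e₁ :=
  ne_of_mem_erase (mem_of_mem_erase h.mem₃)

theorem card_add_card_le (h : Config G 𝓐 𝓑 e₁ e₂ e₃ m c) (hA : ∀ A ∈ 𝓐, e₁ ∈ A)
    (hB : ∀ B ∈ 𝓑, e₁ ∈ B ∨ e₂ ∈ B ∧ e₃ ∈ B) (hb : (m + 2).choose (c + 1) < #𝓑) :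
    #𝓐 + #𝓑 + (m - c).choose (c + 1) ≤ 2 * (m + 2).choose (c + 1) + 1 := by
  have sA1 := memberSubfamily_subset_powersetCard h.subset_left e₁
  have sA2 := nonMemberSubfamily_subset_powersetCard sA1 e₂
  have sA3 := nonMemberSubfamily_subset_powersetCard sA2 e₃
  have sB1 := nonMemberSubfamily_subset_powersetCard h.subset_right e₁
  have sB2 := memberSubfamily_subset_powersetCard sB1 e₂
  have sB3 := memberSubfamily_subset_powersetCard sB2 e₃
  have b1 := card_memberSubfamily_le_choose h.subset_right h.mem₁ h.card_eq
  have b2 := card_memberSubfamily_add_card_nonMemberSubfamily e₁ 𝓑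
  have b3 := card_memberSubfamily_of_forall_mem (𝓕 := 𝓑.nonMemberSubfamily e₁) (x := e₂) (by
    intro B hB'
    rw [mem_nonMemberSubfamily] at hB'
    have := hB B hB'.1
    tauto)
  have b4 := card_memberSubfamily_of_forall_mem
    (𝓕 := (𝓑.nonMemberSubfamily e₁).memberSubfamily e₂) (x := e₃) (by
    intro B hB'
    rw [mem_memberSubfamily, mem_nonMemberSubfamily] at hB'
    have := hB _ hB'.1.1
    rw [or_iff_right hB'.1.2] at this
    exact mem_of_mem_insert_of_ne this.2 h.ne₃₂)
  have a1 := card_memberSubfamily_of_forall_mem hA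
  have a2 := card_memberSubfamily_add_card_nonMemberSubfamily e₂ (𝓐.memberSubfamily e₁)
  have a3 := card_memberSubfamily_add_card_nonMemberSubfamily e₃
    ((𝓐.memberSubfamily e₁).nonMemberSubfamily e₂)
  have a4 := card_memberSubfamily_le_choose sA1 h.mem₂ h.card_erase₁
  have a5 := card_memberSubfamily_le_choose sA2 h.mem₃ h.card_erase₂
  have hm := h.le
  have key := (((h.cross.member_nonMember e₁).nonMember_member e₂).nonMember_member
    e₃).card_add_card_le sA3 sB3 (Nat.lt_succ_self c) (by rw [h.card_erase₃]; lia)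
    (card_pos.1 (by lia))
  rw [h.card_erase₃] at key
  have c1 := Nat.choose_succ_succ (m + 1) c
  have c2 := Nat.choose_succ_succ m c
  simp only [Nat.succ_eq_add_one] at c1 c2
  lia

theorem exists_weights (h : Config G 𝓐 𝓑 e₁ e₂ e₃ m c) (hA : ∀ A ∈ 𝓐, e₁ ∈ A)
    (hA' : ∀ A ∈ 𝓐, e₂ ∈ A ∨ e₃ ∈ A) (hB : ∀ B ∈ 𝓑, e₁ ∈ B ∨ e₂ ∈ B) :
    ∃ u v, u ≤ m.choose c ∧ u * m.choose (c + 1) + v * m.choose c ≤ m.choose c * m.choose (c + 1) ∧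
      #𝓐 ≤ (m + 1).choose c + u ∧ #𝓑 ≤ (m + 2).choose (c + 1) + m.choose c + v := by
  have sA1 := memberSubfamily_subset_powersetCard h.subset_left e₁
  have sA2 := nonMemberSubfamily_subset_powersetCard sA1 e₂
  have sA3 := memberSubfamily_subset_powersetCard sA2 e₃
  have sB1 := nonMemberSubfamily_subset_powersetCard h.subset_right e₁
  have sB2 := memberSubfamily_subset_powersetCard sB1 e₂
  have sB3 := nonMemberSubfamily_subset_powersetCard sB2 e₃
  have b1 := card_memberSubfamily_le_choose h.subset_right h.mem₁ h.card_eq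
  have b2 := card_memberSubfamily_add_card_nonMemberSubfamily e₁ 𝓑
  have b3 := card_memberSubfamily_of_forall_mem (𝓕 := 𝓑.nonMemberSubfamily e₁) (x := e₂) (by
    intro B hB'
    rw [mem_nonMemberSubfamily] at hB'
    have := hB B hB'.1
    tauto)
  have b4 := card_memberSubfamily_add_card_nonMemberSubfamily e₃
    ((𝓑.nonMemberSubfamily e₁).memberSubfamily e₂)
  have b5 := card_memberSubfamily_le_choose sB2 h.mem₃ h.card_erase₂
  have a1 := card_memberSubfamily_of_forall_mem hA
  have a2 := card_memberSubfamily_add_card_nonMemberSubfamily e₂ (𝓐.memberSubfamily e₁)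
  have a3 := card_memberSubfamily_of_forall_mem
    (𝓕 := (𝓐.memberSubfamily e₁).nonMemberSubfamily e₂) (x := e₃) (by
    intro A hA''
    rw [mem_nonMemberSubfamily, mem_memberSubfamily] at hA''
    have := hA' _ hA''.1.1
    simpa [hA''.2, h.ne₂₁, h.ne₃₁] using this)
  have a4 := card_memberSubfamily_le_choose sA1 h.mem₂ h.card_erase₁
  have a5 := card_memberSubfamily_le_choose sA2 h.mem₃ h.card_erase₂
  have hm := h.le
  have key := (((h.cross.member_nonMember e₁).nonMember_member e₂).member_nonMember
    e₃).card_mul_choose_add_le sA3 sB3 (by rw [h.card_erase₃]; lia)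
  rw [h.card_erase₃] at key
  exact ⟨_, _, a5, key, by lia, by lia⟩

theorem card_mul_le (h : Config G 𝓐 𝓑 e₁ e₂ e₃ m c) (hA : ∀ A ∈ 𝓐, e₁ ∈ A)
    (hA' : ∀ A ∈ 𝓐, e₂ ∈ A) (hA'' : ∀ A ∈ 𝓐, e₃ ∈ A) :
    #𝓐 * (m + 1 - c) ≤ m.choose c * c := by
  have sA1 := memberSubfamily_subset_powersetCard h.subset_left e₁
  have sA2 := memberSubfamily_subset_powersetCard sA1 e₂
  have a1 := card_memberSubfamily_of_forall_mem hA
  have a2 := card_memberSubfamily_of_forall_mem (𝓕 := 𝓐.memberSubfamily e₁) (x := e₂) (by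
    intro A hA
    rw [mem_memberSubfamily] at hA
    exact mem_of_mem_insert_of_ne (hA' _ hA.1) h.ne₂₁)
  have hall : ∀ A ∈ (𝓐.memberSubfamily e₁).memberSubfamily e₂, e₃ ∈ A := by
    intro A hA
    rw [mem_memberSubfamily, mem_memberSubfamily] at hA
    exact mem_of_mem_insert_of_ne (mem_of_mem_insert_of_ne (hA'' _ hA.1.1) h.ne₃₁) h.ne₃₂
  have a3 := card_memberSubfamily_of_forall_mem hall
  rw [← a1, ← a2]
  cases c with
  | zero =>
    rw [mul_zero, Nat.le_zero, mul_eq_zero, card_eq_zero]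
    left
    refine eq_empty_of_forall_notMem fun A hA => ?_
    have h1 := hall A hA
    have h2 := (mem_powersetCard.1 (sA2 hA)).2
    rw [card_eq_zero] at h2
    simp [h2] at h1
  | succ c =>
    have a4 := card_memberSubfamily_le_choose sA2 h.mem₃ h.card_erase₂
    rw [a3] at a4
    rw [Nat.choose_succ_right_eq, Nat.add_sub_add_right]
    gcongr

theorem exists_weights' (h : Config G 𝓐 𝓑 e₁ e₂ e₃ m c) (hA : ∀ A ∈ 𝓐, e₁ ∈ A)
    (hA' : ∀ A ∈ 𝓐, e₂ ∈ A) (hB : ∀ B ∈ 𝓑, e₁ ∈ B ∨ e₂ ∈ B ∨ e₃ ∈ B) :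
    ∃ u v, u ≤ m.choose c ∧ u * m.choose (c + 1) + v * m.choose c ≤ m.choose c * m.choose (c + 1) ∧
      #𝓐 + m.choose c ≤ (m + 1).choose c + u ∧
      #𝓑 ≤ (m + 2).choose (c + 1) + m.choose c + m.choose (c + 1) + v := by
  have sA1 := memberSubfamily_subset_powersetCard h.subset_left e₁
  have sA2 := memberSubfamily_subset_powersetCard sA1 e₂
  have sA3 := nonMemberSubfamily_subset_powersetCard sA2 e₃
  have sB1 := nonMemberSubfamily_subset_powersetCard h.subset_right e₁
  have sB2 := nonMemberSubfamily_subset_powersetCard sB1 e₂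
  have sB3 := memberSubfamily_subset_powersetCard sB2 e₃
  have b1 := card_memberSubfamily_le_choose h.subset_right h.mem₁ h.card_eq
  have b2 := card_memberSubfamily_add_card_nonMemberSubfamily e₁ 𝓑
  have b3 := card_memberSubfamily_add_card_nonMemberSubfamily e₂ (𝓑.nonMemberSubfamily e₁)
  have b4 := card_memberSubfamily_of_forall_mem
    (𝓕 := (𝓑.nonMemberSubfamily e₁).nonMemberSubfamily e₂) (x := e₃) (by
    intro B hB'
    rw [mem_nonMemberSubfamily, mem_nonMemberSubfamily] at hB'
    have := hB _ hB'.1.1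
    tauto)
  have b5 := card_memberSubfamily_le_choose sB1 h.mem₂ h.card_erase₁
  have a1 := card_memberSubfamily_of_forall_mem hA
  have a2 := card_memberSubfamily_of_forall_mem (𝓕 := 𝓐.memberSubfamily e₁) (x := e₂) (by
    intro A hA
    rw [mem_memberSubfamily] at hA
    exact mem_of_mem_insert_of_ne (hA' _ hA.1) h.ne₂₁)
  have a3 := card_memberSubfamily_add_card_nonMemberSubfamily e₃
    ((𝓐.memberSubfamily e₁).memberSubfamily e₂)
  have a4 := card_nonMemberSubfamily_le_choose sA2 h.mem₃ h.card_erase₂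
  have a5 : #(((𝓐.memberSubfamily e₁).memberSubfamily e₂).memberSubfamily e₃) + m.choose c ≤
      (m + 1).choose c := by
    cases c with
    | zero =>
      have : ((𝓐.memberSubfamily e₁).memberSubfamily e₂).memberSubfamily e₃ = ∅ := by
        refine eq_empty_of_forall_notMem fun A hA => ?_
        have h2 := (mem_powersetCard.1 (sA2 (mem_memberSubfamily.1 hA).1)).2
        rw [card_eq_zero] at h2
        exact insert_ne_empty _ _ h2
      simp [this]
    | succ c =>
      have := card_memberSubfamily_le_choose sA2 h.mem₃ h.card_erase₂
      rw [Nat.choose_succ_succ]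
      lia
  have hm := h.le
  have c2 := Nat.choose_succ_succ m c
  simp only [Nat.succ_eq_add_one] at c2
  have key := (((h.cross.member_nonMember e₁).member_nonMember e₂).nonMember_member
    e₃).card_mul_choose_add_le sA3 sB3 (by rw [h.card_erase₃]; lia)
  rw [h.card_erase₃] at key
  exact ⟨_, _, a4, key, by lia, by lia⟩

end Config

end Cases

section Main

theorem Cross.not_disjoint_of_forall_superset {n k : ℕ} {𝓐 𝓑 : Finset (Finset (Fin n))}
    (h : Cross 𝓐 𝓑) (hkn : 2 * k ≤ n) (hA : 𝓐 ⊆ univ.powersetCard k) {S : Finset (Fin n)}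
    (hS : #S ≤ k) (hSB : ∀ B, #B = k → S ⊆ B → B ∈ 𝓑) : ∀ A ∈ 𝓐, ¬ Disjoint A S := by
  intro A hAA hd
  have hAc := (mem_powersetCard.1 (hA hAA)).2
  obtain ⟨B, hSB', hBA, hB⟩ := exists_subsuperset_card_eq (n := k)
    (subset_compl_iff_disjoint_left.2 hd) hS
    (by rw [card_compl, Fintype.card_fin]; lia)
  exact h A hAA B (hSB B hB hSB') (subset_compl_iff_disjoint_left.1 hBA)

theorem mul_le_mul_of_add_le {a b C E : ℕ} (hE : E ≤ C) (hb : C < b) (h : a + b + E ≤ 2 * C + 1) :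
    a * b ≤ (C + 1) * (C - E) := by
  obtain ⟨t, rfl⟩ := Nat.exists_eq_add_of_le hb
  obtain ⟨d, rfl⟩ := Nat.exists_eq_add_of_le hE
  rw [Nat.add_sub_cancel_left]
  have h1 : a + t ≤ d := by lia
  obtain ⟨w, rfl⟩ := Nat.exists_eq_add_of_le h1
  nlinarith [Nat.zero_le (t * (E + w)), Nat.zero_le (w * t), Nat.zero_le (t * t)]

/-- Membership conditions on the three largest elements which are monotone in the colexicographic
order. -/
theorem mem_of_colex_lt {α : Type*} [LinearOrder α] {e₁ e₂ e₃ : α} (h₂₁ : e₂ < e₁) (h₃₂ : e₃ < e₂)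
    (hcases : ∀ x, x = e₁ ∨ x = e₂ ∨ x = e₃ ∨ x < e₃) {A B : Finset α}
    (h : ∃ x ∈ B, x ∉ A ∧ ∀ y ∈ A, y ∉ B → y < x) :
    (e₁ ∈ A → e₁ ∈ B) ∧ (e₁ ∈ A ∨ e₂ ∈ A ∧ e₃ ∈ A → e₁ ∈ B ∨ e₂ ∈ B ∧ e₃ ∈ B) ∧
      (e₁ ∈ A ∨ e₂ ∈ A → e₁ ∈ B ∨ e₂ ∈ B) ∧
      (e₁ ∈ A ∨ e₂ ∈ A ∨ e₃ ∈ A → e₁ ∈ B ∨ e₂ ∈ B ∨ e₃ ∈ B) := by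
  obtain ⟨x, hxB, hxA, hx⟩ := h
  have key : ∀ y, x ≤ y → y ∈ A → y ∈ B := fun y hxy hy =>
    by_contra fun hy' => (hx y hy hy').not_ge hxy
  rcases hcases x with rfl | rfl | rfl | hx'
  · simp [hxB]
  · have h1 := key e₁ h₂₁.le
    tauto
  · have h1 := key e₁ (h₃₂.trans h₂₁).le
    have h2 := key e₂ h₃₂.le
    tauto
  · have h1 := key e₁ ((hx'.trans h₃₂).trans h₂₁).le
    have h2 := key e₂ (hx'.trans h₃₂).le
    have h3 := key e₃ hx'.le
    exact ⟨h1, Or.imp h1 (And.imp h2 h3), Or.imp h1 h2, Or.imp h1 (Or.imp h2 h3)⟩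

/-- The bound in case the second family is larger than a star. -/
theorem Cross.card_mul_card_le_of_lt {m c : ℕ} {𝓐 𝓑 : Finset (Finset (Fin (m + 3)))}
    (h : Cross 𝓐 𝓑) (hm : 2 * c + 2 ≤ m) (hA : 𝓐 ⊆ univ.powersetCard (c + 2))
    (hB : 𝓑 ⊆ univ.powersetCard (c + 2)) (hb : (m + 2).choose (c + 1) < #𝓑) :
    #𝓐 * #𝓑 ≤ ((m + 2).choose (c + 1) + 1) *
      ((m + 2).choose (c + 1) - (m - c).choose (c + 1)) := by
  obtain ⟨𝓐', hA', 𝓑', hB', h', hAA, hBB, hlex⟩ := h.exists_lex (by lia) hA hB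
  refine (Nat.mul_le_mul hAA hBB.ge).trans ?_
  rw [← hBB] at hb
  clear hBB hAA hB hA h 𝓐 𝓑
  rename' 𝓐' => 𝓐, 𝓑' => 𝓑, hA' => hA, hB' => hB, h' => h
  set e₁ : Fin (m + 3) := ⟨m + 2, by lia⟩ with he₁
  set e₂ : Fin (m + 3) := ⟨m + 1, by lia⟩ with he₂
  set e₃ : Fin (m + 3) := ⟨m, by lia⟩ with he₃
  have h₂₁ : e₂ < e₁ := by simp [he₁, he₂]
  have h₃₂ : e₃ < e₂ := by simp [he₃, he₂]
  have hcases : ∀ x, x = e₁ ∨ x = e₂ ∨ x = e₃ ∨ x < e₃ := by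
    intro x
    simp only [he₁, he₂, he₃, Fin.ext_iff, Fin.lt_def]
    lia
  have cfg : Config univ 𝓐 𝓑 e₁ e₂ e₃ m c :=
    { cross := h, subset_left := hA, subset_right := hB, mem₁ := mem_univ _,
      mem₂ := mem_erase.2 ⟨h₂₁.ne, mem_univ _⟩
      mem₃ := mem_erase.2 ⟨h₃₂.ne, mem_erase.2 ⟨(h₃₂.trans h₂₁).ne, mem_univ _⟩⟩
      card_eq := by simp
      le := hm }
  have step : ∀ p : Finset (Fin (m + 3)) → Prop, (∀ A B, p A →
      (∃ x ∈ B, x ∉ A ∧ ∀ y ∈ A, y ∉ B → y < x) → p B) →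
      (∀ B, #B = c + 2 → p B → B ∈ 𝓑) ∨ ∀ B ∈ 𝓑, p B := by
    classical
    intro p hp
    rcases hlex {B ∈ univ.powersetCard (c + 2) | p B} (filter_subset _ _)
      (fun A hA B hB hAB => mem_filter.2 ⟨mem_powersetCard.2 ⟨subset_univ _, hB⟩,
        hp A B (mem_filter.1 hA).2 hAB⟩) with h | h
    · exact Or.inl fun B hB hpB =>
        h (mem_filter.2 ⟨mem_powersetCard.2 ⟨subset_univ _, hB⟩, hpB⟩)
    · exact Or.inr fun B hB => (mem_filter.1 (h hB)).2
  have colex := @mem_of_colex_lt _ _ _ _ _ h₂₁ h₃₂ hcases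
  have hq : 0 < m.choose c := Nat.choose_pos (by lia)
  have hp2q := choose_succ_lt_two_mul hm
  have hEqr := choose_sub_add_choose_le hm
  have c1 := Nat.choose_succ_succ (m + 1) c
  have c2 := Nat.choose_succ_succ m c
  have c3 : m.choose c ≤ (m + 1).choose c := Nat.choose_le_choose _ (by lia)
  simp only [Nat.succ_eq_add_one] at c1 c2
  have hE : (m - c).choose (c + 1) ≤ (m + 2).choose (c + 1) := Nat.choose_le_choose _ (by lia)
  have finish : ∀ a b : ℕ, (a * b : ℤ) ≤ ((m + 1).choose c + m.choose c + m.choose (c + 1) + 1) *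
      ((m + 1).choose c + 2 * m.choose c - 1) → a * b ≤ ((m + 2).choose (c + 1) + 1) *
      ((m + 2).choose (c + 1) - (m - c).choose (c + 1)) := by
    intro a b hab
    zify [hE]
    refine hab.trans (mul_le_mul (by lia) (by lia) (by lia) (by lia))
  have hA1 : ∀ A ∈ 𝓐, e₁ ∈ A := by
    rcases step (fun B => e₁ ∈ B) fun A B hpA hx => (colex hx).1 hpA with h1 | h1
    · simpa using h.not_disjoint_of_forall_superset (by lia) hA (S := {e₁}) (by simp) (by simpa)
    · have := card_memberSubfamily_le_choose hB (mem_univ e₁) cfg.card_eq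
      rw [card_memberSubfamily_of_forall_mem h1] at this
      exact absurd hb this.not_gt
  rcases step (fun B => e₁ ∈ B ∨ e₂ ∈ B ∧ e₃ ∈ B) fun A B hpA hx => (colex hx).2.1 hpA with h2 | h2
  swap
  · exact mul_le_mul_of_add_le hE hb (cfg.card_add_card_le hA1 h2 hb)
  rcases step (fun B => e₁ ∈ B ∨ e₂ ∈ B) fun A B hpA hx => (colex hx).2.2.1 hpA with h3 | h3
  swap
  · have hA2 : ∀ A ∈ 𝓐, e₂ ∈ A ∨ e₃ ∈ A := by
      have := h.not_disjoint_of_forall_superset (by lia) hA (S := {e₂, e₃})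
        (card_le_two.trans (by lia)) (fun B hB hS => h2 B hB (Or.inr ⟨hS (by simp), hS (by simp)⟩))
      intro A hAA
      have := this A hAA
      simp only [disjoint_insert_right, disjoint_singleton_right] at this
      tauto
    obtain ⟨u, v, hu, huv, hau, hbv⟩ := cfg.exists_weights hA1 hA2 h3
    refine finish _ _ (mul_le_of_weighted_le (α := u) (β := v) (by lia) (by lia) (by lia) (by lia)
      (by lia) (by lia) (by lia) (mod_cast huv) (mod_cast hau) (by lia))
  have hA2 : ∀ A ∈ 𝓐, e₂ ∈ A := by
    simpa using h.not_disjoint_of_forall_superset (by lia) hA (S := {e₂}) (by simp)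
      (fun B hB hS => h3 B hB (Or.inr (by simpa using hS)))
  rcases step (fun B => e₁ ∈ B ∨ e₂ ∈ B ∨ e₃ ∈ B) fun A B hpA hx =>
    (colex hx).2.2.2 hpA with h4 | h4
  swap
  · obtain ⟨u, v, hu, huv, hau, hbv⟩ := cfg.exists_weights' hA1 hA2 h4
    refine finish _ _ (mul_le_of_weighted_le (α := u - m.choose c) (β := v + m.choose (c + 1))
      (r := m.choose (c + 1)) (q := m.choose c) (p := (m + 1).choose c)
      (by lia) (by lia) (by lia) (by lia) (by lia) (by lia) (by lia) ?_ (by lia) (by lia))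
    have : (u * m.choose (c + 1) + v * m.choose c : ℤ) ≤ m.choose c * m.choose (c + 1) :=
      mod_cast huv
    linarith
  have hA3 : ∀ A ∈ 𝓐, e₃ ∈ A := by
    simpa using h.not_disjoint_of_forall_superset (by lia) hA (S := {e₃}) (by simp)
      (fun B hB hS => h4 B hB (Or.inr (Or.inr (by simpa using hS))))
  have h5 := mul_choose_le_of_mul_le hm (cfg.card_mul_le hA1 hA2 hA3)
  have h6 : #𝓑 ≤ (m + 3).choose (c + 2) := by simpa using card_le_card hB
  have h7 : #𝓐 * #𝓑 ≤ 2 * m.choose c * (m + 2).choose (c + 1) :=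
    (Nat.mul_le_mul_left _ h6).trans h5
  refine finish _ _ ((Int.ofNat_le.2 h7).trans ?_)
  rw [c1, c2]
  push_cast
  have h8 : (m.choose c : ℤ) ≤ (m + 1).choose c := mod_cast c3
  have h9 : (1 : ℤ) ≤ m.choose c := mod_cast hq
  nlinarith

/-- The main bound, over the ground set `Fin n`. -/
theorem Cross.card_mul_card_le {n k : ℕ} {𝓐 𝓑 : Finset (Finset (Fin n))}
    (h : Cross 𝓐 𝓑) (hk : 0 < k) (hn : 2 * k < n) (hA : 𝓐 ⊆ univ.powersetCard k)
    (hB : 𝓑 ⊆ univ.powersetCard k) (hb : (n - 1).choose (k - 1) ≤ #𝓑)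
    (hempty : ∀ x, ∃ B ∈ 𝓑, x ∉ B) :
    #𝓐 * #𝓑 ≤ ((n - 1).choose (k - 1) + 1) *
      ((n - 1).choose (k - 1) - (n - k - 1).choose (k - 1)) := by
  obtain rfl | hk2 : k = 1 ∨ 2 ≤ k := by lia
  · have : 𝓐 = ∅ := by
      refine eq_empty_of_forall_notMem fun A hAA => ?_
      obtain ⟨x, rfl⟩ := card_eq_one.1 (mem_powersetCard.1 (hA hAA)).2
      obtain ⟨B, hBB, hx⟩ := hempty x
      exact h _ hAA B hBB (disjoint_singleton_left.2 hx)
    simp [this]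
  rcases hb.eq_or_lt with hb | hb
  · have h1 := h.card_add_choose_le_of_card_eq hk hn hA hB hb.symm hempty
    rw [← hb, mul_comm]
    exact Nat.mul_le_mul (Nat.le_succ _) (by lia)
  · obtain ⟨c, rfl⟩ := Nat.exists_eq_add_of_le' hk2
    obtain ⟨m, rfl⟩ := Nat.exists_eq_add_of_le' (show 3 ≤ n by lia)
    have e1 : m + 3 - (c + 2) - 1 = m - c := by lia
    rw [e1]
    exact h.card_mul_card_le_of_lt (by lia) hA hB hb

end Main

section Transport

/-- The copy of `Fin n` in the natural numbers whose image is `Icc 1 n`. -/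
def finSucc (n : ℕ) : Fin n ↪ ℕ := ⟨fun i => i + 1, fun i j h => Fin.ext (by simpa using h)⟩

theorem map_preimage_finSucc {n : ℕ} {S : Finset ℕ} (hS : S ⊆ Icc 1 n) :
    (univ.filter fun i => finSucc n i ∈ S).map (finSucc n) = S := by
  ext x
  simp only [mem_map, mem_filter, mem_univ, true_and]
  refine ⟨fun ⟨i, hi, h⟩ => h ▸ hi, fun hx => ?_⟩
  have := mem_Icc.1 (hS hx)
  have hx' : finSucc n ⟨x - 1, by lia⟩ = x := Nat.sub_add_cancel this.1
  exact ⟨⟨x - 1, by lia⟩, by rwa [hx'], hx'⟩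

/-- Pull a family of subsets of `Icc 1 n` back to `Fin n`. -/
def pullback (n : ℕ) (𝓕 : Finset (Finset ℕ)) : Finset (Finset (Fin n)) :=
  univ.filter fun S => S.map (finSucc n) ∈ 𝓕

theorem mem_pullback {n : ℕ} {𝓕 : Finset (Finset ℕ)} {S : Finset (Fin n)} :
    S ∈ pullback n 𝓕 ↔ S.map (finSucc n) ∈ 𝓕 := by simp [pullback]

theorem exists_mem_pullback {n : ℕ} {𝓕 : Finset (Finset ℕ)} (h : ∀ S ∈ 𝓕, S ⊆ Icc 1 n)
    {S : Finset ℕ} (hS : S ∈ 𝓕) : ∃ T ∈ pullback n 𝓕, T.map (finSucc n) = S :=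
  ⟨_, mem_pullback.2 (by rwa [map_preimage_finSucc (h S hS)]), map_preimage_finSucc (h S hS)⟩

theorem card_pullback {n : ℕ} {𝓕 : Finset (Finset ℕ)} (h : ∀ S ∈ 𝓕, S ⊆ Icc 1 n) :
    #(pullback n 𝓕) = #𝓕 :=
  card_nbij (fun S => S.map (finSucc n)) (fun _ hS => mem_pullback.1 hS)
    (map_injective _).injOn fun _ hS => exists_mem_pullback h hS

theorem pullback_subset_powersetCard {n k : ℕ} {𝓕 : Finset (Finset ℕ)} (h : ∀ S ∈ 𝓕, #S = k) :
    pullback n 𝓕 ⊆ univ.powersetCard k := fun S hS =>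
  mem_powersetCard.2 ⟨subset_univ _, by rw [← h _ (mem_pullback.1 hS), card_map]⟩

end Transport

end CrossIntersecting

/-- Theorem 1: if `𝓐, 𝓑` are cross-intersecting families of `k`-subsets of `[n]`,
`n > 2k > 0`, `|𝓐| ≤ binom(n-1,k-1) ≤ |𝓑|` and the intersection of all members
of `𝓑` is empty, then
`|𝓐|·|𝓑| ≤ (binom(n-1,k-1) + 1)·(binom(n-1,k-1) − binom(n-k-1,k-1))`. -/
theorem thm1 (n k : ℕ) (hk : 0 < k) (hn : 2 * k < n)
    (𝓐 𝓑 : Finset (Finset ℕ))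
    (h𝓐 : ∀ A ∈ 𝓐, A ⊆ Finset.Icc 1 n ∧ A.card = k)
    (h𝓑 : ∀ B ∈ 𝓑, B ⊆ Finset.Icc 1 n ∧ B.card = k)
    (hcross : ∀ A ∈ 𝓐, ∀ B ∈ 𝓑, (A ∩ B).Nonempty)
    (hA_le : 𝓐.card ≤ (n - 1).choose (k - 1))
    (hB_ge : (n - 1).choose (k - 1) ≤ 𝓑.card)
    (hBint : ∀ x : ℕ, ∃ B ∈ 𝓑, x ∉ B) :
    𝓐.card * 𝓑.card ≤
      ((n - 1).choose (k - 1) + 1) *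
        ((n - 1).choose (k - 1) - (n - k - 1).choose (k - 1)) := by
  have hA := CrossIntersecting.card_pullback fun A hA => (h𝓐 A hA).1
  have hB := CrossIntersecting.card_pullback fun B hB => (h𝓑 B hB).1
  have hc : CrossIntersecting.Cross (CrossIntersecting.pullback n 𝓐)
      (CrossIntersecting.pullback n 𝓑) := by
    intro A hA B hB hd
    have := hcross _ (CrossIntersecting.mem_pullback.1 hA) _ (CrossIntersecting.mem_pullback.1 hB)
    rw [← Finset.not_disjoint_iff_nonempty_inter, Finset.disjoint_map] at this
    exact this hd
  rw [← hA, ← hB]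
  refine hc.card_mul_card_le hk hn
    (CrossIntersecting.pullback_subset_powersetCard fun A hA => (h𝓐 A hA).2)
    (CrossIntersecting.pullback_subset_powersetCard fun B hB => (h𝓑 B hB).2)
    (hB_ge.trans hB.ge) fun x => ?_
  obtain ⟨B, hBB, hx⟩ := hBint (CrossIntersecting.finSucc n x)
  obtain ⟨T, hT, rfl⟩ := CrossIntersecting.exists_mem_pullback (fun B hB => (h𝓑 B hB).1) hBB
  exact ⟨T, hT, fun h => hx (Finset.mem_map_of_mem _ h)⟩
end

section
/- Let n, k, i be integers with n ≥ 2k > 0 and 3 ≤ i ≤ k+1, and let 𝓐 and 𝓑 be cross-intersecting families of k-subsets of [n] such that |𝓑| ≥ binom(n-1, k-1) + binom(n-i, k-i+1). Then |𝓐|·|𝓑| ≤ (binom(n-1, k-1) + binom(n-i, k-i+1))·(binom(n-1, k-1) − binom(n-i, k-1)). -/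
open Finset
open scoped FinsetFamily

theorem Finset.Colex.exists_isInitSeg_card_eq_s2 {α : Type*} [LinearOrder α] [Fintype α]
    (r : ℕ) {m : ℕ} (hm : m ≤ (Fintype.card α).choose r) :
    ∃ 𝒞 : Finset (Finset α), Colex.IsInitSeg 𝒞 r ∧ #𝒞 = m := by
  induction m with
  | zero => exact ⟨∅, by simp, rfl⟩
  | succ m ih =>
    obtain ⟨𝒞, h𝒞, hcard⟩ := ih (by lia)
    have hne : (powersetCard r univ \ 𝒞).Nonempty := by
      rw [sdiff_nonempty]
      intro h
      have := card_le_card h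
      rw [card_powersetCard, card_univ] at this
      lia
    obtain ⟨s, hs, hmin⟩ := exists_min_image _ (fun t : Finset α => toColex t) hne
    simp only [mem_sdiff, mem_powersetCard_univ] at hs hmin
    refine ⟨insert s 𝒞, ⟨?_, ?_⟩, by rw [card_insert_of_notMem hs.2, hcard]⟩
    · intro t ht
      rcases mem_insert.1 (mem_coe.1 ht) with rfl | ht
      · exact hs.1
      · exact h𝒞.1 ht
    · rintro u t hu ⟨htu, ht⟩
      by_contra hcon
      rw [mem_insert, not_or] at hcon
      rcases mem_insert.1 hu with rfl | hu
      · exact (hmin t ⟨ht, hcon.2⟩).not_gt htu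
      · exact hcon.2 (h𝒞.2 hu ⟨htu, ht⟩)

/-- `X` strictly precedes `B` in the lexicographic order: the smallest element of the symmetric
difference lies in `X`. -/
def LexPrec (X B : Finset ℕ) : Prop :=
  ∃ m ∈ X, m ∉ B ∧ ∀ y < m, y ∈ X ↔ y ∈ B

/-- Pull back a subset of `[n]` to `Fin n`, reversing the order. -/
def revPullback (n : ℕ) (s : Finset ℕ) : Finset (Fin n) := {x | n - x.val ∈ s}

theorem card_revPullback {n : ℕ} {s : Finset ℕ} (hs : s ⊆ Icc 1 n) : #(revPullback n s) = #s := by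
  refine card_bij (fun x _ => n - x.val) ?_ ?_ ?_
  · intro x hx
    simpa [revPullback] using hx
  · intro x _ y _ h
    ext
    lia
  · intro b hb
    have := mem_Icc.1 (hs hb)
    refine ⟨⟨n - b, by lia⟩, ?_, by simp; lia⟩
    have h : n - (n - b) = b := by lia
    simpa [revPullback, h] using hb

theorem revPullback_injOn (n : ℕ) {s t : Finset ℕ} (hs : s ⊆ Icc 1 n) (ht : t ⊆ Icc 1 n)
    (h : revPullback n s = revPullback n t) : s = t := by
  ext b
  by_cases hb : b ∈ Icc 1 n
  · rw [mem_Icc] at hb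
    have := congrArg (fun u => (⟨n - b, by lia⟩ : Fin n) ∈ u) h
    have h' : n - (n - b) = b := by lia
    simpa [revPullback, h'] using this
  · exact ⟨fun h' => absurd (hs h') hb, fun h' => absurd (ht h') hb⟩

theorem exists_revPullback_eq (n : ℕ) (u : Finset (Fin n)) :
    ∃ s ⊆ Icc 1 n, revPullback n s = u := by
  refine ⟨u.image fun x => n - x.val, ?_, ?_⟩
  · intro b hb
    obtain ⟨x, -, rfl⟩ := mem_image.1 hb
    rw [mem_Icc]
    lia
  · ext x
    simp only [revPullback, mem_filter, mem_univ, true_and, mem_image]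
    refine ⟨?_, fun h => ⟨x, h, rfl⟩⟩
    rintro ⟨y, hy, hxy⟩
    have : x = y := by
      ext
      lia
    exact this ▸ hy

theorem card_filter_revPullback (n k : ℕ) {𝒟 : Finset (Finset (Fin n))}
    (h𝒟 : ∀ u ∈ 𝒟, #u = k) :
    #{s ∈ powersetCard k (Icc 1 n) | revPullback n s ∈ 𝒟} = #𝒟 := by
  refine card_bij (fun s _ => revPullback n s) ?_ ?_ ?_
  · intro s hs
    exact (mem_filter.1 hs).2
  · intro s hs t ht h
    exact revPullback_injOn n (mem_powersetCard.1 (mem_filter.1 hs).1).1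
      (mem_powersetCard.1 (mem_filter.1 ht).1).1 h
  · intro u hu
    obtain ⟨s, hs, rfl⟩ := exists_revPullback_eq n u
    exact ⟨s, mem_filter.2
      ⟨mem_powersetCard.2 ⟨hs, by rw [← card_revPullback hs, h𝒟 _ hu]⟩, hu⟩, rfl⟩

theorem LexPrec.toColex_compl_lt {n : ℕ} {X B : Finset ℕ} (hX : X ⊆ Icc 1 n) (h : LexPrec X B) :
    toColex (revPullback n X)ᶜ < toColex (revPullback n B)ᶜ := by
  obtain ⟨m, hmX, hmB, hlt⟩ := h
  have hm := mem_Icc.1 (hX hmX)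
  have hnm : n - (n - m) = m := by lia
  rw [Colex.toColex_lt_toColex_iff_exists_forall_lt]
  refine ⟨⟨n - m, by lia⟩, by simpa [revPullback, hnm] using hmB,
    by simpa [revPullback, hnm] using hmX, ?_⟩
  intro b hb hb'
  simp only [revPullback, mem_compl, mem_filter, mem_univ, true_and, not_not] at hb hb'
  by_contra hcon
  rw [Fin.lt_def, not_lt] at hcon
  simp only at hcon
  rcases hcon.eq_or_lt with h | h
  · rw [← h, hnm] at hb
    exact hb hmX
  · exact hb ((hlt _ (by lia)).2 hb')

/-- Hilton's form of the **Kruskal-Katona theorem**: in a cross-intersecting pair of families of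
`k`-subsets of `[n]`, the second family may be replaced by a lexicographic initial segment. -/
theorem exists_lex_crossIntersecting {n k : ℕ} (hn : 2 * k ≤ n) {𝒜 ℬ : Finset (Finset ℕ)}
    (h𝒜 : 𝒜 ⊆ powersetCard k (Icc 1 n)) (hℬ : ℬ ⊆ powersetCard k (Icc 1 n))
    (hcross : ∀ A ∈ 𝒜, ∀ B ∈ ℬ, ¬ Disjoint A B) :
    ∃ 𝒜' ⊆ powersetCard k (Icc 1 n), ∃ ℬ' ⊆ powersetCard k (Icc 1 n),
      (∀ A ∈ 𝒜', ∀ B ∈ ℬ', ¬ Disjoint A B) ∧ #𝒜 ≤ #𝒜' ∧ #ℬ' = #ℬ ∧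
      ∀ B ∈ ℬ', ∀ X ∈ powersetCard k (Icc 1 n), LexPrec X B → X ∈ ℬ' := by
  set U := powersetCard k (Icc 1 n) with hU
  have hUsub : ∀ s ∈ U, s ⊆ Icc 1 n := fun s hs => (mem_powersetCard.1 hs).1
  have hUcard : ∀ s ∈ U, #(revPullback n s) = k := fun s hs => by
    rw [card_revPullback (hUsub s hs), (mem_powersetCard.1 hs).2]
  have hUcompl : ∀ s ∈ U, #(revPullback n s)ᶜ = n - k := fun s hs => by
    rw [card_compl, hUcard s hs, Fintype.card_fin]
  set 𝒞 : Finset (Finset (Fin n)) := ℬ.image fun B => (revPullback n B)ᶜ with h𝒞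
  have h𝒞card : #𝒞 = #ℬ := card_image_of_injOn fun s hs t ht h =>
    revPullback_injOn n (hUsub s (hℬ hs)) (hUsub t (hℬ ht)) (compl_injective h)
  have h𝒞sized : (𝒞 : Set (Finset (Fin n))).Sized (n - k) := by
    intro u hu
    obtain ⟨B, hB, rfl⟩ := mem_image.1 (mem_coe.1 hu)
    exact hUcompl B (hℬ hB)
  obtain ⟨𝒟, h𝒟, h𝒟card⟩ := Colex.exists_isInitSeg_card_eq_s2 (α := Fin n) (n - k) (m := #𝒞)
    (by simpa using h𝒞sized.card_le)
  have hkk := iterated_kk (k := n - 2 * k) h𝒞sized h𝒟card.le h𝒟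
  have hsize : n - k - (n - 2 * k) = k := by lia
  have hshadow : ∀ u ∈ ∂^[n - 2 * k] 𝒟, #u = k := fun u hu => by
    rw [← hsize]
    exact h𝒟.1.shadow_iterate hu
  have hshadow' : ∀ u ∈ ∂^[n - 2 * k] 𝒞, #u = k := fun u hu => by
    rw [← hsize]
    exact h𝒞sized.shadow_iterate hu
  refine ⟨{A ∈ U | revPullback n A ∉ ∂^[n - 2 * k] 𝒟}, filter_subset _ _,
    {B ∈ U | (revPullback n B)ᶜ ∈ 𝒟}, filter_subset _ _, ?_, ?_, ?_, ?_⟩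
  · intro A hA B hB hdisj
    rw [mem_filter] at hA hB
    refine hA.2 (mem_shadow_iterate_iff_exists_card.2 ?_)
    have hsub : revPullback n A ⊆ (revPullback n B)ᶜ := by
      intro x hx
      simp only [revPullback, mem_compl, mem_filter, mem_univ, true_and] at hx ⊢
      exact disjoint_left.1 hdisj hx
    refine ⟨(revPullback n B)ᶜ \ revPullback n A, ?_, disjoint_sdiff, ?_⟩
    · rw [card_sdiff_of_subset hsub, hUcompl B hB.1, hUcard A hA.1]
      lia
    · rw [union_sdiff_of_subset hsub]
      exact hB.2
  · have h1 : #{A ∈ U | revPullback n A ∈ ∂^[n - 2 * k] 𝒟} = #(∂^[n - 2 * k] 𝒟) :=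
      card_filter_revPullback n k hshadow
    have h2 : #{A ∈ U | revPullback n A ∈ ∂^[n - 2 * k] 𝒞} = #(∂^[n - 2 * k] 𝒞) :=
      card_filter_revPullback n k hshadow'
    have h3 := card_filter_add_card_filter_not (s := U) (fun A => revPullback n A ∈ ∂^[n - 2 * k] 𝒟)
    have h4 := card_filter_add_card_filter_not (s := U) (fun A => revPullback n A ∈ ∂^[n - 2 * k] 𝒞)
    have h5 : #𝒜 ≤ #{A ∈ U | revPullback n A ∉ ∂^[n - 2 * k] 𝒞} := by
      refine card_le_card fun A hA => mem_filter.2 ⟨h𝒜 hA, fun hcon => ?_⟩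
      obtain ⟨u, hu, hsub, -⟩ := mem_shadow_iterate_iff_exists_sdiff.1 hcon
      obtain ⟨B, hB, rfl⟩ := mem_image.1 hu
      refine hcross A hA B hB (disjoint_left.2 fun x hxA hxB => ?_)
      have hx := mem_Icc.1 (hUsub A (h𝒜 hA) hxA)
      have hnx : n - (n - x) = x := by lia
      have := @hsub ⟨n - x, by lia⟩ (by simpa [revPullback, hnx] using hxA)
      simp only [revPullback, mem_compl, mem_filter, mem_univ, true_and, hnx] at this
      exact this hxB
    lia
  · rw [← h𝒞card, ← h𝒟card]
    have := card_filter_revPullback n k (𝒟 := 𝒟.image compl) (by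
      intro u hu
      obtain ⟨v, hv, rfl⟩ := mem_image.1 hu
      rw [card_compl, h𝒟.1 hv, Fintype.card_fin]
      lia)
    rw [card_image_of_injective _ compl_injective] at this
    rw [← this]
    congr 1
    refine filter_congr fun B _ => ?_
    rw [mem_image]
    exact ⟨fun h => ⟨_, h, compl_compl _⟩, fun ⟨v, hv, h⟩ => by rw [← h, compl_compl]; exact hv⟩
  · intro B hB X hX hlex
    rw [mem_filter] at hB ⊢
    exact ⟨hX, h𝒟.2 hB.2 ⟨hlex.toColex_compl_lt (hUsub X hX), hUcompl X hX⟩⟩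

/-- The `k`-subsets of `Ω` containing `S` and avoiding `R`. -/
def containing (Ω : Finset ℕ) (k : ℕ) (S R : Finset ℕ) : Finset (Finset ℕ) :=
  {B ∈ powersetCard k Ω | S ⊆ B ∧ Disjoint R B}

theorem mem_containing {Ω : Finset ℕ} {k : ℕ} {S R B : Finset ℕ} :
    B ∈ containing Ω k S R ↔ B ∈ powersetCard k Ω ∧ S ⊆ B ∧ Disjoint R B := mem_filter

theorem card_containing {Ω S R : Finset ℕ} {k : ℕ} (hS : S ⊆ Ω) (hR : R ⊆ Ω) (hSR : Disjoint S R)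
    (hk : #S ≤ k) : #(containing Ω k S R) = (#Ω - #S - #R).choose (k - #S) := by
  have hcard : #((Ω \ S) \ R) = #Ω - #S - #R := by
    rw [card_sdiff_of_subset (subset_sdiff.2 ⟨hR, hSR.symm⟩), card_sdiff_of_subset hS]
  rw [← hcard, ← card_powersetCard]
  refine card_bij' (fun B _ => B \ S) (fun C _ => C ∪ S) ?_ ?_ ?_ ?_
  · intro B hB
    obtain ⟨hB, hSB, hRB⟩ := mem_containing.1 hB
    obtain ⟨hBΩ, rfl⟩ := mem_powersetCard.1 hB
    exact mem_powersetCard.2 ⟨subset_sdiff.2 ⟨sdiff_subset_sdiff hBΩ subset_rfl,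
      (hRB.mono_right sdiff_subset).symm⟩, card_sdiff_of_subset hSB⟩
  · intro C hC
    obtain ⟨hC, hCk⟩ := mem_powersetCard.1 hC
    obtain ⟨hC, hCR⟩ := subset_sdiff.1 hC
    obtain ⟨hC, hCS⟩ := subset_sdiff.1 hC
    refine mem_containing.2 ⟨mem_powersetCard.2 ⟨union_subset hC hS, ?_⟩, subset_union_right,
      disjoint_union_right.2 ⟨hCR.symm, hSR.symm⟩⟩
    rw [card_union_of_disjoint hCS]
    lia
  · intro B hB
    exact sdiff_union_of_subset (mem_containing.1 hB).2.1
  · intro C hC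
    have := (subset_sdiff.1 (subset_sdiff.1 (mem_powersetCard.1 hC).1).1).2
    simpa [union_sdiff_right] using this

theorem containing_eq_empty {Ω S R : Finset ℕ} {k : ℕ} (hk : k < #S) :
    containing Ω k S R = ∅ := by
  refine filter_eq_empty_iff.2 fun B hB h => ?_
  have := card_le_card h.1
  rw [(mem_powersetCard.1 hB).2] at this
  lia

/-- A biregular double count between the sets containing `S` and avoiding `R` and those containing
`R` and avoiding `S`, adjacent when disjoint. -/
theorem card_inter_containing_add_le {Ω S R : Finset ℕ} {k : ℕ} {𝒜 ℬ : Finset (Finset ℕ)}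
    (hΩ : 2 * k ≤ #Ω) (hS : S ⊆ Ω) (hR : R ⊆ Ω) (hSR : Disjoint S R) (hle : #R ≤ #S) (hRk : #R ≤ k)
    (hcross : ∀ A ∈ 𝒜, ∀ B ∈ ℬ, ¬ Disjoint A B) :
    #(𝒜 ∩ containing Ω k R S) + #(ℬ ∩ containing Ω k S R) ≤ #(containing Ω k R S) := by
  rcases lt_or_ge k (#S) with hSk | hSk
  · rw [containing_eq_empty hSk, inter_empty, card_empty, add_zero]
    exact card_le_card inter_subset_right
  have hdeg : ∀ {S R B : Finset ℕ}, S ⊆ Ω → R ⊆ Ω → Disjoint S R → #R ≤ k → B ∈ containing Ω k S R →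
      #(containing Ω k R B) = (#Ω - #R - k).choose (#Ω - 2 * k) := by
    intro S R B hS hR hSR hRk hB
    obtain ⟨hB, hSB, hRB⟩ := mem_containing.1 hB
    obtain ⟨hBΩ, hBk⟩ := mem_powersetCard.1 hB
    rw [card_containing hR hBΩ hRB hRk, hBk]
    exact Nat.choose_symm_of_eq_add (by lia)
  have hpos : 0 < (#Ω - #R - k).choose (#Ω - 2 * k) := Nat.choose_pos (by lia)
  have hmono : (#Ω - #S - k).choose (#Ω - 2 * k) ≤ (#Ω - #R - k).choose (#Ω - 2 * k) :=
    Nat.choose_le_choose _ (by lia)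
  have key := card_mul_le_card_mul (s := ℬ ∩ containing Ω k S R) (t := containing Ω k R S \ 𝒜)
    (fun B A => Disjoint A B) (m := (#Ω - #R - k).choose (#Ω - 2 * k))
    (n := (#Ω - #S - k).choose (#Ω - 2 * k)) ?_ ?_
  · have h1 := Nat.le_of_mul_le_mul_right (key.trans (Nat.mul_le_mul_left _ hmono)) hpos
    have h2 := card_sdiff_add_card_inter (containing Ω k R S) 𝒜
    rw [inter_comm] at h2
    lia
  · intro B hB
    rw [mem_inter] at hB
    rw [← hdeg hS hR hSR hRk hB.2]
    refine card_le_card fun A hA => ?_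
    obtain ⟨hA, hRA, hBA⟩ := mem_containing.1 hA
    refine (mem_bipartiteAbove _).2 ⟨mem_sdiff.2 ⟨mem_containing.2
      ⟨hA, hRA, hBA.mono_left (mem_containing.1 hB.2).2.1⟩, fun h => ?_⟩, hBA.symm⟩
    exact hcross A h B hB.1 hBA.symm
  · intro A hA
    rw [mem_sdiff] at hA
    rw [← hdeg hR hS hSR.symm hSk hA.1]
    refine card_le_card fun B hB => ?_
    obtain ⟨hB, hAB⟩ := (mem_bipartiteBelow _).1 hB
    obtain ⟨hB, hSB, -⟩ := mem_containing.1 (mem_inter.1 hB).2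
    exact mem_containing.2 ⟨hB, hSB, hAB⟩

theorem Nat.mul_le_mul_of_add_le_add {a b D F : ℕ} (hsum : a + b ≤ D + F) (hDF : D ≤ F)
    (hF : F ≤ b) : a * b ≤ D * F := by
  obtain ⟨t, rfl⟩ := Nat.exists_eq_add_of_le hF
  obtain ⟨u, rfl⟩ := Nat.exists_eq_add_of_le (show a + t ≤ D by lia)
  obtain ⟨v, rfl⟩ := Nat.exists_eq_add_of_le hDF
  nlinarith

/-- If `ℬ` extends `F` only by sets containing `S` and avoiding `R`, then `𝒜` loses at least as
much as `ℬ` gains, so the product of sizes cannot grow. -/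
theorem card_mul_card_le_of_extension {Ω S R : Finset ℕ} {k : ℕ} {𝒜 ℬ D F : Finset (Finset ℕ)}
    (hΩ : 2 * k ≤ #Ω) (hS : S ⊆ Ω) (hR : R ⊆ Ω) (hSR : Disjoint S R) (hle : #R ≤ #S) (hRk : #R ≤ k)
    (hcross : ∀ A ∈ 𝒜, ∀ B ∈ ℬ, ¬ Disjoint A B)
    (hD : 𝒜 ⊆ D) (hRD : containing Ω k R S ⊆ D) (hF : ℬ ⊆ F ∪ containing Ω k S R)
    (hDF : #D ≤ #F) (hFℬ : #F ≤ #ℬ) : #𝒜 * #ℬ ≤ #D * #F := by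
  refine Nat.mul_le_mul_of_add_le_add ?_ hDF hFℬ
  have h1 := card_inter_containing_add_le hΩ hS hR hSR hle hRk hcross
  have h2 : #𝒜 ≤ #(D \ containing Ω k R S) + #(𝒜 ∩ containing Ω k R S) := by
    rw [← card_sdiff_add_card_inter 𝒜 (containing Ω k R S)]
    gcongr
  have h3 : #ℬ ≤ #F + #(ℬ ∩ containing Ω k S R) := by
    refine (card_le_card fun B hB => ?_).trans (card_union_le _ _)
    rcases mem_union.1 (hF hB) with h | h
    · exact mem_union_left _ h
    · exact mem_union_right _ (mem_inter.2 ⟨hB, h⟩)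
  have h4 := card_sdiff_add_card_eq_card hRD
  lia

theorem not_disjoint_of_containing_subset {Ω S : Finset ℕ} {k : ℕ} {ℬ : Finset (Finset ℕ)}
    (hΩ : 2 * k ≤ #Ω) (hS : S ⊆ Ω) (hk : #S ≤ k) (hsub : ∀ X ∈ powersetCard k Ω, S ⊆ X → X ∈ ℬ)
    {A : Finset ℕ} (hA : A ∈ powersetCard k Ω) (hcross : ∀ B ∈ ℬ, ¬ Disjoint A B) :
    ¬ Disjoint A S := by
  intro hdisj
  obtain ⟨hAΩ, hAk⟩ := mem_powersetCard.1 hA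
  obtain ⟨X, hSX, hX, hXk⟩ := exists_subsuperset_card_eq (subset_sdiff.2 ⟨hS, hdisj.symm⟩) hk
    (by rw [card_sdiff_of_subset hAΩ]; lia)
  exact hcross X (hsub X (mem_powersetCard.2 ⟨hX.trans sdiff_subset, hXk⟩) hSX)
    (disjoint_sdiff.mono_right hX)

theorem lex_closed_dichotomy {U ℬ : Finset (Finset ℕ)} (hℬ : ℬ ⊆ U)
    (hlex : ∀ B ∈ ℬ, ∀ X ∈ U, LexPrec X B → X ∈ ℬ) {p : Finset ℕ → Prop}
    (hp : ∀ X ∈ U, ∀ B ∈ U, p X → ¬ p B → LexPrec X B) :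
    (∀ X ∈ U, p X → X ∈ ℬ) ∨ ∀ B ∈ ℬ, p B := by
  by_contra! h
  obtain ⟨⟨X, hX, hpX, hXℬ⟩, B, hB, hpB⟩ := h
  exact hXℬ (hlex B hB X hX (hp X hX B (hℬ hB) hpX hpB))

theorem lex_bounds_aux {u d c y a g e h f U : ℝ} (hu : 0 ≤ u) (hd : 0 ≤ d)
    (hy : y * (2 * u + 3 + d) = c * (u + 2 + d)) (ha : a * (2 * u + 3 + d) = c * (u + 1))
    (hg : g * (2 * u + 2 + d) = a * (u + 2 + d)) (he : e * (2 * u + 1 + d) = g * u)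
    (hh : h * (2 * u + 1 + d) = g * (u + 1 + d)) (hf : f * (2 * u + 2 + d) = a * u)
    (hU : U * (u + 2) = c * (2 * u + 4 + d)) :
    (a + e) * (c + y) ≤ (a + g) * (c + g) ∧ a * (c + y + h) ≤ (a + g) * (c + g) ∧
      (f + e) * U ≤ (a + g) * (c + g) := by
  have h1 : 0 < 2 * u + 1 + d := by positivity
  have h2 : 0 < 2 * u + 2 + d := by positivity
  have h3 : 0 < 2 * u + 3 + d := by positivity
  rw [← eq_div_iff (by positivity)] at hy ha hg he hh hf hU
  subst hU hf hh he hg ha hy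
  refine ⟨?_, ?_, ?_⟩ <;>
  · rw [← sub_nonneg]
    field_simp
    ring_nf
    positivity

/-- The sets containing `1` or all of `2, …, j`. -/
def lexFamily (n k j : ℕ) : Finset (Finset ℕ) :=
  {B ∈ powersetCard k (Icc 1 n) | 1 ∈ B ∨ Icc 2 j ⊆ B}

/-- The sets containing `1` and meeting `2, …, j`. -/
def dualFamily (n k j : ℕ) : Finset (Finset ℕ) :=
  {A ∈ powersetCard k (Icc 1 n) | 1 ∈ A ∧ ¬ Disjoint A (Icc 2 j)}

theorem zero_notMem_of_mem_powersetCard {n k : ℕ} {X : Finset ℕ}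
    (hX : X ∈ powersetCard k (Icc 1 n)) : 0 ∉ X := fun h =>
  absurd (mem_Icc.1 ((mem_powersetCard.1 hX).1 h)).1 (by simp)

theorem card_lexFamily {n k j : ℕ} (hn : 2 * k ≤ n) (hj : 3 ≤ j) (hjk : j ≤ k + 1) :
    #(lexFamily n k j) = (n - 1).choose (k - 1) + (n - j).choose (k + 1 - j) := by
  have h1 : #(containing (Icc 1 n) k {1} ∅) = (n - 1).choose (k - 1) := by
    rw [card_containing (by simp; lia) (by simp) (by simp) (by simp; lia)]
    simp
  have h2 : #(containing (Icc 1 n) k (Icc 2 j) {1}) = (n - j).choose (k + 1 - j) := by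
    rw [card_containing (Icc_subset_Icc (by lia) (by lia)) (by simp; lia) (by simp)
      (by simp; lia)]
    simp only [Nat.card_Icc, card_singleton]
    congr 1 <;> lia
  rw [← h1, ← h2, ← card_union_of_disjoint]
  · congr 1
    ext B
    simp only [lexFamily, mem_filter, mem_union, mem_containing, singleton_subset_iff,
      disjoint_singleton_left, disjoint_empty_left]
    tauto
  · rw [disjoint_left]
    intro B hB hB'
    simp only [mem_containing, singleton_subset_iff, disjoint_singleton_left] at hB hB'
    exact hB'.2.2 hB.2.1

theorem card_dualFamily {n k j : ℕ} (hn : 2 * k ≤ n) (hj : 3 ≤ j) (hjk : j ≤ k + 1) :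
    #(dualFamily n k j) = (n - 1).choose (k - 1) - (n - j).choose (k - 1) := by
  have h1 : #(containing (Icc 1 n) k {1} ∅) = (n - 1).choose (k - 1) := by
    rw [card_containing (by simp; lia) (by simp) (by simp) (by simp; lia)]
    simp
  have h2 : #(containing (Icc 1 n) k {1} (Icc 2 j)) = (n - j).choose (k - 1) := by
    rw [card_containing (by simp; lia) (Icc_subset_Icc (by lia) (by lia)) (by simp)
      (by simp; lia)]
    simp only [Nat.card_Icc, card_singleton]
    congr 1
    lia
  have hsub : containing (Icc 1 n) k {1} (Icc 2 j) ⊆ containing (Icc 1 n) k {1} ∅ := by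
    intro A hA
    simp only [mem_containing] at hA ⊢
    exact ⟨hA.1, hA.2.1, by simp⟩
  rw [← h1, ← h2, ← card_sdiff_of_subset hsub]
  congr 1
  ext A
  simp only [dualFamily, mem_filter, mem_sdiff, mem_containing, singleton_subset_iff,
    disjoint_empty_left, disjoint_comm (a := A)]
  tauto

theorem card_dualFamily_le_card_lexFamily (n k j : ℕ) :
    #(dualFamily n k j) ≤ #(lexFamily n k j) :=
  card_le_card fun _ hA => mem_filter.2
    ⟨(mem_filter.1 hA).1, Or.inl (mem_filter.1 hA).2.1⟩

theorem Nat.choose_le_choose_of_add_le {N a b : ℕ} (hab : a ≤ b) (hN : a + b ≤ N) :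
    N.choose a ≤ N.choose b := by
  have key : ∀ c, a ≤ c → 2 * c ≤ N → N.choose a ≤ N.choose c := by
    intro c hac
    induction c, hac using Nat.le_induction with
    | base => exact fun _ => le_rfl
    | succ c _ ih =>
      exact fun h => (ih (by lia)).trans (Nat.choose_le_succ_of_lt_half_left (by lia))
  rcases le_or_gt (2 * b) N with h | h
  · exact key b hab h
  · rw [← Nat.choose_symm (show b ≤ N by by_contra hb; lia)]
    exact key _ (by lia) (by lia)

theorem card_dualFamily_mul_card_lexFamily_le_succ {n k j : ℕ} (hn : 2 * k ≤ n) (hj : 3 ≤ j)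
    (hjk : j ≤ k) :
    #(dualFamily n k j) * #(lexFamily n k j) ≤
      #(dualFamily n k (j + 1)) * #(lexFamily n k (j + 1)) := by
  have hmono : #(lexFamily n k (j + 1)) ≤ #(lexFamily n k j) := by
    refine card_le_card fun B hB => ?_
    rw [lexFamily, mem_filter] at hB ⊢
    exact ⟨hB.1, hB.2.imp_right (Icc_subset_Icc_right (by lia)).trans⟩
  refine Nat.mul_le_mul_of_add_le_add ?_ (card_dualFamily_le_card_lexFamily n k (j + 1)) hmono
  rw [card_dualFamily hn hj (by lia), card_dualFamily hn (by lia) (by lia),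
    card_lexFamily hn hj (by lia), card_lexFamily hn (by lia) (by lia)]
  have h1 : (n - j).choose (k + 1 - j) =
      (n - (j + 1)).choose (k - j) + (n - (j + 1)).choose (k + 1 - j) := by
    rw [show n - j = n - (j + 1) + 1 by lia, show k + 1 - j = k - j + 1 by lia,
      Nat.choose_succ_succ]
  have h2 : (n - j).choose (k - 1) =
      (n - (j + 1)).choose (k - 2) + (n - (j + 1)).choose (k - 1) := by
    rw [show n - j = n - (j + 1) + 1 by lia, show k - 1 = k - 2 + 1 by lia,
      Nat.choose_succ_succ]
  have h3 : (n - (j + 1)).choose (k + 1 - j) ≤ (n - (j + 1)).choose (k - 2) :=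
    Nat.choose_le_choose_of_add_le (by lia) (by lia)
  have h4 : (n - j).choose (k - 1) ≤ (n - 1).choose (k - 1) :=
    Nat.choose_le_choose _ (by lia)
  rw [show k + 1 - (j + 1) = k - j by lia]
  lia

theorem lexPrec_of_prefix {X B : Finset ℕ} {j : ℕ} (hX0 : 0 ∉ X) (hB0 : 0 ∉ B)
    (hX : 1 ∈ X ∨ Icc 2 j ⊆ X) (hB : ¬ (1 ∈ B ∨ Icc 2 j ⊆ B)) : LexPrec X B := by
  rw [not_or, not_subset] at hB
  by_cases h1 : 1 ∈ X
  · exact ⟨1, h1, hB.1, fun y hy => by simp [Nat.lt_one_iff.1 hy, hX0, hB0]⟩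
  replace hX := hX.resolve_left h1
  have hex := hB.2
  obtain ⟨hm, hmB⟩ := Nat.find_spec hex
  refine ⟨Nat.find hex, hX hm, hmB, fun y hy => ?_⟩
  rw [mem_Icc] at hm
  rcases Nat.lt_or_ge y 2 with h | h
  · interval_cases y
    · simp [hX0, hB0]
    · simp [h1, hB.1]
  · have hy' : y ∈ Icc 2 j := mem_Icc.2 ⟨h, by lia⟩
    have := Nat.find_min hex hy
    simp only [hy', true_and, not_not] at this
    simp [hX hy', this]

theorem lexPrec_of_le_four {X B : Finset ℕ} {m : ℕ} (hm : m ≤ 4) (hX0 : 0 ∉ X) (hB0 : 0 ∉ B)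
    (hX : m ∈ X) (hB : m ∉ B) (h1 : 1 < m → (1 ∈ X ↔ 1 ∈ B)) (h2 : 2 < m → (2 ∈ X ↔ 2 ∈ B))
    (h3 : 3 < m → (3 ∈ X ↔ 3 ∈ B)) : LexPrec X B := by
  refine ⟨m, hX, hB, fun y hy => ?_⟩
  have : y < 4 := by lia
  interval_cases y
  exacts [by simp [hX0, hB0], h1 hy, h2 hy, h3 hy]

/-- Arithmetic for lexicographic families strictly larger than those handled by the extension
argument. -/
theorem lex_bounds {u d e f : ℕ} (he : e * (2 * u + 1 + d) = (2 * u + 1 + d).choose u * u)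
    (hf : f * (2 * u + 2 + d) = (2 * u + 2 + d).choose u * u) :
    ((2 * u + 2 + d).choose u + e) *
        ((2 * u + 3 + d).choose (u + 1) + (2 * u + 2 + d).choose (u + 1))
        ≤ ((2 * u + 2 + d).choose u + (2 * u + 1 + d).choose u) *
          ((2 * u + 3 + d).choose (u + 1) + (2 * u + 1 + d).choose u) ∧
      (2 * u + 2 + d).choose u * ((2 * u + 3 + d).choose (u + 1) + (2 * u + 2 + d).choose (u + 1) +
          (2 * u + d).choose u)
        ≤ ((2 * u + 2 + d).choose u + (2 * u + 1 + d).choose u) *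
          ((2 * u + 3 + d).choose (u + 1) + (2 * u + 1 + d).choose u) ∧
      (f + e) * (2 * u + 4 + d).choose (u + 2)
        ≤ ((2 * u + 2 + d).choose u + (2 * u + 1 + d).choose u) *
          ((2 * u + 3 + d).choose (u + 1) + (2 * u + 1 + d).choose u) := by
  have hy := Nat.choose_mul_succ_eq (2 * u + 2 + d) (u + 1)
  have ha := Nat.add_one_mul_choose_eq (2 * u + 2 + d) u
  have hg := Nat.choose_mul_succ_eq (2 * u + 1 + d) u
  have hh := Nat.choose_mul_succ_eq (2 * u + d) u
  have hU := Nat.add_one_mul_choose_eq (2 * u + 3 + d) (u + 1)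
  rw [show 2 * u + 2 + d + 1 = 2 * u + 3 + d by lia,
    show 2 * u + 3 + d - (u + 1) = u + 2 + d by lia] at hy
  rw [show 2 * u + 2 + d + 1 = 2 * u + 3 + d by lia] at ha
  rw [show 2 * u + 1 + d + 1 = 2 * u + 2 + d by lia,
    show 2 * u + 2 + d - u = u + 2 + d by lia] at hg
  rw [show 2 * u + d + 1 = 2 * u + 1 + d by lia,
    show 2 * u + 1 + d - u = u + 1 + d by lia] at hh
  rw [show 2 * u + 3 + d + 1 = 2 * u + 4 + d by lia, show u + 1 + 1 = u + 2 by lia] at hU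
  have := lex_bounds_aux (u := u) (d := d) (c := (2 * u + 3 + d).choose (u + 1))
    (y := (2 * u + 2 + d).choose (u + 1)) (a := (2 * u + 2 + d).choose u)
    (g := (2 * u + 1 + d).choose u) (e := e) (h := (2 * u + d).choose u) (f := f)
    (U := (2 * u + 4 + d).choose (u + 2)) (by positivity) (by positivity)
    (by exact_mod_cast hy) (by rw [mul_comm]; exact_mod_cast ha) (by exact_mod_cast hg)
    (by exact_mod_cast he) (by exact_mod_cast hh) (by exact_mod_cast hf)
    (by rw [← mul_comm (2 * u + 4 + d : ℝ)]; exact_mod_cast hU.symm)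
  exact_mod_cast this

theorem card_containing_three {u d : ℕ} {S R : Finset ℕ} (hS : S ⊆ Icc 1 (2 * u + 4 + d))
    (hR : R ⊆ Icc 1 (2 * u + 4 + d)) (hSR : Disjoint S R) (hS3 : #S = 3) (hR1 : #R ≤ 1) :
    #(containing (Icc 1 (2 * u + 4 + d)) (u + 2) S R) * (2 * u + 2 + d - #R) =
      (2 * u + 2 + d - #R).choose u * u := by
  rcases u with _ | v
  · rw [containing_eq_empty (by lia)]
    simp
  · rw [card_containing hS hR hSR (by lia), hS3, Nat.card_Icc]
    have := Nat.add_one_mul_choose_eq (2 * v + 3 + d - #R) v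
    rw [show 2 * v + 3 + d - #R + 1 = 2 * (v + 1) + 2 + d - #R by lia] at this
    rw [← this, mul_comm]
    congr 2; lia

theorem containing_bounds {n k : ℕ} (hk : 2 ≤ k) (hn : 2 * k ≤ n) :
    (#(containing (Icc 1 n) k {1, 2} ∅) + #(containing (Icc 1 n) k {1, 3, 4} {2})) *
        (#(containing (Icc 1 n) k {1} ∅) + #(containing (Icc 1 n) k {2} {1})) ≤
      #(dualFamily n k 3) * #(lexFamily n k 3) ∧
    #(containing (Icc 1 n) k {1, 2} ∅) * (#(containing (Icc 1 n) k {1} ∅) +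
        #(containing (Icc 1 n) k {2} {1}) + #(containing (Icc 1 n) k {3, 4} {1, 2})) ≤
      #(dualFamily n k 3) * #(lexFamily n k 3) ∧
    (#(containing (Icc 1 n) k {1, 2, 3} ∅) + #(containing (Icc 1 n) k {1, 2, 4} {3})) *
        #(powersetCard k (Icc 1 n)) ≤
      #(dualFamily n k 3) * #(lexFamily n k 3) := by
  obtain ⟨u, rfl⟩ := Nat.exists_eq_add_of_le' hk
  obtain ⟨d, rfl⟩ := Nat.exists_eq_add_of_le (show 2 * u + 4 ≤ n by lia)
  have h12 : #({1, 2} : Finset ℕ) = 2 := rfl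
  have h34 : #({3, 4} : Finset ℕ) = 2 := rfl
  have hP1 : #(containing (Icc 1 (2 * u + 4 + d)) (u + 2) {1} ∅) =
      (2 * u + 3 + d).choose (u + 1) := by
    rw [card_containing (by simp; lia) (by simp) (by simp) (by simp), Nat.card_Icc]
    simp only [Nat.add_sub_cancel, card_singleton, card_empty]
    congr 1; lia
  have hP21 : #(containing (Icc 1 (2 * u + 4 + d)) (u + 2) {2} {1}) =
      (2 * u + 2 + d).choose (u + 1) := by
    rw [card_containing (by simp; lia) (by simp; lia) (by simp) (by simp), Nat.card_Icc]
    simp only [Nat.add_sub_cancel, card_singleton]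
    congr 1; lia
  have hP12 : #(containing (Icc 1 (2 * u + 4 + d)) (u + 2) {1, 2} ∅) =
      (2 * u + 2 + d).choose u := by
    rw [card_containing (by simp [insert_subset_iff]; lia) (by simp) (by simp) (by simp),
      Nat.card_Icc]
    simp only [Nat.add_sub_cancel, card_empty, h12]
    congr 1; lia
  have hP34 : #(containing (Icc 1 (2 * u + 4 + d)) (u + 2) {3, 4} {1, 2}) =
      (2 * u + d).choose u := by
    rw [card_containing (by simp [insert_subset_iff]; lia) (by simp [insert_subset_iff]; lia)
      (by simp) (by simp), Nat.card_Icc]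
    simp only [Nat.add_sub_cancel, h12, h34]
    congr 1; lia
  have hP123 := card_containing_three (u := u) (d := d) (S := {1, 2, 3}) (R := ∅)
    (by simp [insert_subset_iff]; lia) (by simp) (by simp) (by simp) (by simp)
  have hP134 := card_containing_three (u := u) (d := d) (S := {1, 3, 4}) (R := {2})
    (by simp [insert_subset_iff]; lia) (by simp; lia) (by simp) (by simp) (by simp)
  have hP124 := card_containing_three (u := u) (d := d) (S := {1, 2, 4}) (R := {3})
    (by simp [insert_subset_iff]; lia) (by simp; lia) (by simp) (by simp) (by simp)
  simp only [card_empty, card_singleton, Nat.sub_zero,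
    show 2 * u + 2 + d - 1 = 2 * u + 1 + d by lia] at hP123 hP134 hP124
  have hswap : #(containing (Icc 1 (2 * u + 4 + d)) (u + 2) {1, 2, 4} {3}) =
      #(containing (Icc 1 (2 * u + 4 + d)) (u + 2) {1, 3, 4} {2}) :=
    Nat.eq_of_mul_eq_mul_right (by lia) (hP124.trans hP134.symm)
  have hD : #(dualFamily (2 * u + 4 + d) (u + 2) 3) =
      (2 * u + 2 + d).choose u + (2 * u + 1 + d).choose u := by
    rw [card_dualFamily (by lia) le_rfl (by lia)]
    have h1 := Nat.choose_succ_succ (2 * u + 2 + d) u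
    have h2 := Nat.choose_succ_succ (2 * u + 1 + d) u
    rw [show 2 * u + 4 + d - 1 = (2 * u + 2 + d).succ by lia,
      show 2 * u + 4 + d - 3 = 2 * u + 1 + d by lia, show u + 2 - 1 = u.succ by lia]
    rw [show (2 * u + 1 + d).succ = 2 * u + 2 + d by lia] at h2
    lia
  have hFc : #(lexFamily (2 * u + 4 + d) (u + 2) 3) =
      (2 * u + 3 + d).choose (u + 1) + (2 * u + 1 + d).choose u := by
    rw [card_lexFamily (by lia) le_rfl (by lia)]
    congr 2 <;> lia
  rw [hswap, hP1, hP21, hP12, hP34, hD, hFc, card_powersetCard, Nat.card_Icc, Nat.add_sub_cancel]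
  exact lex_bounds hP134 hP123

set_option maxHeartbeats 1000000 in
theorem card_mul_card_le_of_lexFamily_three {n k : ℕ} (hk : 2 ≤ k) (hn : 2 * k ≤ n)
    {𝒜 ℬ : Finset (Finset ℕ)} (h𝒜 : 𝒜 ⊆ powersetCard k (Icc 1 n))
    (hℬ : ℬ ⊆ powersetCard k (Icc 1 n))
    (hcross : ∀ A ∈ 𝒜, ∀ B ∈ ℬ, ¬ Disjoint A B)
    (hlex : ∀ B ∈ ℬ, ∀ X ∈ powersetCard k (Icc 1 n), LexPrec X B → X ∈ ℬ)
    (hF : lexFamily n k 3 ⊆ ℬ) :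
    #𝒜 * #ℬ ≤ #(dualFamily n k 3) * #(lexFamily n k 3) := by
  set Ω := Icc 1 n with hΩ
  have hΩcard : #Ω = n := by simp [hΩ]
  have h2k : 2 * k ≤ #Ω := by lia
  have h1Ω : 1 ∈ Ω := mem_Icc.2 (by lia)
  have h2Ω : 2 ∈ Ω := mem_Icc.2 (by lia)
  have h3Ω : 3 ∈ Ω := mem_Icc.2 (by lia)
  have h4Ω : 4 ∈ Ω := mem_Icc.2 (by lia)
  have hpair : ∀ {a b}, a ∈ Ω → b ∈ Ω → {a, b} ⊆ Ω :=
    fun ha hb => by simp [insert_subset_iff, ha, hb]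
  have hIcc : Icc 2 3 = {2, 3} := by decide
  have hmeet : ∀ S ⊆ Ω, #S ≤ k → (∀ X ∈ powersetCard k Ω, S ⊆ X → X ∈ ℬ) →
      ∀ A ∈ 𝒜, ¬ Disjoint A S := fun S hS hSk h A hA =>
    not_disjoint_of_containing_subset h2k hS hSk h (h𝒜 hA) (hcross A hA)
  have hA1 : ∀ A ∈ 𝒜, 1 ∈ A := by
    intro A hA
    simpa using hmeet {1} (by simpa) (by simp; lia) (fun X hX h =>
      hF (mem_filter.2 ⟨hX, Or.inl (by simpa using h)⟩)) A hA
  have hA23 : ∀ A ∈ 𝒜, 2 ∈ A ∨ 3 ∈ A := by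
    intro A hA
    have := hmeet {2, 3} (hpair h2Ω h3Ω) (card_le_two.trans hk) (fun X hX h =>
      hF (mem_filter.2 ⟨hX, Or.inr (by rwa [hIcc])⟩)) A hA
    simp only [disjoint_insert_right, disjoint_singleton_right] at this
    tauto
  have hlt : ∀ X ∈ powersetCard k Ω, ∀ B ∈ powersetCard k Ω, ∀ m ≤ 4, m ∈ X → m ∉ B →
      (1 < m → (1 ∈ X ↔ 1 ∈ B)) → (2 < m → (2 ∈ X ↔ 2 ∈ B)) → (3 < m → (3 ∈ X ↔ 3 ∈ B)) →
      LexPrec X B := fun X hX B hB m hm =>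
    lexPrec_of_le_four hm (zero_notMem_of_mem_powersetCard hX) (zero_notMem_of_mem_powersetCard hB)
  obtain ⟨hb1, hb2, hb3⟩ := containing_bounds hk hn
  rcases lex_closed_dichotomy hℬ hlex (p := fun X => 1 ∈ X ∨ 2 ∈ X ∧ (3 ∈ X ∨ 4 ∈ X)) (by
    intro X hX B hB hpX hpB
    have h1 := hlt X hX B hB 1
    have h2 := hlt X hX B hB 2
    have h3 := hlt X hX B hB 3
    have h4 := hlt X hX B hB 4
    grind) with hG | hG
  swap
  · refine card_mul_card_le_of_extension (S := {2, 4}) (R := {1, 3}) h2k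
      (hpair h2Ω h4Ω) (hpair h1Ω h3Ω) (by simp) (by simp) (card_le_two.trans hk) hcross ?_ ?_ ?_
      (card_dualFamily_le_card_lexFamily _ _ _) (card_le_card hF)
    · intro A hA
      refine mem_filter.2 ⟨h𝒜 hA, hA1 A hA, ?_⟩
      have := hA23 A hA
      simp only [hIcc, disjoint_insert_right, disjoint_singleton_right]
      tauto
    · intro A hA
      simp only [mem_containing, insert_subset_iff, singleton_subset_iff] at hA
      refine mem_filter.2 ⟨hA.1, hA.2.1.1, ?_⟩
      simp only [hIcc, disjoint_insert_right, disjoint_singleton_right]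
      tauto
    · intro B hB
      have := hG B hB
      simp only [mem_union, lexFamily, mem_filter, mem_containing, insert_subset_iff,
        singleton_subset_iff, hIcc, disjoint_insert_left, disjoint_singleton_left]
      have := hℬ hB
      tauto
  have hA24 : ∀ A ∈ 𝒜, 2 ∈ A ∨ 4 ∈ A := by
    intro A hA
    have := hmeet {2, 4} (hpair h2Ω h4Ω) (card_le_two.trans hk) (fun X hX h =>
      hG X hX (by simp only [insert_subset_iff, singleton_subset_iff] at h; tauto)) A hA
    simp only [disjoint_insert_right, disjoint_singleton_right] at this
    tauto
  rcases lex_closed_dichotomy hℬ hlex (p := fun X => 1 ∈ X ∨ 2 ∈ X) (by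
    intro X hX B hB hpX hpB
    have h1 := hlt X hX B hB 1
    have h2 := hlt X hX B hB 2
    grind) with hH | hH
  swap
  · refine le_trans (Nat.mul_le_mul ?_ ?_) hb1
    · refine (card_le_card fun A hA => ?_).trans (card_union_le _ _)
      have h1 := h𝒜 hA
      have h2 := hA1 A hA
      have h3 := hA23 A hA
      have h4 := hA24 A hA
      simp only [mem_union, mem_containing, insert_subset_iff, singleton_subset_iff,
        disjoint_empty_left, disjoint_singleton_left]
      tauto
    · refine (card_le_card fun B hB => ?_).trans (card_union_le _ _)
      have h1 := hℬ hB
      have h2 := hH B hB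
      simp only [mem_union, mem_containing, singleton_subset_iff,
        disjoint_empty_left, disjoint_singleton_left]
      tauto
  have hA2 : ∀ A ∈ 𝒜, 2 ∈ A := by
    intro A hA
    simpa using hmeet {2} (by simpa) (by simp; lia) (fun X hX h =>
      hH X hX (Or.inr (by simpa using h))) A hA
  rcases lex_closed_dichotomy hℬ hlex (p := fun X => 1 ∈ X ∨ 2 ∈ X ∨ 3 ∈ X ∧ 4 ∈ X) (by
    intro X hX B hB hpX hpB
    have h1 := hlt X hX B hB 1
    have h2 := hlt X hX B hB 2
    have h3 := hlt X hX B hB 3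
    have h4 := hlt X hX B hB 4
    grind) with hI | hI
  swap
  · refine le_trans (Nat.mul_le_mul ?_ ?_) hb2
    · refine card_le_card fun A hA => ?_
      have h1 := h𝒜 hA
      have h2 := hA1 A hA
      have h3 := hA2 A hA
      simp only [mem_containing, insert_subset_iff, singleton_subset_iff, disjoint_empty_left]
      tauto
    · refine (card_le_card fun B hB => ?_).trans
        ((card_union_le _ _).trans (Nat.add_le_add_right (card_union_le _ _) _))
      have h1 := hℬ hB
      have h2 := hI B hB
      simp only [mem_union, mem_containing, insert_subset_iff, singleton_subset_iff,
        disjoint_empty_left, disjoint_singleton_left, disjoint_insert_left]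
      tauto
  · refine le_trans (Nat.mul_le_mul ?_ ?_) hb3
    · refine (card_le_card fun A hA => ?_).trans (card_union_le _ _)
      have h1 := h𝒜 hA
      have h2 := hA1 A hA
      have h3 := hA2 A hA
      have h4 := hmeet {3, 4} (hpair h3Ω h4Ω) (card_le_two.trans hk) (fun X hX h =>
        hI X hX (by simp only [insert_subset_iff, singleton_subset_iff] at h; tauto)) A hA
      simp only [disjoint_insert_right, disjoint_singleton_right] at h4
      simp only [mem_union, mem_containing, insert_subset_iff, singleton_subset_iff,
        disjoint_empty_left, disjoint_singleton_left]
      tauto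
    · exact card_le_card hℬ

theorem card_mul_card_le_of_lexFamily_subset {n k j : ℕ} (hn : 2 * k ≤ n) (hj : 3 ≤ j)
    (hjk : j ≤ k + 1) {𝒜 ℬ : Finset (Finset ℕ)} (h𝒜 : 𝒜 ⊆ powersetCard k (Icc 1 n))
    (hℬ : ℬ ⊆ powersetCard k (Icc 1 n)) (hcross : ∀ A ∈ 𝒜, ∀ B ∈ ℬ, ¬ Disjoint A B)
    (hlex : ∀ B ∈ ℬ, ∀ X ∈ powersetCard k (Icc 1 n), LexPrec X B → X ∈ ℬ)
    (hF : lexFamily n k j ⊆ ℬ) :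
    #𝒜 * #ℬ ≤ #(dualFamily n k j) * #(lexFamily n k j) := by
  induction j, hj using Nat.le_induction with
  | base =>
    exact card_mul_card_le_of_lexFamily_three (by lia) hn h𝒜 hℬ hcross hlex hF
  | succ j hj ih =>
    rcases lex_closed_dichotomy hℬ hlex (p := fun X => 1 ∈ X ∨ Icc 2 j ⊆ X)
      (fun X hX B hB => lexPrec_of_prefix (zero_notMem_of_mem_powersetCard hX)
        (zero_notMem_of_mem_powersetCard hB)) with h | h
    · refine (ih (by lia) fun X hX => ?_).trans
        (card_dualFamily_mul_card_lexFamily_le_succ hn hj (by lia))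
      rw [lexFamily, mem_filter] at hX
      exact h X hX.1 hX.2
    · have hΩ : 2 * k ≤ #(Icc 1 n) := by simpa
      have hIcc : Icc 2 (j + 1) = insert (j + 1) (Icc 2 j) := by
        ext
        simp
        lia
      refine card_mul_card_le_of_extension (S := Icc 2 j) (R := {1, j + 1}) hΩ
        (Icc_subset_Icc (by lia) (by lia)) (by simp [insert_subset_iff]; lia) (by simp)
        ((card_le_two).trans (by simp; lia)) (card_le_two.trans (by lia)) hcross ?_ ?_ ?_
        (card_dualFamily_le_card_lexFamily _ _ _) (card_le_card hF)
      · intro A hA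
        refine mem_filter.2 ⟨h𝒜 hA, ?_, ?_⟩
        · have := not_disjoint_of_containing_subset (S := {1}) hΩ (by simp; lia) (by simp; lia)
            (fun X hX h => hF (mem_filter.2 ⟨hX, Or.inl (by simpa using h)⟩)) (h𝒜 hA) (hcross A hA)
          simpa using this
        · exact not_disjoint_of_containing_subset hΩ (Icc_subset_Icc (by lia) (by lia))
            (by simp; lia) (fun X hX h => hF (mem_filter.2 ⟨hX, Or.inr h⟩)) (h𝒜 hA) (hcross A hA)
      · intro A hA
        simp only [mem_containing, insert_subset_iff, singleton_subset_iff] at hA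
        refine mem_filter.2 ⟨hA.1, hA.2.1.1, ?_⟩
        rw [hIcc, disjoint_insert_right]
        tauto
      · intro B hB
        have h1 := h B hB
        have h2 := hℬ hB
        simp only [mem_union, lexFamily, mem_filter, mem_containing, hIcc, insert_subset_iff,
          disjoint_insert_left, disjoint_singleton_left]
        tauto

/-- Theorem 2: if `𝓐, 𝓑` are cross-intersecting families of `k`-subsets of `[n]`,
`n ≥ 2k > 0`, and `|𝓑| ≥ binom(n-1,k-1) + binom(n-i,k-i+1)` for some `3 ≤ i ≤ k+1`,
then `|𝓐|·|𝓑| ≤ (binom(n-1,k-1) + binom(n-i,k-i+1))·(binom(n-1,k-1) − binom(n-i,k-1))`. -/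
theorem thm2 (n k i : ℕ) (hk : 0 < k) (hn : 2 * k ≤ n)
    (hi3 : 3 ≤ i) (hik : i ≤ k + 1)
    (𝓐 𝓑 : Finset (Finset ℕ))
    (h𝓐 : ∀ A ∈ 𝓐, A ⊆ Finset.Icc 1 n ∧ A.card = k)
    (h𝓑 : ∀ B ∈ 𝓑, B ⊆ Finset.Icc 1 n ∧ B.card = k)
    (hcross : ∀ A ∈ 𝓐, ∀ B ∈ 𝓑, (A ∩ B).Nonempty)
    (hB_ge : (n - 1).choose (k - 1) + (n - i).choose (k + 1 - i) ≤ 𝓑.card) :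
    𝓐.card * 𝓑.card ≤
      ((n - 1).choose (k - 1) + (n - i).choose (k + 1 - i)) *
        ((n - 1).choose (k - 1) - (n - i).choose (k - 1)) := by
  have h𝓐' : 𝓐 ⊆ powersetCard k (Icc 1 n) := fun A hA => mem_powersetCard.2 (h𝓐 A hA)
  have h𝓑' : 𝓑 ⊆ powersetCard k (Icc 1 n) := fun B hB => mem_powersetCard.2 (h𝓑 B hB)
  obtain ⟨𝒜, h𝒜, ℬ, hℬ, hcross', h𝒜card, hℬcard, hlex⟩ := exists_lex_crossIntersecting hn h𝓐' h𝓑'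
    fun A hA B hB => not_disjoint_iff_nonempty_inter.2 (hcross A hA B hB)
  rw [← card_lexFamily hn hi3 hik, ← hℬcard] at hB_ge
  rw [← card_lexFamily hn hi3 hik, ← card_dualFamily hn hi3 hik, ← hℬcard,
    mul_comm #(lexFamily n k i)]
  refine (Nat.mul_le_mul_right _ h𝒜card).trans
    (card_mul_card_le_of_lexFamily_subset hn hi3 hik h𝒜 hℬ hcross' hlex ?_)
  rcases lex_closed_dichotomy hℬ hlex (p := fun X => 1 ∈ X ∨ Icc 2 i ⊆ X)
    (fun X hX B hB => lexPrec_of_prefix (zero_notMem_of_mem_powersetCard hX)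
      (zero_notMem_of_mem_powersetCard hB)) with h | h
  · intro X hX
    rw [lexFamily, mem_filter] at hX
    exact h X hX.1 hX.2
  · exact (eq_of_subset_of_card_le (fun B hB => mem_filter.2 ⟨hℬ hB, h B hB⟩) hB_ge).ge
end

section
/- Let n, k be positive integers with n ≥ 2k, and let 𝓐 and 𝓑 be cross-intersecting families of k-subsets of [n] such that |𝓐| ≥ binom(n-2, k-2) and |𝓑| ≥ binom(n-2, k-2). Then |𝓐| + |𝓑| ≤ 2·binom(n-1, k-1). -/
open Finset Finset.Colex
open scoped FinsetFamily

namespace CrossIntersecting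

lemma card_powersetCard_filter_superset {α : Type*} [DecidableEq α] {S U : Finset α} {j : ℕ}
    (hSU : S ⊆ U) (hSj : #S ≤ j) :
    #{Z ∈ powersetCard j U | S ⊆ Z} = (#U - #S).choose (j - #S) := by
  rw [← card_sdiff_of_subset hSU, ← card_powersetCard]
  refine card_nbij' (· \ S) (· ∪ S) ?_ ?_ ?_ ?_
  · intro Z hZ
    simp only [coe_filter, mem_powersetCard, Set.mem_ofPred_eq] at hZ
    simp only [mem_coe, mem_powersetCard]
    exact ⟨sdiff_subset_sdiff hZ.1.1 le_rfl, by rw [card_sdiff_of_subset hZ.2, hZ.1.2]⟩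
  · intro Z hZ
    simp only [mem_coe, mem_powersetCard] at hZ
    have hd : Disjoint Z S := disjoint_of_subset_left hZ.1 sdiff_disjoint
    simp only [coe_filter, mem_powersetCard, Set.mem_ofPred_eq]
    refine ⟨⟨union_subset (hZ.1.trans sdiff_subset) hSU, ?_⟩, subset_union_right⟩
    rw [card_union_of_disjoint hd, hZ.2]
    omega
  · intro Z hZ
    simp only [coe_filter, mem_powersetCard, Set.mem_ofPred_eq] at hZ
    exact sdiff_union_of_subset hZ.2
  · intro Z hZ
    simp only [mem_coe, mem_powersetCard] at hZ
    have hd : Disjoint Z S := disjoint_of_subset_left hZ.1 sdiff_disjoint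
    exact union_sdiff_cancel_right hd

lemma exists_isInitSeg_card_eq {α : Type*} [LinearOrder α] [Fintype α] (r : ℕ) {m : ℕ}
    (hm : m ≤ (Fintype.card α).choose r) :
    ∃ 𝒞 : Finset (Finset α), IsInitSeg 𝒞 r ∧ #𝒞 = m := by
  induction m with
  | zero => exact ⟨∅, isInitSeg_empty, rfl⟩
  | succ m ih =>
    obtain ⟨𝒞, h𝒞, rfl⟩ := ih (by omega)
    have hne : (powersetCard r univ \ 𝒞).Nonempty := by
      refine sdiff_nonempty.2 fun h => ?_
      have := card_le_card h
      rw [card_powersetCard, card_univ] at this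
      omega
    obtain ⟨x, hx, hmin⟩ := exists_min_image _ toColex hne
    simp only [mem_sdiff, mem_powersetCard, subset_univ, true_and] at hx hmin
    refine ⟨insert x 𝒞, ⟨?_, ?_⟩, card_insert_of_notMem hx.2⟩
    · intro s hs
      rcases mem_insert.1 hs with rfl | hs
      exacts [hx.1, h𝒞.1 hs]
    · rintro s t hs ⟨hts, ht⟩
      rcases mem_insert.1 hs with rfl | hs
      · by_contra h
        rw [mem_insert, not_or] at h
        exact absurd (hmin t ⟨ht, h.2⟩) (not_le_of_gt hts)
      · exact mem_insert_of_mem (h𝒞.2 hs ⟨hts, ht⟩)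

lemma toColex_lt_toColex_of_mem {α : Type*} [LinearOrder α] {s t : Finset α} {a : α}
    (hat : a ∈ t) (has : a ∉ s) (h : ∀ b ∈ s, b ≤ a ∨ b ∈ t) : toColex s < toColex t := by
  refine lt_of_le_of_ne (toColex_le_toColex.2 fun b hb hbt => ⟨a, hat, has, ?_⟩) ?_
  · exact (h b hb).resolve_right hbt
  · rintro hst
    exact has (toColex_inj.1 hst ▸ hat)

/-- An initial segment of the colex order whose iterated shadow is not too large contains no set
with both of the two largest elements. -/
lemma notMem_of_isInitSeg {m r : ℕ} (hr : 1 ≤ r) (hrm : 2 * r ≤ m)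
    {D : Finset (Finset (Fin (m + 2)))} (hD : IsInitSeg D (m + 1 - r))
    (hE : #(∂^[m - 2 * r] D) + m.choose (r - 1) ≤ (m + 2).choose (r + 1))
    {X : Finset (Fin (m + 2))} (hX : X ∈ D) (hlast : Fin.last (m + 1) ∈ X) :
    (Fin.last m).castSucc ∉ X := by
  set a := Fin.last (m + 1)
  set b := (Fin.last m).castSucc
  intro hb
  have hab : a ≠ b := by simp [a, b, Fin.ext_iff]
  have hle : ∀ c : Fin (m + 2), c ≤ b ∨ c = a := by
    intro c
    simp only [a, b, Fin.le_def, Fin.ext_iff, Fin.val_castSucc, Fin.val_last]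
    omega
  have hXc := hD.1 hX
  have hmem : ∀ Z : Finset (Fin (m + 2)), #Z = m + 1 - r → (a ∉ Z ∨ b ∉ Z) → Z ∈ D := by
    rintro Z hZ h
    refine hD.2 hX ⟨?_, hZ⟩
    rcases h with h | h
    · exact toColex_lt_toColex_of_mem hlast h fun c _ => Or.inl (Fin.le_last c)
    · exact toColex_lt_toColex_of_mem hb h fun c _ => (hle c).imp_right (by rintro rfl; exact hlast)
  have hshadow : ∀ Y : Finset (Fin (m + 2)), #Y = r + 1 → (a ∉ Y ∨ b ∉ Y) →
      Y ∈ ∂^[m - 2 * r] D := by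
    have key : ∀ c, (∀ Z : Finset (Fin (m + 2)), #Z = m + 1 - r → c ∉ Z → Z ∈ D) →
        ∀ Y : Finset (Fin (m + 2)), #Y = r + 1 → c ∉ Y → Y ∈ ∂^[m - 2 * r] D := by
      intro c hc Y hY hcY
      obtain ⟨Z, hYZ, hZ, hZc⟩ := exists_subsuperset_card_eq (s := Y) (t := univ.erase c)
        (n := m + 1 - r) (fun y hy => mem_erase.2 ⟨fun h => hcY (h ▸ hy), mem_univ _⟩)
        (by omega) (by rw [card_erase_of_mem (mem_univ _), card_univ, Fintype.card_fin]; omega)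
      refine mem_shadow_iterate_iff_exists_mem_card_add.2 ⟨Z, hc Z hZc fun h => ?_, hYZ, by omega⟩
      exact (mem_erase.1 (hZ h)).1 rfl
    rintro Y hY (h | h)
    · exact key a (fun Z hZ h => hmem Z hZ (Or.inl h)) Y hY h
    · exact key b (fun Z hZ h => hmem Z hZ (Or.inr h)) Y hY h
  obtain ⟨Y, habY, hYX, hYc⟩ := exists_subsuperset_card_eq (s := {a, b}) (t := X) (n := r + 1)
    (by simp [insert_subset_iff, hlast, hb]) (by rw [card_pair hab]; omega) (by omega)
  have hYE : Y ∈ ∂^[m - 2 * r] D :=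
    mem_shadow_iterate_iff_exists_mem_card_add.2 ⟨X, hX, hYX, by omega⟩
  have hsub : powersetCard (r + 1) univ \ ∂^[m - 2 * r] D ⊆
      {Z ∈ powersetCard (r + 1) (univ : Finset (Fin (m + 2))) | {a, b} ⊆ Z}.erase Y := by
    intro Z hZ
    simp only [mem_sdiff, mem_powersetCard, subset_univ, true_and] at hZ
    simp only [mem_erase, mem_filter, mem_powersetCard, subset_univ, true_and, insert_subset_iff,
      singleton_subset_iff]
    refine ⟨fun h => hZ.2 (h ▸ hYE), hZ.1, ?_⟩
    by_contra h
    exact hZ.2 (hshadow Z hZ.1 (by tauto))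
  have h1 := card_le_card hsub
  have hYmem : Y ∈ {Z ∈ powersetCard (r + 1) (univ : Finset (Fin (m + 2))) | {a, b} ⊆ Z} := by
    simp [hYc, habY]
  have hpos := card_pos.2 ⟨Y, hYmem⟩
  rw [card_erase_of_mem hYmem] at h1
  rw [card_powersetCard_filter_superset (subset_univ _) (by rw [card_pair hab]; omega),
    card_pair hab, card_univ, Fintype.card_fin] at h1 hpos
  have h2 := le_card_sdiff (∂^[m - 2 * r] D) (powersetCard (r + 1) univ)
  rw [card_powersetCard, card_univ, Fintype.card_fin] at h2
  rw [show m + 1 + 1 - 2 = m by omega, show r + 1 - 2 = r - 1 by omega] at h1 hpos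
  omega

lemma card_add_choose_le_card_shadow_add_choose {m r : ℕ} (hr : 1 ≤ r) (hrm : 2 * r ≤ m)
    {D : Finset (Finset (Fin (m + 2)))} (hD : IsInitSeg D (m + 1 - r))
    (hcard : (m + 1).choose r < #D)
    (hE : #(∂^[m - 2 * r] D) + m.choose (r - 1) ≤ (m + 2).choose (r + 1)) :
    #D + (m + 1).choose (r + 1) ≤ #(∂^[m - 2 * r] D) + (m + 1).choose r := by
  set a := Fin.last (m + 1)
  set b := (Fin.last m).castSucc
  set E := ∂^[m - 2 * r] D
  have hab : a ≠ b := by simp [a, b, Fin.ext_iff]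
  have hcua : #((univ : Finset (Fin (m + 2))).erase a) = m + 1 := by
    rw [card_erase_of_mem (mem_univ _), card_univ, Fintype.card_fin]; omega
  have hcub : #((univ : Finset (Fin (m + 2))).erase b) = m + 1 := by
    rw [card_erase_of_mem (mem_univ _), card_univ, Fintype.card_fin]; omega
  have hsubE : ∀ {c : Fin (m + 2)} {Z}, c ∉ Z → Z ⊆ univ.erase c := fun hcZ y hy =>
    mem_erase.2 ⟨fun h => hcZ (h ▸ hy), mem_univ _⟩
  have hsymm : (m + 1).choose (m + 1 - r) = (m + 1).choose r := Nat.choose_symm (by omega)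
  have hD0 : #{X ∈ D | a ∉ X} ≤ (m + 1).choose r := by
    refine (card_le_card (t := powersetCard (m + 1 - r) (univ.erase a)) fun X hX => ?_).trans_eq
      (by rw [card_powersetCard, hcua, hsymm])
    rw [mem_filter] at hX
    exact mem_powersetCard.2 ⟨hsubE hX.2, hD.1 hX.1⟩
  have hsplitD := card_filter_add_card_filter_not (s := D) (fun X => a ∈ X)
  have hsplitE := card_filter_add_card_filter_not (s := E) (fun X => a ∈ X)
  obtain ⟨X, hX⟩ : {X ∈ D | a ∈ X}.Nonempty := card_pos.1 (by omega)
  rw [mem_filter] at hX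
  have hE0 : (m + 1).choose (r + 1) ≤ #{Y ∈ E | a ∉ Y} := by
    refine Eq.trans_le (by rw [card_powersetCard, hcua])
      (card_le_card (s := powersetCard (r + 1) (univ.erase a)) fun Y hY => ?_)
    obtain ⟨hYa, hYc⟩ := mem_powersetCard.1 hY
    obtain ⟨Z, hYZ, hZ, hZc⟩ := exists_subsuperset_card_eq (n := m + 1 - r) hYa
      (by omega) (by omega)
    have haZ : a ∉ Z := fun h => (mem_erase.1 (hZ h)).1 rfl
    refine mem_filter.2 ⟨mem_shadow_iterate_iff_exists_mem_card_add.2 ⟨Z, ?_, hYZ, by omega⟩,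
      fun h => haZ (hYZ h)⟩
    exact hD.2 hX.1 ⟨toColex_lt_toColex_of_mem hX.2 haZ fun c _ => Or.inl (Fin.le_last c), hZc⟩
  have hD1 : #{X ∈ D | a ∈ X} ≤ #{Y ∈ E | a ∈ Y} := by
    have hpos : 0 < (m - r).choose r := Nat.choose_pos (by omega)
    refine Nat.le_of_mul_le_mul_right ?_ hpos
    refine card_mul_le_card_mul (fun X Y => Y ⊆ X) ?_ ?_
    · intro X hX
      rw [mem_filter] at hX
      have hXc := hD.1 hX.1
      have h := card_powersetCard_filter_superset (S := {a}) (U := X) (j := r + 1)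
        (by simpa using hX.2) (by simp)
      rw [card_singleton, hXc, Nat.add_sub_cancel, show m + 1 - r - 1 = m - r by omega] at h
      rw [← h]
      refine card_le_card fun Y hY => ?_
      simp only [mem_filter, mem_powersetCard, singleton_subset_iff] at hY
      simp only [bipartiteAbove, mem_filter]
      exact ⟨⟨mem_shadow_iterate_iff_exists_mem_card_add.2 ⟨X, hX.1, hY.1.1, by omega⟩, hY.2⟩,
        hY.1.1⟩
    · intro Y hY
      rw [mem_filter] at hY
      obtain ⟨Z, hZ, hYZ, hZY⟩ := mem_shadow_iterate_iff_exists_mem_card_add.1 hY.1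
      have hZc := hD.1 hZ
      have hbY : b ∉ Y := fun h => notMem_of_isInitSeg hr hrm hD hE hZ (hYZ hY.2) (hYZ h)
      have h := card_powersetCard_filter_superset (S := Y) (U := univ.erase b) (j := m + 1 - r)
        (hsubE hbY) (by omega)
      rw [hcub, show m + 1 - #Y = m - r by omega, show m + 1 - r - #Y = m - r - r by omega,
        Nat.choose_symm (by omega)] at h
      rw [← h]
      refine card_le_card fun X hX => ?_
      simp only [bipartiteBelow, mem_filter] at hX
      simp only [mem_filter, mem_powersetCard]
      exact ⟨⟨hsubE (notMem_of_isInitSeg hr hrm hD hE hX.1.1 hX.1.2), hD.1 hX.1.1⟩, hX.2⟩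
  omega

lemma card_add_card_le_of_choose_lt {m r : ℕ} (hr : 1 ≤ r) (hrm : 2 * r ≤ m)
    {𝓐 𝓑 : Finset (Finset (Fin (m + 2)))}
    (h𝓐 : (𝓐 : Set (Finset (Fin (m + 2)))).Sized (r + 1))
    (h𝓑 : (𝓑 : Set (Finset (Fin (m + 2)))).Sized (r + 1))
    (hcross : ∀ A ∈ 𝓐, ∀ B ∈ 𝓑, (A ∩ B).Nonempty)
    (hA : m.choose (r - 1) ≤ #𝓐) (hB : (m + 1).choose r < #𝓑) :
    #𝓐 + #𝓑 ≤ 2 * (m + 1).choose r := by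
  have hco : (𝓑ᶜˢ : Set (Finset (Fin (m + 2)))).Sized (m + 1 - r) := by
    intro s hs
    have := h𝓑 (mem_compls.1 hs)
    rw [card_compl, Fintype.card_fin] at this
    have := card_le_univ s
    rw [Fintype.card_fin] at this
    omega
  have hcle : #𝓑 ≤ (Fintype.card (Fin (m + 2))).choose (m + 1 - r) := by
    rw [← card_compls, ← card_univ, ← card_powersetCard]
    exact card_le_card fun s hs => mem_powersetCard.2 ⟨subset_univ _, hco hs⟩
  obtain ⟨D, hD, hDc⟩ := exists_isInitSeg_card_eq _ hcle
  have hkk : #(∂^[m - 2 * r] D) ≤ #(∂^[m - 2 * r] 𝓑ᶜˢ) :=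
    iterated_kk hco (by rw [hDc, card_compls]) hD
  have hdisj : Disjoint 𝓐 (∂^[m - 2 * r] 𝓑ᶜˢ) := by
    refine disjoint_left.2 fun A hA hA' => ?_
    obtain ⟨s, hs, hAs, -⟩ := mem_shadow_iterate_iff_exists_mem_card_add.1 hA'
    obtain ⟨x, hx⟩ := hcross A hA _ (mem_compls.1 hs)
    rw [mem_inter, mem_compl] at hx
    exact hx.2 (hAs hx.1)
  have htot : #𝓐 + #(∂^[m - 2 * r] 𝓑ᶜˢ) ≤ (m + 2).choose (r + 1) := by
    rw [← card_union_of_disjoint hdisj]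
    calc _ ≤ #(powersetCard (r + 1) (univ : Finset (Fin (m + 2)))) := by
          refine card_le_card (union_subset (fun s hs => ?_) fun s hs => ?_)
          · exact mem_powersetCard.2 ⟨subset_univ _, h𝓐 hs⟩
          · obtain ⟨t, ht, -, hst⟩ := mem_shadow_iterate_iff_exists_mem_card_add.1 hs
            have := hco ht
            exact mem_powersetCard.2 ⟨subset_univ _, by omega⟩
      _ = _ := by rw [card_powersetCard, card_univ, Fintype.card_fin]
  have := card_add_choose_le_card_shadow_add_choose hr hrm hD (by omega) (by omega)
  have hp : (m + 2).choose (r + 1) = (m + 1).choose r + (m + 1).choose (r + 1) :=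
    Nat.choose_succ_succ _ _
  omega

lemma card_add_card_le {m r : ℕ} (hr : 1 ≤ r) (hrm : 2 * r ≤ m)
    {𝓐 𝓑 : Finset (Finset (Fin (m + 2)))}
    (h𝓐 : (𝓐 : Set (Finset (Fin (m + 2)))).Sized (r + 1))
    (h𝓑 : (𝓑 : Set (Finset (Fin (m + 2)))).Sized (r + 1))
    (hcross : ∀ A ∈ 𝓐, ∀ B ∈ 𝓑, (A ∩ B).Nonempty)
    (hA : m.choose (r - 1) ≤ #𝓐) (hB : m.choose (r - 1) ≤ #𝓑) :
    #𝓐 + #𝓑 ≤ 2 * (m + 1).choose r := by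
  by_cases h1 : (m + 1).choose r < #𝓑
  · exact card_add_card_le_of_choose_lt hr hrm h𝓐 h𝓑 hcross hA h1
  by_cases h2 : (m + 1).choose r < #𝓐
  · rw [add_comm]
    exact card_add_card_le_of_choose_lt hr hrm h𝓑 h𝓐
      (fun B hB A hA => inter_comm A B ▸ hcross A hA B hB) hB h2
  omega

/-- The elements of `[n]` lying in `A`, shifted to `Fin n`. -/
def toFin (n : ℕ) (A : Finset ℕ) : Finset (Fin n) := {i | i.val + 1 ∈ A}

lemma mem_toFin {n : ℕ} {A : Finset ℕ} {i : Fin n} : i ∈ toFin n A ↔ i.val + 1 ∈ A := by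
  simp [toFin]

lemma image_toFin {n : ℕ} {A : Finset ℕ} (hA : A ⊆ Icc 1 n) :
    (toFin n A).image (fun i => i.val + 1) = A := by
  ext x
  simp only [mem_image, mem_toFin]
  constructor
  · rintro ⟨i, hi, rfl⟩
    exact hi
  · intro hx
    have := mem_Icc.1 (hA hx)
    exact ⟨⟨x - 1, by omega⟩, by simpa [Nat.sub_add_cancel this.1] using hx, by simp; omega⟩

lemma card_toFin {n : ℕ} {A : Finset ℕ} (hA : A ⊆ Icc 1 n) : #(toFin n A) = #A := by
  conv_rhs => rw [← image_toFin hA]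
  refine (card_image_of_injective _ fun i j h => ?_).symm
  simpa [Fin.ext_iff] using h

lemma card_image_toFin {n : ℕ} {𝓐 : Finset (Finset ℕ)} (h𝓐 : ∀ A ∈ 𝓐, A ⊆ Icc 1 n) :
    #(𝓐.image (toFin n)) = #𝓐 := by
  refine card_image_of_injOn fun A hA B hB h => ?_
  rw [← image_toFin (h𝓐 A hA), ← image_toFin (h𝓐 B hB), h]

lemma toFin_inter_nonempty {n : ℕ} {A B : Finset ℕ} (hA : A ⊆ Icc 1 n)
    (h : (A ∩ B).Nonempty) : (toFin n A ∩ toFin n B).Nonempty := by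
  obtain ⟨x, hx⟩ := h
  rw [mem_inter] at hx
  have := mem_Icc.1 (hA hx.1)
  refine ⟨⟨x - 1, by omega⟩, ?_⟩
  simpa [mem_toFin, Nat.sub_add_cancel this.1] using hx

lemma card_le_one_of_cross {𝓐 𝓑 : Finset (Finset ℕ)} (h𝓐 : ∀ A ∈ 𝓐, #A = 1)
    (h𝓑 : ∀ B ∈ 𝓑, #B = 1) (hcross : ∀ A ∈ 𝓐, ∀ B ∈ 𝓑, (A ∩ B).Nonempty) (hne : 𝓑.Nonempty) :
    #𝓐 ≤ 1 := by
  obtain ⟨B, hB⟩ := hne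
  obtain ⟨b, rfl⟩ := card_eq_one.1 (h𝓑 B hB)
  have key : ∀ A ∈ 𝓐, A = {b} := by
    intro A hA
    obtain ⟨a, rfl⟩ := card_eq_one.1 (h𝓐 A hA)
    obtain ⟨x, hx⟩ := hcross _ hA _ hB
    simp only [mem_inter, mem_singleton] at hx
    rw [← hx.1, ← hx.2]
  exact card_le_one.2 fun A hA A' hA' => (key A hA).trans (key A' hA').symm

end CrossIntersecting

open CrossIntersecting in
/-- Proposition 1: if `𝓐, 𝓑` are cross-intersecting families of `k`-subsets of `[n]`,
`n ≥ 2k`, `k ≥ 1`, and both families have size at least `binom(n-2,k-2)`, then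
`|𝓐| + |𝓑| ≤ 2·binom(n-1,k-1)`. -/
theorem prop1 (n k : ℕ) (hk : 0 < k) (hn : 2 * k ≤ n)
    (𝓐 𝓑 : Finset (Finset ℕ))
    (h𝓐 : ∀ A ∈ 𝓐, A ⊆ Finset.Icc 1 n ∧ A.card = k)
    (h𝓑 : ∀ B ∈ 𝓑, B ⊆ Finset.Icc 1 n ∧ B.card = k)
    (hcross : ∀ A ∈ 𝓐, ∀ B ∈ 𝓑, (A ∩ B).Nonempty)
    (hA_ge : (n - 2).choose (k - 2) ≤ 𝓐.card)
    (hB_ge : (n - 2).choose (k - 2) ≤ 𝓑.card) :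
    𝓐.card + 𝓑.card ≤ 2 * (n - 1).choose (k - 1) := by
  obtain rfl | hk2 := Nat.eq_or_lt_of_le hk
  · simp only [Nat.succ_eq_add_one, zero_add, Nat.reduceSub, Nat.choose_zero_right]
      at hA_ge hB_ge ⊢
    have h1 := card_le_one_of_cross (fun A hA => (h𝓐 A hA).2) (fun B hB => (h𝓑 B hB).2) hcross
      (Finset.card_pos.1 hB_ge)
    have h2 := card_le_one_of_cross (fun B hB => (h𝓑 B hB).2) (fun A hA => (h𝓐 A hA).2)
      (fun B hB A hA => Finset.inter_comm A B ▸ hcross A hA B hB) (Finset.card_pos.1 hA_ge)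
    omega
  obtain ⟨r, rfl⟩ : ∃ r, k = r + 1 := ⟨k - 1, by omega⟩
  obtain ⟨m, rfl⟩ : ∃ m, n = m + 2 := ⟨n - 2, by omega⟩
  have hA' : ∀ A ∈ 𝓐, A ⊆ Finset.Icc 1 (m + 2) := fun A hA => (h𝓐 A hA).1
  have hB' : ∀ B ∈ 𝓑, B ⊆ Finset.Icc 1 (m + 2) := fun B hB => (h𝓑 B hB).1
  rw [← card_image_toFin hA'] at hA_ge ⊢
  rw [← card_image_toFin hB'] at hB_ge ⊢
  refine card_add_card_le (r := r) (by omega) (by omega) ?_ ?_ ?_ hA_ge hB_ge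
  · intro s hs
    obtain ⟨A, hA, rfl⟩ := Finset.mem_image.1 hs
    rw [card_toFin (hA' A hA), (h𝓐 A hA).2]
  · intro s hs
    obtain ⟨B, hB, rfl⟩ := Finset.mem_image.1 hs
    rw [card_toFin (hB' B hB), (h𝓑 B hB).2]
  · intro s hs t ht
    obtain ⟨A, hA, rfl⟩ := Finset.mem_image.1 hs
    obtain ⟨B, hB, rfl⟩ := Finset.mem_image.1 ht
    exact toFin_inter_nonempty (hA' A hA) (hcross A hA B hB)
end

section
/- Let 𝓐 be a family of a-subsets of [n] and 𝓑 a family of b-subsets of [n] which are cross-intersecting. Then the lexicographic initial segments L^(a)(|𝓐|) and L^(b)(|𝓑|) are also cross-intersecting. -/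
/-- `F` strictly precedes `G` in the lexicographic order on finite sets of
positive integers: `min (F \ G) < min (G \ F)`. -/
def LexLt (F G : Finset ℕ) : Prop := (F \ G).min < (G \ F).min

/-- `𝓛` is an initial segment of the lexicographic order on `k`-subsets of
`[n] = {1,…,n}`: it consists of `k`-subsets of `[n]` and is closed downwards
under the lexicographic order. -/
def IsLexSegment (n k : ℕ) (𝓛 : Finset (Finset ℕ)) : Prop :=
  (∀ F ∈ 𝓛, F ⊆ Finset.Icc 1 n ∧ F.card = k) ∧
    ∀ F : Finset ℕ, F ⊆ Finset.Icc 1 n → F.card = k →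
      ∀ G ∈ 𝓛, LexLt F G → F ∈ 𝓛

open Finset Finset.Colex
open scoped FinsetFamily

namespace Finset.Colex

lemma IsInitSeg.shadow_iterate {α : Type*} [LinearOrder α] [Finite α]
    {𝒜 : Finset (Finset α)} {r : ℕ} (h : IsInitSeg 𝒜 r) (k : ℕ) :
    IsInitSeg (∂^[k] 𝒜) (r - k) := by
  induction k with
  | zero => simpa using h
  | succ k ih =>
    rw [Function.iterate_succ_apply', ← Nat.sub_sub]
    exact ih.shadow

lemma toColex_compl_lt_toColex_compl {α : Type*} [LinearOrder α] [Fintype α]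
    {s t : Finset α} : toColex sᶜ < toColex tᶜ ↔ toColex t < toColex s := by
  simp only [toColex_lt_toColex_iff_exists_forall_lt, mem_compl, not_not]
  grind

/-- A colex up-set `𝒰` at level `b` meets no down-closure of a colex initial segment `ℐ`,
as soon as the same holds for some families of the same sizes. -/
lemma not_subset_of_isInitSeg {n b c : ℕ} {𝒞 ℬ ℐ 𝒰 : Finset (Finset (Fin n))}
    (h𝒞 : (𝒞 : Set (Finset (Fin n))).Sized c) (hℬ : (ℬ : Set (Finset (Fin n))).Sized b)
    (hℬ𝒞 : ∀ B ∈ ℬ, ∀ C ∈ 𝒞, ¬ B ⊆ C) (hℐ : IsInitSeg ℐ c) (hℐ𝒞 : #ℐ ≤ #𝒞)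
    (h𝒰 : (𝒰 : Set (Finset (Fin n))).Sized b)
    (h𝒰_up : ∀ S ∈ 𝒰, ∀ T : Finset (Fin n), #T = b → toColex S < toColex T → T ∈ 𝒰)
    (hℬ𝒰 : #ℬ = #𝒰) : ∀ S ∈ 𝒰, ∀ T ∈ ℐ, ¬ S ⊆ T := by
  intro S hS T hT hST
  have hSb : #S = b := h𝒰 hS
  have hTc : #T = c := hℐ.1 hT
  have hbc : b ≤ c := hSb ▸ hTc ▸ card_le_card hST
  have hinit : IsInitSeg (∂^[c - b] ℐ) b := by
    simpa [Nat.sub_sub_self hbc] using hℐ.shadow_iterate (c - b)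
  have hSmem : S ∈ ∂^[c - b] ℐ :=
    mem_shadow_iterate_iff_exists_mem_card_add.2 ⟨T, hT, hST, by omega⟩
  have hcover : powersetCard b univ ⊆ ∂^[c - b] ℐ ∪ 𝒰 := by
    intro R hR
    have hRb : #R = b := (mem_powersetCard.1 hR).2
    rcases lt_trichotomy (toColex R) (toColex S) with h | h | h
    · exact mem_union_left _ (hinit.2 hSmem ⟨h, hRb⟩)
    · rw [toColex_inj.1 h]
      exact mem_union_right _ hS
    · exact mem_union_right _ (h𝒰_up S hS R hRb h)
  have hinter : 0 < #(∂^[c - b] ℐ ∩ 𝒰) := card_pos.2 ⟨S, mem_inter.2 ⟨hSmem, hS⟩⟩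
  have hdisj : Disjoint (∂^[c - b] 𝒞) ℬ := by
    refine disjoint_left.2 fun R hR hRℬ => ?_
    obtain ⟨C, hC, hRC, -⟩ := mem_shadow_iterate_iff_exists_mem_card_add.1 hR
    exact hℬ𝒞 R hRℬ C hC hRC
  have hlevel : ∂^[c - b] 𝒞 ∪ ℬ ⊆ powersetCard b univ := by
    refine union_subset (fun R hR => ?_) fun R hR =>
      mem_powersetCard.2 ⟨subset_univ _, hℬ hR⟩
    obtain ⟨C, hC, -, hcard⟩ := mem_shadow_iterate_iff_exists_mem_card_add.1 hR
    have := h𝒞 hC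
    exact mem_powersetCard.2 ⟨subset_univ _, by omega⟩
  have hkk := iterated_kk (k := c - b) h𝒞 hℐ𝒞 hℐ
  have h1 := card_le_card hcover
  have h2 := card_le_card hlevel
  rw [card_union_of_disjoint hdisj] at h2
  have h3 := card_union_add_card_inter (∂^[c - b] ℐ) 𝒰
  omega

end Finset.Colex

/-- The order-reversing embedding of `Fin n` onto `{1,…,n}`. -/
def revEmb (n : ℕ) : Fin n ↪ ℕ where
  toFun i := n - i
  inj' i j h := by ext; dsimp at h; omega

lemma revEmb_apply {n : ℕ} (i : Fin n) : revEmb n i = n - i := rfl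

lemma exists_revEmb_eq {n x : ℕ} (hx : x ∈ Icc 1 n) : ∃ i, revEmb n i = x := by
  rw [mem_Icc] at hx
  exact ⟨⟨n - x, by omega⟩, by rw [revEmb_apply, Fin.val_mk]; omega⟩

lemma revEmb_lt_revEmb {n : ℕ} {i j : Fin n} : revEmb n i < revEmb n j ↔ j < i := by
  simp only [revEmb_apply, Fin.lt_def]
  omega

lemma map_revEmb_subset {n : ℕ} (S : Finset (Fin n)) : S.map (revEmb n) ⊆ Icc 1 n := by
  intro x hx
  obtain ⟨i, -, rfl⟩ := mem_map.1 hx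
  simp only [revEmb_apply, mem_Icc]
  omega

/-- The subset of `Fin n` corresponding to `F ∩ {1,…,n}` under `revEmb`. -/
def revPull (n : ℕ) (F : Finset ℕ) : Finset (Fin n) := {i | revEmb n i ∈ F}

@[simp] lemma mem_revPull {n : ℕ} {F : Finset ℕ} {i : Fin n} :
    i ∈ revPull n F ↔ revEmb n i ∈ F := by simp [revPull]

lemma map_revPull {n : ℕ} {F : Finset ℕ} (hF : F ⊆ Icc 1 n) :
    (revPull n F).map (revEmb n) = F := by
  ext x
  simp only [mem_map, mem_revPull]
  constructor
  · rintro ⟨i, hi, rfl⟩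
    exact hi
  · intro hx
    obtain ⟨i, rfl⟩ := exists_revEmb_eq (hF hx)
    exact ⟨i, hx, rfl⟩

lemma revPull_map {n : ℕ} (S : Finset (Fin n)) : revPull n (S.map (revEmb n)) = S := by
  ext i
  simp

lemma card_revPull {n : ℕ} {F : Finset ℕ} (hF : F ⊆ Icc 1 n) : #(revPull n F) = #F := by
  rw [← card_map (revEmb n), map_revPull hF]

lemma card_image_revPull {n : ℕ} {𝓕 : Finset (Finset ℕ)} (h𝓕 : ∀ F ∈ 𝓕, F ⊆ Icc 1 n) :
    #(𝓕.image (revPull n)) = #𝓕 := by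
  refine card_image_of_injOn fun F hF G hG h => ?_
  rw [← map_revPull (h𝓕 F hF), ← map_revPull (h𝓕 G hG)]
  exact congrArg _ h

lemma inter_nonempty_iff_not_revPull_subset {n : ℕ} {F G : Finset ℕ} (hF : F ⊆ Icc 1 n) :
    (F ∩ G).Nonempty ↔ ¬ revPull n G ⊆ (revPull n F)ᶜ := by
  constructor
  · rintro ⟨x, hx⟩ h
    rw [mem_inter] at hx
    obtain ⟨i, rfl⟩ := exists_revEmb_eq (hF hx.1)
    exact mem_compl.1 (h (mem_revPull.2 hx.2)) (mem_revPull.2 hx.1)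
  · intro h
    obtain ⟨i, hiG, hiF⟩ := not_subset.1 h
    exact ⟨revEmb n i, by simpa [and_comm] using And.intro hiG hiF⟩

lemma lexLt_of_toColex_revPull_lt {n : ℕ} {F G : Finset ℕ} (hG : G ⊆ Icc 1 n)
    (h : toColex (revPull n G) < toColex (revPull n F)) : LexLt F G := by
  obtain ⟨i, hiF, hiG, hi⟩ := toColex_lt_toColex_iff_exists_forall_lt.1 h
  rw [mem_revPull] at hiF hiG
  refine (min_le (mem_sdiff.2 ⟨hiF, hiG⟩)).trans_lt ?_
  rw [Finset.min_eq_inf_withTop, Finset.lt_inf_iff (WithTop.coe_lt_top _)]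
  intro x hx
  rw [mem_sdiff] at hx
  obtain ⟨j, rfl⟩ := exists_revEmb_eq (hG hx.1)
  exact WithTop.coe_lt_coe.2 (revEmb_lt_revEmb.2
    (hi j (mem_revPull.2 hx.1) fun hj => hx.2 (mem_revPull.1 hj)))

lemma IsLexSegment.mem_image_revPull {n k : ℕ} {𝓛 : Finset (Finset ℕ)}
    (h𝓛 : IsLexSegment n k 𝓛) {S T : Finset (Fin n)} (hS : S ∈ 𝓛.image (revPull n))
    (hT : #T = k) (hST : toColex S < toColex T) : T ∈ 𝓛.image (revPull n) := by
  obtain ⟨G, hG, rfl⟩ := mem_image.1 hS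
  refine mem_image.2 ⟨T.map (revEmb n), ?_, revPull_map T⟩
  refine h𝓛.2 _ (map_revEmb_subset T) (by rw [card_map, hT]) G hG ?_
  exact lexLt_of_toColex_revPull_lt (h𝓛.1 G hG).1 (by rwa [revPull_map])

lemma sized_image_revPull {n k : ℕ} {𝓕 : Finset (Finset ℕ)}
    (h𝓕 : ∀ F ∈ 𝓕, F ⊆ Icc 1 n ∧ #F = k) :
    (𝓕.image (revPull n) : Set (Finset (Fin n))).Sized k := by
  intro S hS
  obtain ⟨F, hF, rfl⟩ := mem_image.1 (mem_coe.1 hS)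
  rw [card_revPull (h𝓕 F hF).1, (h𝓕 F hF).2]

lemma IsLexSegment.isInitSeg_compls {n k : ℕ} {𝓛 : Finset (Finset ℕ)}
    (h𝓛 : IsLexSegment n k 𝓛) : IsInitSeg (𝓛.image (revPull n))ᶜˢ (n - k) := by
  refine ⟨by simpa using (sized_image_revPull h𝓛.1).compls, fun S T hS hT => ?_⟩
  rw [mem_compls] at hS ⊢
  have hSk : #Sᶜ = k := sized_image_revPull h𝓛.1 hS
  have hle : k ≤ n := by simpa [hSk] using card_le_univ Sᶜ
  refine h𝓛.mem_image_revPull hS ?_ (toColex_compl_lt_toColex_compl.2 hT.1)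
  rw [card_compl, Fintype.card_fin, hT.2]
  omega

/-- Hilton's Lemma: if `𝓐 ⊆ ([n] choose a)` and `𝓑 ⊆ ([n] choose b)` are
cross-intersecting, then the lexicographic initial segments `L^(a)(|𝓐|)` and
`L^(b)(|𝓑|)` are cross-intersecting as well. -/
theorem hilton_lemma (n a b : ℕ)
    (𝓐 𝓑 𝓛a 𝓛b : Finset (Finset ℕ))
    (h𝓐 : ∀ A ∈ 𝓐, A ⊆ Finset.Icc 1 n ∧ A.card = a)
    (h𝓑 : ∀ B ∈ 𝓑, B ⊆ Finset.Icc 1 n ∧ B.card = b)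
    (hcross : ∀ A ∈ 𝓐, ∀ B ∈ 𝓑, (A ∩ B).Nonempty)
    (h𝓛a : IsLexSegment n a 𝓛a) (h𝓛acard : 𝓛a.card = 𝓐.card)
    (h𝓛b : IsLexSegment n b 𝓛b) (h𝓛bcard : 𝓛b.card = 𝓑.card) :
    ∀ F ∈ 𝓛a, ∀ G ∈ 𝓛b, (F ∩ G).Nonempty := by
  intro F hF G hG
  rw [inter_nonempty_iff_not_revPull_subset (h𝓛a.1 F hF).1]
  refine not_subset_of_isInitSeg (𝒞 := (𝓐.image (revPull n))ᶜˢ) (ℬ := 𝓑.image (revPull n))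
    (ℐ := (𝓛a.image (revPull n))ᶜˢ) (𝒰 := 𝓛b.image (revPull n)) (b := b) (c := n - a)
    (by simpa using (sized_image_revPull h𝓐).compls) (sized_image_revPull h𝓑) ?_
    h𝓛a.isInitSeg_compls ?_ (sized_image_revPull h𝓛b.1)
    (fun S hS T hT hST => h𝓛b.mem_image_revPull hS hT hST) ?_
    _ (mem_image_of_mem _ hG) _ (mem_compls.2 (by simpa using mem_image_of_mem _ hF))
  · intro S hS T hT hST
    obtain ⟨B, hB, rfl⟩ := mem_image.1 hS
    obtain ⟨A, hA, hAT⟩ := mem_image.1 (mem_compls.1 hT)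
    rw [← compl_compl T, ← hAT] at hST
    exact (inter_nonempty_iff_not_revPull_subset (h𝓐 A hA).1).1 (hcross A hA B hB) hST
  · rw [card_compls, card_compls, card_image_revPull fun A hA => (h𝓐 A hA).1,
      card_image_revPull fun A hA => (h𝓛a.1 A hA).1, h𝓛acard]
  · rw [card_image_revPull fun B hB => (h𝓑 B hB).1,
      card_image_revPull fun B hB => (h𝓛b.1 B hB).1, h𝓛bcard]
end
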